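/- arXiv:0907.3912 — 2 statements merged into one kernel-verified Lean document; each statement's English description precedes it below -/
import Mathlib

section
/- Green's Theorem 4: Assume char k = 0. Let I ⊆ R = k[x_1,…,x_r] be a homogeneous ideal, r ≥ 3, and let d, m be integers with 1 ≤ m ≤ d. Suppose that h_d = dim_k (R/I)_d = md + 1 − C(m−1, 2) and that for a general linear form L one has dim_k (R/(I + (L)))_d = m. Then in degree d, I is the ideal of a plane curve of degree m: there exist linearly independent linear forms L_1,…,L_{r−3} ∈ R_1 and a form F of degree m such that I_d = span_k(L_1,…,L_{r−3})·R_{d−1} + F·R_{d−m}. -/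
open MvPolynomial

/-- The degree-`d` graded component of `R/I` (the image of the space of
degree-`d` homogeneous polynomials in the quotient), as a `k`-submodule. -/
noncomputable def gradedPiece (k : Type*) [Field k] (r : ℕ)
    (I : Ideal (MvPolynomial (Fin r) k)) (d : ℕ) :
    Submodule k (MvPolynomial (Fin r) k ⧸ I) :=
  Submodule.map (Ideal.Quotient.mkₐ k I).toLinearMap
    (homogeneousSubmodule (Fin r) k d)

/-- The Hilbert function of `R/I` in degree `d`. -/
noncomputable def hilb (k : Type*) [Field k] (r : ℕ)
    (I : Ideal (MvPolynomial (Fin r) k)) (d : ℕ) : ℕ :=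
  Module.finrank k (gradedPiece k r I d)

/-- `I` is a homogeneous ideal. -/
def IsHomogIdeal {k : Type*} [Field k] {r : ℕ}
    (I : Ideal (MvPolynomial (Fin r) k)) : Prop :=
  ∀ f ∈ I, ∀ n : ℕ, homogeneousComponent n f ∈ I

/-- `I` contains no nonzero linear forms. -/
def NoLinearForms {k : Type*} [Field k] {r : ℕ}
    (I : Ideal (MvPolynomial (Fin r) k)) : Prop :=
  ∀ f ∈ I, f.IsHomogeneous 1 → f = 0

/-- The dimension of the degree-`i` component of the socle of `R/I`. -/
noncomputable def socDim (k : Type*) [Field k] (r : ℕ)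
    (I : Ideal (MvPolynomial (Fin r) k)) (i : ℕ) : ℕ :=
  Module.finrank k (Submodule.map (Ideal.Quotient.mkₐ k I).toLinearMap
    (homogeneousSubmodule (Fin r) k i ⊓
      ⨅ j : Fin r, Submodule.comap (LinearMap.mulLeft k (X j))
        (Submodule.restrictScalars k I)))

/-- `R/I` is a standard graded artinian algebra:
`I` is homogeneous and `R/I` is finite-dimensional over `k`. -/
def StdArtinian (k : Type*) [Field k] (r : ℕ)
    (I : Ideal (MvPolynomial (Fin r) k)) : Prop :=
  IsHomogIdeal I ∧ Module.Finite k (MvPolynomial (Fin r) k ⧸ I)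

/-- `R/I` has socle degree `e`: `e` is the largest degree with nonzero
Hilbert function. -/
def SocleDegree (k : Type*) [Field k] (r : ℕ)
    (I : Ideal (MvPolynomial (Fin r) k)) (e : ℕ) : Prop :=
  hilb k r I e ≠ 0 ∧ ∀ j : ℕ, e < j → hilb k r I j = 0

/-- `R/I` is a standard graded artinian Gorenstein algebra of socle degree `e`:
the socle vanishes below degree `e` and is one-dimensional in degree `e`. -/
def Gorenstein (k : Type*) [Field k] (r e : ℕ)
    (I : Ideal (MvPolynomial (Fin r) k)) : Prop :=
  StdArtinian k r I ∧ SocleDegree k r I e ∧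
    (∀ i : ℕ, i < e → socDim k r I i = 0) ∧ socDim k r I e = 1

/-- `R/I` is a standard graded artinian level algebra of socle degree `e`. -/
def LevelAlg (k : Type*) [Field k] (r e : ℕ)
    (I : Ideal (MvPolynomial (Fin r) k)) : Prop :=
  StdArtinian k r I ∧ SocleDegree k r I e ∧
    (∀ i : ℕ, i < e → socDim k r I i = 0)

/-- The linear form with coefficient vector `c`. -/
noncomputable def linForm {k : Type*} [Field k] {r : ℕ} (c : Fin r → k) :
    MvPolynomial (Fin r) k :=
  ∑ i, C (c i) * X i

/-- A property `P` holds for a general linear form: there is a nonempty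
(basic) Zariski-open subset of the space of linear forms on which `P` holds. -/
def Generically (k : Type*) [Field k] (r : ℕ)
    (P : MvPolynomial (Fin r) k → Prop) : Prop :=
  ∃ Q : MvPolynomial (Fin r) k, Q ≠ 0 ∧
    ∀ c : Fin r → k, eval c Q ≠ 0 → P (linForm c)

/-- `R/I` has the weak Lefschetz property (socle degree `e`): multiplication
by some linear form has maximal rank from each degree `i < e` to degree `i+1`. -/
def WLP (k : Type*) [Field k] (r e : ℕ)
    (I : Ideal (MvPolynomial (Fin r) k)) : Prop :=
  ∃ L : MvPolynomial (Fin r) k, L.IsHomogeneous 1 ∧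
    ∀ i : ℕ, i < e →
      Module.finrank k (Submodule.map
        (LinearMap.mulLeft k (Ideal.Quotient.mk I L)) (gradedPiece k r I i)) =
      min (hilb k r I i) (hilb k r I (i + 1))

/-- The largest `t` with `choose t i ≤ n`: the leading top in the
`i`-binomial expansion of `n`. -/
noncomputable def binTop (n i : ℕ) : ℕ := sSup {t : ℕ | Nat.choose t i ≤ n}

/-- Auxiliary recursion computing `((n)_{(i)})⁻¹₀`, i.e. the sum
`C(n_i - 1, i) + C(n_{i-1} - 1, i-1) + ⋯ + C(n_j - 1, j)` where
`n_{(i)} = C(n_i, i) + ⋯ + C(n_j, j)` is the `i`-binomial expansion of `n`. -/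
noncomputable def greenBoundAux : ℕ → ℕ → ℕ
  | 0, _ => 0
  | (i + 1), n =>
    if n = 0 then 0 else
      Nat.choose (binTop n (i + 1) - 1) (i + 1) +
        greenBoundAux i (n - Nat.choose (binTop n (i + 1)) (i + 1))

/-- `greenBound n i = ((n)_{(i)})⁻¹₀`. -/
noncomputable def greenBound (n i : ℕ) : ℕ := greenBoundAux i n

namespace GreenPlaneCurve

/-! ### Generic points of affine space -/

/-- The filter on affine space generated by the nonempty Zariski-open sets. -/
def genericFilter (k σ : Type*) [Field k] : Filter (σ → k) where
  sets := {s | ∃ Q : MvPolynomial σ k, Q ≠ 0 ∧ ∀ c, eval c Q ≠ 0 → c ∈ s}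
  univ_sets := ⟨1, one_ne_zero, fun _ _ => trivial⟩
  sets_of_superset := by
    rintro s t ⟨Q, hQ, h⟩ hst
    exact ⟨Q, hQ, fun c hc => hst (h c hc)⟩
  inter_sets := by
    rintro s t ⟨Q, hQ, h⟩ ⟨Q', hQ', h'⟩
    refine ⟨Q * Q', mul_ne_zero hQ hQ', fun c hc => ?_⟩
    rw [map_mul] at hc
    exact ⟨h c (left_ne_zero_of_mul hc), h' c (right_ne_zero_of_mul hc)⟩

section Generic

variable {k σ : Type*} [Field k]

lemma eventually_generic_iff {P : (σ → k) → Prop} :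
    (∀ᶠ c in genericFilter k σ, P c) ↔
      ∃ Q : MvPolynomial σ k, Q ≠ 0 ∧ ∀ c, eval c Q ≠ 0 → P c :=
  Iff.rfl

instance [Infinite k] : (genericFilter k σ).NeBot := by
  refine ⟨fun h => ?_⟩
  obtain ⟨Q, hQ, h⟩ := Filter.empty_mem_iff_bot.mpr h
  refine hQ (MvPolynomial.funext fun c => ?_)
  by_contra hc
  exact h c (by simpa using hc)

/-- A function on affine space given by evaluating a polynomial. -/
def IsPolyFun (p : (σ → k) → k) : Prop :=
  ∃ P : MvPolynomial σ k, ∀ c, p c = eval c P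

namespace IsPolyFun

lemma const (a : k) : IsPolyFun (fun _ : σ → k => a) := ⟨C a, by simp⟩

lemma coord (i : σ) : IsPolyFun (fun c : σ → k => c i) := ⟨X i, by simp⟩

lemma mul {p q : (σ → k) → k} (hp : IsPolyFun p) (hq : IsPolyFun q) :
    IsPolyFun (fun c => p c * q c) := by
  obtain ⟨P, hP⟩ := hp
  obtain ⟨Q, hQ⟩ := hq
  exact ⟨P * Q, fun c => by simp [hP, hQ]⟩

lemma sum {ι : Type*} (s : Finset ι) {p : ι → (σ → k) → k} (hp : ∀ i ∈ s, IsPolyFun (p i)) :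
    IsPolyFun (fun c => ∑ i ∈ s, p i c) := by
  classical
  choose! P hP using hp
  exact ⟨∑ i ∈ s, P i, fun c => by
    rw [map_sum]; exact Finset.sum_congr rfl fun i hi => hP i hi c⟩

lemma comp_line {p : (σ → k) → k} (hp : IsPolyFun p) (c₀ c₁ : σ → k) :
    IsPolyFun (fun τ : Unit → k => p (c₀ + τ () • c₁)) := by
  obtain ⟨P, hP⟩ := hp
  refine ⟨bind₁ (fun i => C (c₀ i) + X () * C (c₁ i)) P, fun τ => ?_⟩
  change p _ = _
  rw [hP, ← coe_aeval_eq_eval, ← coe_aeval_eq_eval, RingHom.coe_coe, RingHom.coe_coe,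
    aeval_bind₁]
  congr 2
  ext i
  simp

end IsPolyFun

variable {X Y : Type*} [AddCommGroup X] [Module k X] [AddCommGroup Y] [Module k Y]

/-- Linear independence is an open condition on a family depending polynomially on parameters. -/
lemma eventually_linearIndependent {ι : Type*} [Finite ι] (v : (σ → k) → ι → Y)
    (hv : ∀ (g : Y →ₗ[k] k) (i : ι), IsPolyFun fun c => g (v c i))
    (c₀ : σ → k) (h : LinearIndependent k (v c₀)) :
    ∀ᶠ c in genericFilter k σ, LinearIndependent k (v c) := by
  classical
  cases nonempty_fintype ι
  obtain ⟨g, hg⟩ := LinearMap.exists_leftInverse_of_injective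
    (Fintype.linearCombination k (v c₀))
    (LinearMap.ker_eq_bot.mpr h.fintypeLinearCombination_injective)
  have hgv : ∀ i, g (v c₀ i) = Pi.single i 1 := fun i => by
    have := LinearMap.congr_fun hg (Pi.single i 1)
    simpa using this
  choose P hP using fun i j => hv (LinearMap.proj j ∘ₗ g) i
  have hdet : ∀ c, eval c (Matrix.det (Matrix.of P)) = Matrix.det fun i => g (v c i) := by
    intro c
    rw [RingHom.map_det]
    congr 1
    ext i j
    simpa using (hP i j c).symm
  refine eventually_generic_iff.mpr ⟨Matrix.det (Matrix.of P), fun h0 => ?_, fun c hc => ?_⟩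
  · have h1 := hdet c₀
    have h2 : (fun i => g (v c₀ i)) = (1 : Matrix ι ι k) := by
      ext i j
      rw [hgv, Matrix.one_apply, Pi.single_apply]
      simp [eq_comm]
    rw [h0, map_zero, h2, Matrix.det_one] at h1
    exact zero_ne_one h1
  · rw [hdet] at hc
    exact LinearIndependent.of_comp g (Matrix.linearIndependent_rows_of_det_ne_zero hc)

/-- The rank of a polynomial family of linear maps is lower semicontinuous. -/
lemma eventually_finrank_range_le [Module.Finite k X] (Φ : (σ → k) → X →ₗ[k] Y)
    (hΦ : ∀ (g : Y →ₗ[k] k) (x : X), IsPolyFun fun c => g (Φ c x)) (c₀ : σ → k) :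
    ∀ᶠ c in genericFilter k σ,
      Module.finrank k (LinearMap.range (Φ c₀)) ≤ Module.finrank k (LinearMap.range (Φ c)) := by
  have b := Module.finBasis k (LinearMap.range (Φ c₀))
  choose w hw using fun i => (b i).2
  have hli : LinearIndependent k fun i => Φ c₀ (w i) := by
    simp_rw [hw]
    exact b.linearIndependent.map' _ (Submodule.ker_subtype _)
  filter_upwards [eventually_linearIndependent (fun c i => Φ c (w i)) (fun g i => hΦ g (w i)) c₀ hli]
    with c hc
  have : LinearIndependent k fun i => (⟨Φ c (w i), ⟨w i, rfl⟩⟩ : LinearMap.range (Φ c)) :=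
    LinearIndependent.of_comp (LinearMap.range (Φ c)).subtype hc
  simpa using this.fintype_card_le_finrank

/-- If the rank of a one-parameter polynomial family `Ψ` is maximal at `0` and
`Ψ t f = t • y t`, then `y 0` lies in the range of `Ψ 0`. -/
lemma mem_range_of_finrank_range_le [Infinite k] [Module.Finite k X] (Ψ : k → X →ₗ[k] Y) (y : k → Y)
    (hΨ : ∀ (g : Y →ₗ[k] k) (x : X), IsPolyFun fun τ : Unit → k => g (Ψ (τ ()) x))
    (hy : ∀ g : Y →ₗ[k] k, IsPolyFun fun τ : Unit → k => g (y (τ ())))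
    (hmax : ∀ t, Module.finrank k (LinearMap.range (Ψ t)) ≤
      Module.finrank k (LinearMap.range (Ψ 0)))
    (f : X) (hf : ∀ t, Ψ t f = t • y t) : y 0 ∈ LinearMap.range (Ψ 0) := by
  by_contra hnot
  have b := Module.finBasis k (LinearMap.range (Ψ 0))
  choose w hw using fun i => (b i).2
  have hli : LinearIndependent k fun i => Ψ 0 (w i) := by
    simp_rw [hw]
    exact b.linearIndependent.map' _ (Submodule.ker_subtype _)
  let v : (Unit → k) → Option (Fin (Module.finrank k (LinearMap.range (Ψ 0)))) → Y :=
    fun τ o => o.elim (y (τ ())) fun i => Ψ (τ ()) (w i)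
  have hv0 : LinearIndependent k (v 0) := by
    rw [linearIndependent_option]
    refine ⟨hli, fun hmem => hnot ?_⟩
    refine Submodule.span_le.mpr ?_ hmem
    rintro _ ⟨i, rfl⟩
    exact ⟨w i, rfl⟩
  have hev := eventually_linearIndependent v (fun g o => by
    cases o with
    | none => exact hy g
    | some i => exact hΨ g (w i)) 0 hv0
  have hne : ∀ᶠ τ in genericFilter k Unit, τ () ≠ 0 :=
    eventually_generic_iff.mpr ⟨MvPolynomial.X (), X_ne_zero _, fun c hc => by simpa using hc⟩
  obtain ⟨τ, hτ, hτ0⟩ := (hev.and hne).exists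
  have hmem : ∀ o, v τ o ∈ LinearMap.range (Ψ (τ ())) := by
    rintro (_ | i)
    · refine ⟨(τ ())⁻¹ • f, ?_⟩
      rw [map_smul, hf, smul_smul, inv_mul_cancel₀ hτ0, one_smul]
      rfl
    · exact ⟨w i, rfl⟩
  have : LinearIndependent k fun o => (⟨v τ o, hmem o⟩ : LinearMap.range (Ψ (τ ()))) :=
    LinearIndependent.of_comp (LinearMap.range (Ψ (τ ()))).subtype hτ
  have h1 := this.fintype_card_le_finrank
  have h2 := hmax (τ ())
  simp only [Fintype.card_option, Fintype.card_fin] at h1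
  omega

end Generic

section Forms

variable {k : Type*} [Field k] {r : ℕ}

/-! ### Linear forms -/

lemma linForm_add (c c' : Fin r → k) : linForm (c + c') = linForm c + linForm c' := by
  simp [linForm, add_mul, Finset.sum_add_distrib]

lemma linForm_smul (a : k) (c : Fin r → k) : linForm (a • c) = a • linForm c := by
  simp [linForm, Finset.smul_sum, smul_eq_C_mul, mul_assoc]

/-- `linForm` as a linear map. -/
noncomputable def linFormₗ (k : Type*) [Field k] (r : ℕ) :
    (Fin r → k) →ₗ[k] MvPolynomial (Fin r) k where
  toFun := linForm
  map_add' := linForm_add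
  map_smul' := linForm_smul

lemma linForm_single (i : Fin r) : linForm (Pi.single i (1 : k)) = X i := by
  classical
  simp [linForm, Pi.single_apply]

lemma coeff_linForm (c : Fin r → k) (i : Fin r) :
    coeff (Finsupp.single i 1) (linForm c) = c i := by
  classical
  simp [linForm, coeff_sum, coeff_C_mul, coeff_X, Finsupp.single_left_inj]

lemma linFormₗ_injective : Function.Injective (linFormₗ k r) := by
  intro c c' h
  ext i
  rw [← coeff_linForm c, ← coeff_linForm c']
  exact congrArg _ h

lemma linForm_zero : linForm (0 : Fin r → k) = 0 := (linFormₗ k r).map_zero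

lemma linForm_sub (c c' : Fin r → k) : linForm (c - c') = linForm c - linForm c' :=
  (linFormₗ k r).map_sub c c'

lemma linForm_eq_zero_iff {c : Fin r → k} : linForm c = 0 ↔ c = 0 :=
  (linFormₗ k r).map_eq_zero_iff linFormₗ_injective

lemma isHomogeneous_linForm (c : Fin r → k) : (linForm c).IsHomogeneous 1 :=
  IsHomogeneous.sum _ _ _ fun _ _ => isHomogeneous_C_mul_X _ _

lemma isHomogeneous_linForm_pow (c : Fin r → k) (a : ℕ) : (linForm c ^ a).IsHomogeneous a := by
  simpa using (isHomogeneous_linForm c).pow a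

lemma exists_linForm_eq {f : MvPolynomial (Fin r) k} (hf : f.IsHomogeneous 1) :
    ∃ c, linForm c = f := by
  have h : f ∈ homogeneousSubmodule (Fin r) k 1 := hf
  rw [homogeneousSubmodule_one_eq_span_X] at h
  have : Submodule.span k (Set.range X) ≤ LinearMap.range (linFormₗ k r) := by
    rw [Submodule.span_le]
    rintro _ ⟨i, rfl⟩
    exact ⟨Pi.single i 1, linForm_single i⟩
  exact this h

lemma eventually_ne_zero (hr : 0 < r) : ∀ᶠ c in genericFilter k (Fin r), c ≠ 0 :=
  eventually_generic_iff.mpr ⟨X ⟨0, hr⟩, X_ne_zero _, fun c hc h => by simp [h] at hc⟩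

/-- A general point avoids a proper linear subspace. -/
lemma eventually_notMem {U : Submodule k (Fin r → k)} (hU : U ≠ ⊤) :
    ∀ᶠ c in genericFilter k (Fin r), c ∉ U := by
  obtain ⟨x, -, hx⟩ := SetLike.exists_of_lt (lt_top_iff_ne_top.mpr hU)
  obtain ⟨g, hg, hgU⟩ := Submodule.exists_dual_map_eq_bot_of_notMem hx inferInstance
  have hval : ∀ c : Fin r → k, g c = eval c (linForm fun i => g (Pi.single i 1)) := by
    intro c
    conv_lhs => rw [← Finset.univ_sum_single c]
    rw [map_sum]
    simp only [linForm, map_sum, map_mul, eval_C, eval_X]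
    refine Finset.sum_congr rfl fun i _ => ?_
    rw [show Pi.single i (c i) = c i • Pi.single i (1 : k) by
      rw [← Pi.single_smul, smul_eq_mul, mul_one], map_smul, smul_eq_mul, mul_comm]
  refine eventually_generic_iff.mpr
    ⟨linForm fun i => g (Pi.single i 1), fun h0 => hg ?_, fun c hc hcU => hc ?_⟩
  · rw [hval, h0, map_zero]
  · rw [← hval]
    have : g c ∈ U.map g := ⟨c, hcU, rfl⟩
    rw [hgU] at this
    simpa using this

lemma eventually_forall_notMem_of_eventually {P : (Fin r → k) → Prop} [Infinite k]
    (hP : ∀ᶠ c in genericFilter k (Fin r), P c) {U : Submodule k (Fin r → k)}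
    (hU : ∀ c, P c → c ∈ U) : U = ⊤ := by
  by_contra h
  obtain ⟨c, hc, h_not⟩ := (hP.and (eventually_notMem h)).exists
  exact h_not (hU c hc)

/-! ### Subspaces of forms of a fixed degree -/

instance finite_homogeneousSubmodule (n : ℕ) : Module.Finite k (homogeneousSubmodule (Fin r) k n) :=
  Module.Finite.iff_fg.mpr (homogeneousSubmodule_fg _ _ n)

/-- The codimension of a subspace of the space of forms of degree `n`. -/
noncomputable def cod (n : ℕ) (V : Submodule k (MvPolynomial (Fin r) k)) : ℕ :=
  Module.finrank k (homogeneousSubmodule (Fin r) k n) - Module.finrank k V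

/-- The subspace spanned by `V` and the multiples of `F` by forms of degree `e`. -/
noncomputable def add (V : Submodule k (MvPolynomial (Fin r) k)) (F : MvPolynomial (Fin r) k)
    (e : ℕ) : Submodule k (MvPolynomial (Fin r) k) :=
  V ⊔ Submodule.map (LinearMap.mulLeft k F) (homogeneousSubmodule (Fin r) k e)

/-- The forms of degree `e` whose product with `F` lies in `V`. -/
noncomputable def col (V : Submodule k (MvPolynomial (Fin r) k)) (F : MvPolynomial (Fin r) k)
    (e : ℕ) : Submodule k (MvPolynomial (Fin r) k) :=
  homogeneousSubmodule (Fin r) k e ⊓ Submodule.comap (LinearMap.mulLeft k F) V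

variable {V V' : Submodule k (MvPolynomial (Fin r) k)} {F : MvPolynomial (Fin r) k} {n e a : ℕ}

lemma mem_col {f : MvPolynomial (Fin r) k} : f ∈ col V F e ↔ f.IsHomogeneous e ∧ F * f ∈ V :=
  Iff.rfl

lemma mem_add {f : MvPolynomial (Fin r) k} :
    f ∈ add V F e ↔ ∃ v ∈ V, ∃ g : MvPolynomial (Fin r) k, g.IsHomogeneous e ∧ v + F * g = f := by
  simp [add, Submodule.mem_sup]

lemma le_add : V ≤ add V F e := le_sup_left

lemma mul_mem_add {g : MvPolynomial (Fin r) k} (hg : g.IsHomogeneous e) : F * g ∈ add V F e :=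
  mem_add.mpr ⟨0, V.zero_mem, g, hg, zero_add _⟩

lemma add_right_comm (F' : MvPolynomial (Fin r) k) (e' : ℕ) :
    add (add V F e) F' e' = add (add V F' e') F e := by
  exact sup_right_comm _ _ _

lemma col_le : col V F e ≤ homogeneousSubmodule (Fin r) k e := inf_le_left

lemma add_le (hV : V ≤ homogeneousSubmodule (Fin r) k n) (hF : F.IsHomogeneous a) (h : a + e = n) :
    add V F e ≤ homogeneousSubmodule (Fin r) k n := by
  refine sup_le hV ?_
  rintro _ ⟨g, hg, rfl⟩
  exact h ▸ hF.mul hg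

lemma finite_of_le (hV : V ≤ homogeneousSubmodule (Fin r) k n) : Module.Finite k V :=
  Submodule.finiteDimensional_of_le hV

lemma cod_add_finrank (hV : V ≤ homogeneousSubmodule (Fin r) k n) :
    cod n V + Module.finrank k V = Module.finrank k (homogeneousSubmodule (Fin r) k n) :=
  Nat.sub_add_cancel (Submodule.finrank_mono hV)

lemma cod_anti (hV' : V' ≤ homogeneousSubmodule (Fin r) k n) (h : V ≤ V') : cod n V' ≤ cod n V :=
  have := finite_of_le hV'
  Nat.sub_le_sub_left (Submodule.finrank_mono h) _

lemma eq_of_le_of_cod_le (hV' : V' ≤ homogeneousSubmodule (Fin r) k n) (h : V ≤ V')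
    (hc : cod n V ≤ cod n V') : V = V' := by
  have := finite_of_le hV'
  have h1 := cod_add_finrank hV'
  have h2 := cod_add_finrank (h.trans hV')
  exact Submodule.eq_of_le_of_finrank_le h (by omega)

lemma cod_self : cod n (homogeneousSubmodule (Fin r) k n) = 0 := Nat.sub_self _

lemma eq_of_cod_eq_zero (hV : V ≤ homogeneousSubmodule (Fin r) k n) (h : cod n V = 0) :
    V = homogeneousSubmodule (Fin r) k n :=
  eq_of_le_of_cod_le le_rfl hV (by omega)

/-- Additivity of codimension along multiplication by a nonzero form. -/
lemma cod_eq_col_add (hV : V ≤ homogeneousSubmodule (Fin r) k n) (hF : F.IsHomogeneous a)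
    (hF0 : F ≠ 0) (h : a + e = n) : cod n V = cod e (col V F e) + cod n (add V F e) := by
  have := finite_of_le hV
  have hinj : Function.Injective (LinearMap.mulLeft k F) := mul_right_injective₀ hF0
  have h1 := Submodule.finrank_sup_add_finrank_inf_eq V
    (Submodule.map (LinearMap.mulLeft k F) (homogeneousSubmodule (Fin r) k e))
  have h2 : V ⊓ Submodule.map (LinearMap.mulLeft k F) (homogeneousSubmodule (Fin r) k e) =
      Submodule.map (LinearMap.mulLeft k F) (col V F e) := by
    ext f
    constructor
    · rintro ⟨hf, g, hg, rfl⟩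
      exact ⟨g, ⟨hg, hf⟩, rfl⟩
    · rintro ⟨g, ⟨hg, hf⟩, rfl⟩
      exact ⟨hf, g, hg, rfl⟩
  rw [h2, ← (Submodule.equivMapOfInjective _ hinj _).finrank_eq,
    ← (Submodule.equivMapOfInjective _ hinj _).finrank_eq] at h1
  have h3 := cod_add_finrank hV
  have h4 := cod_add_finrank (add_le hV hF h)
  have h5 := cod_add_finrank (col_le : col V F e ≤ _)
  have h6 : add V F e = V ⊔ Submodule.map (LinearMap.mulLeft k F)
    (homogeneousSubmodule (Fin r) k e) := rfl
  rw [h6] at h4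
  rw [h6]
  omega

lemma finrank_map_mkQ {T : Submodule k (MvPolynomial (Fin r) k)} [Module.Finite k T]
    (h : V ≤ T) : Module.finrank k (T.map V.mkQ) + Module.finrank k V = Module.finrank k T := by
  have h1 := LinearMap.finrank_range_add_finrank_ker (V.mkQ.domRestrict T)
  rw [LinearMap.range_domRestrict, LinearMap.ker_domRestrict, Submodule.ker_mkQ,
    (Submodule.comapSubtypeEquivOfLe h).finrank_eq] at h1
  exact h1

end Forms

section Genericity

variable {k : Type*} [Field k] {r : ℕ}
variable {V V' : Submodule k (MvPolynomial (Fin r) k)} {n e a m : ℕ}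

/-! ### Sections by general linear forms -/

lemma isPolyFun_linForm_pow (g : MvPolynomial (Fin r) k →ₗ[k] k) (a : ℕ)
    (w : MvPolynomial (Fin r) k) : IsPolyFun fun c : Fin r → k => g (linForm c ^ a * w) := by
  induction a generalizing w with
  | zero => simpa using IsPolyFun.const (g w)
  | succ a ih =>
    have : (fun c : Fin r → k => g (linForm c ^ (a + 1) * w)) =
        fun c => ∑ i, c i * g (linForm c ^ a * (X i * w)) := by
      funext c
      rw [pow_succ, mul_assoc, linForm, Finset.sum_mul, Finset.mul_sum, map_sum]
      refine Finset.sum_congr rfl fun i _ => ?_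
      rw [mul_assoc, mul_left_comm, ← smul_eq_C_mul, map_smul, smul_eq_mul]
    rw [this]
    exact IsPolyFun.sum _ fun i _ => (IsPolyFun.coord i).mul (ih _)

/-- Multiplication by a power of a linear form, modulo `V`. -/
noncomputable def mulPowMod (V : Submodule k (MvPolynomial (Fin r) k)) (a e : ℕ) (c : Fin r → k) :
    homogeneousSubmodule (Fin r) k e →ₗ[k] MvPolynomial (Fin r) k ⧸ V :=
  V.mkQ ∘ₗ LinearMap.mulLeft k (linForm c ^ a) ∘ₗ (homogeneousSubmodule (Fin r) k e).subtype

lemma range_mulPowMod (c : Fin r → k) :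
    LinearMap.range (mulPowMod V a e c) = (add V (linForm c ^ a) e).map V.mkQ := by
  rw [mulPowMod, LinearMap.range_comp, LinearMap.range_comp, Submodule.range_subtype, add,
    Submodule.map_sup]
  simp

lemma finrank_range_mulPowMod (hV : V ≤ homogeneousSubmodule (Fin r) k n) (h : a + e = n)
    (c : Fin r → k) :
    Module.finrank k (LinearMap.range (mulPowMod V a e c)) + cod n (add V (linForm c ^ a) e) =
      cod n V := by
  have hle := add_le hV (isHomogeneous_linForm_pow c a) h
  have := finite_of_le hle
  rw [range_mulPowMod]
  have h1 := finrank_map_mkQ (le_add : V ≤ add V (linForm c ^ a) e)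
  have h2 := cod_add_finrank hV
  have h3 := cod_add_finrank hle
  omega

lemma eventually_cod_le (hV : V ≤ homogeneousSubmodule (Fin r) k n) (h : a + e = n)
    (c₀ : Fin r → k) : ∀ᶠ c in genericFilter k (Fin r),
      cod n (add V (linForm c ^ a) e) ≤ cod n (add V (linForm c₀ ^ a) e) := by
  have hev := eventually_finrank_range_le (mulPowMod V a e)
    (fun g x => isPolyFun_linForm_pow (g ∘ₗ V.mkQ) a x) c₀
  filter_upwards [hev] with c hc
  have h1 := finrank_range_mulPowMod hV h c
  have h2 := finrank_range_mulPowMod hV h c₀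
  omega

lemma eventually_forall_cod_le (hV : V ≤ homogeneousSubmodule (Fin r) k n) (h : a + e = n) :
    ∀ᶠ c in genericFilter k (Fin r), ∀ c',
      cod n (add V (linForm c ^ a) e) ≤ cod n (add V (linForm c' ^ a) e) := by
  have hmin := Function.argmin_le (fun c : Fin r → k => cod n (add V (linForm c ^ a) e))
  filter_upwards [eventually_cod_le hV h
    (Function.argmin fun c : Fin r → k => cod n (add V (linForm c ^ a) e))] with c hc x
  exact hc.trans (hmin x)

/-- If `linForm c` is general and `linForm c ^ a * f ∈ V`, then the derivative of
`linForm c ^ a` in any direction, times `f`, lies in `V` modulo `linForm c ^ a`. -/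
lemma deriv_mul_mem_add [Infinite k] (hV : V ≤ homogeneousSubmodule (Fin r) k n) (h : a + e = n)
    {c : Fin r → k} (hc : ∀ c', cod n (add V (linForm c ^ a) e) ≤ cod n (add V (linForm c' ^ a) e))
    {f : MvPolynomial (Fin r) k} (hf : f.IsHomogeneous e) (hfV : linForm c ^ a * f ∈ V)
    (c₁ : Fin r → k) :
    (a : MvPolynomial (Fin r) k) * linForm c ^ (a - 1) * linForm c₁ * f ∈
      add V (linForm c ^ a) e := by
  let D : k → MvPolynomial (Fin r) k := fun t =>
    ∑ i ∈ Finset.range a, linForm (c + t • c₁) ^ i * (linForm c ^ (a - 1 - i) * (linForm c₁ * f))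
  have hD : ∀ t, linForm (c + t • c₁) ^ a * f = linForm c ^ a * f + t • D t := by
    intro t
    have h1 := (Commute.all (linForm (c + t • c₁)) (linForm c)).geom_sum₂_mul a
    have h2 : linForm (c + t • c₁) - linForm c = C t * linForm c₁ := by
      rw [linForm_add, linForm_smul, smul_eq_C_mul]; ring
    rw [h2] at h1
    have h3 : t • D t = (∑ i ∈ Finset.range a, linForm (c + t • c₁) ^ i * linForm c ^ (a - 1 - i)) *
        (C t * linForm c₁) * f := by
      simp only [D, smul_eq_C_mul, Finset.mul_sum, Finset.sum_mul]
      exact Finset.sum_congr rfl fun i _ => by ring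
    rw [h3, h1]
    ring
  have hD0 : D 0 = (a : MvPolynomial (Fin r) k) * linForm c ^ (a - 1) * linForm c₁ * f := by
    simp only [D, zero_smul, add_zero]
    rw [Finset.sum_congr rfl (g := fun _ => linForm c ^ (a - 1) * linForm c₁ * f)]
    · simp [mul_assoc]
    · intro i hi
      rw [← mul_assoc, ← pow_add, mul_assoc]
      have := Finset.mem_range.mp hi
      rw [show i + (a - 1 - i) = a - 1 by omega]
  have key := mem_range_of_finrank_range_le (fun t => mulPowMod V a e (c + t • c₁))
    (fun t => V.mkQ (D t))
    (fun g x => (isPolyFun_linForm_pow (g ∘ₗ V.mkQ) a x).comp_line c c₁)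
    (fun g => by
      simp only [D, map_sum]
      exact IsPolyFun.sum _ fun i _ =>
        (isPolyFun_linForm_pow (g ∘ₗ V.mkQ) i _).comp_line c c₁)
    (fun t => by
      have h1 := finrank_range_mulPowMod hV h (c + t • c₁)
      have h2 := finrank_range_mulPowMod hV h (c + (0 : k) • c₁)
      have h3 := hc (c + t • c₁)
      simp only [zero_smul, add_zero] at h2 ⊢
      omega)
    ⟨f, hf⟩ (fun t => by
      change V.mkQ (linForm (c + t • c₁) ^ a * f) = t • V.mkQ (D t)
      rw [hD, map_add, map_smul, add_eq_right]
      simpa using hfV)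
  simp only [zero_smul, add_zero] at key
  rw [range_mulPowMod, hD0] at key
  obtain ⟨v, hv, hvV⟩ := key
  have : (a : MvPolynomial (Fin r) k) * linForm c ^ (a - 1) * linForm c₁ * f - v ∈ V := by
    rw [← Submodule.ker_mkQ V, LinearMap.mem_ker, map_sub, hvV, sub_self]
  simpa using Submodule.add_mem _ (le_add (F := linForm c ^ a) (e := e) this) hv

lemma add_col_le {F F' : MvPolynomial (Fin r) k} (hF : F.IsHomogeneous 1)
    (hF' : F'.IsHomogeneous 1) :
    add (col V F (n + 1)) F' n ≤ col (add V F' (n + 1)) F (n + 1) := by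
  intro f hf
  obtain ⟨v, hv, g, hg, rfl⟩ := mem_add.mp hf
  refine mem_col.mpr ⟨hv.1.add ?_, ?_⟩
  · rw [add_comm n 1]; exact hF'.mul hg
  · rw [mul_add, mul_left_comm]
    refine Submodule.add_mem _ (le_add hv.2) (mul_mem_add ?_)
    rw [add_comm n 1]; exact hF.mul hg

/-- The restriction of the colon space is controlled by double restrictions. -/
lemma cod_add_le_cod_col (hV : V ≤ homogeneousSubmodule (Fin r) k (n + 1 + 1))
    {F F' : MvPolynomial (Fin r) k} (hF : F.IsHomogeneous 1) (hF0 : F ≠ 0)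
    (hF' : F'.IsHomogeneous 1) :
    cod (n + 1 + 1) (add V F' (n + 1)) ≤
      cod (n + 1) (add (col V F (n + 1)) F' n) +
        cod (n + 1 + 1) (add (add V F (n + 1)) F' (n + 1)) := by
  have h1 := cod_eq_col_add (add_le hV hF' (by omega : 1 + (n + 1) = n + 1 + 1)) hF hF0
    (by omega : 1 + (n + 1) = n + 1 + 1)
  have h2 : add (col V F (n + 1)) F' n ≤ col (add V F' (n + 1)) F (n + 1) :=
    add_col_le hF hF'
  have h3 := cod_anti col_le h2
  rw [add_right_comm] at h1
  omega

/-- A subspace all of whose sections have codimension at least `m` can be enlarged so that the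
general section has codimension exactly `m`. -/
lemma exists_enlarge (hV : V ≤ homogeneousSubmodule (Fin r) k (n + 1))
    (hm : ∀ c, m ≤ cod (n + 1) (add V (linForm c) n)) :
    ∃ V', V ≤ V' ∧ V' ≤ homogeneousSubmodule (Fin r) k (n + 1) ∧
      (∀ c, m ≤ cod (n + 1) (add V' (linForm c) n)) ∧
      ∃ c, cod (n + 1) (add V' (linForm c) n) = m := by
  induction hN : cod (n + 1) V using Nat.strong_induction_on generalizing V with
  | _ N ih =>
    by_cases hex : ∃ c, cod (n + 1) (add V (linForm c) n) = m
    · exact ⟨V, le_rfl, hV, hm, hex⟩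
    push Not at hex
    have hlt : ∀ c, m + 1 ≤ cod (n + 1) (add V (linForm c) n) := fun c => by
      have := hm c; have := hex c; omega
    have hadd : ∀ c, add V (linForm c) n ≤ homogeneousSubmodule (Fin r) k (n + 1) := fun c =>
      add_le hV (isHomogeneous_linForm c) (by omega)
    have hne : V ≠ homogeneousSubmodule (Fin r) k (n + 1) := by
      rintro rfl
      have h1 := hlt 0
      have h2 := cod_anti (hadd 0) le_add
      rw [cod_self] at h2
      omega
    obtain ⟨v, hv, hvV⟩ := SetLike.exists_of_lt (lt_of_le_of_ne hV hne)
    have hV₁ : V ⊔ Submodule.span k {v} ≤ homogeneousSubmodule (Fin r) k (n + 1) :=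
      sup_le hV (by simpa [Submodule.span_le] using hv)
    have hcodlt : cod (n + 1) (V ⊔ Submodule.span k {v}) < cod (n + 1) V := by
      refine lt_of_le_of_ne (cod_anti hV₁ le_sup_left) fun h => hvV ?_
      rw [eq_of_le_of_cod_le hV₁ le_sup_left h.ge]
      exact Submodule.mem_sup_right (Submodule.mem_span_singleton_self v)
    obtain ⟨V', h1, h2⟩ := ih _ (hN ▸ hcodlt) hV₁ (fun c => by
      have h1 := hlt c
      have hfin := finite_of_le (hadd c)
      have h2 : add (V ⊔ Submodule.span k {v}) (linForm c) n =
          add V (linForm c) n ⊔ Submodule.span k {v} := sup_right_comm _ _ _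
      have h3 := cod_add_finrank (hadd c)
      have h4 := cod_add_finrank (add_le hV₁ (isHomogeneous_linForm c) (by omega : 1 + n = n + 1))
      have h5 := Submodule.finrank_add_le_finrank_add_finrank (add V (linForm c) n)
        (Submodule.span k {v})
      have h6 : Module.finrank k (Submodule.span k {v}) ≤ 1 := by
        simpa using finrank_span_le_card (R := k) ({v} : Set (MvPolynomial (Fin r) k))
      rw [h2] at h4 ⊢
      omega) rfl
    exact ⟨V', le_sup_left.trans h1, h2⟩

end Genericity

section LinearIdeals

variable {k : Type*} [Field k] {r : ℕ}
variable {U U' : Submodule k (Fin r → k)} {J : Ideal (MvPolynomial (Fin r) k)}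
  {F f : MvPolynomial (Fin r) k} {c : Fin r → k} {n e a m : ℕ}

/-! ### Homogeneous ideals -/

lemma homogeneousComponent_mul (hF : F.IsHomogeneous a) (g : MvPolynomial (Fin r) k) (n : ℕ) :
    homogeneousComponent n (F * g) =
      if a ≤ n then F * homogeneousComponent (n - a) g else 0 := by
  conv_lhs => rw [← sum_homogeneousComponent g, Finset.mul_sum, map_sum]
  have h : ∀ i, homogeneousComponent n (F * homogeneousComponent i g) =
      if a + i = n then F * homogeneousComponent i g else 0 := by
    intro i
    rw [homogeneousComponent_of_mem (hF.mul (homogeneousComponent_isHomogeneous i g))]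
    simp [eq_comm]
  simp only [h]
  split_ifs with han
  · rw [Finset.sum_eq_single (n - a)]
    · rw [if_pos (by omega)]
    · intro i _ hi
      rw [if_neg (by omega)]
    · intro hi
      rw [homogeneousComponent_eq_zero _ _ (by have := Finset.mem_range.not.mp hi; omega)]
      simp
  · exact Finset.sum_eq_zero fun i _ => if_neg (by omega)

lemma isHomogIdeal_span {s : Set (MvPolynomial (Fin r) k)}
    (hs : ∀ x ∈ s, ∃ a, x.IsHomogeneous a) : IsHomogIdeal (Ideal.span s) := by
  intro f hf n
  suffices h : ∀ g : MvPolynomial (Fin r) k, homogeneousComponent n (g * f) ∈ Ideal.span s by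
    simpa using h 1
  induction hf using Submodule.span_induction with
  | mem x hx =>
    intro g
    obtain ⟨a, ha⟩ := hs x hx
    rw [mul_comm, homogeneousComponent_mul ha]
    split_ifs
    · exact Ideal.mul_mem_right _ _ (Ideal.subset_span hx)
    · exact Ideal.zero_mem _
  | zero => simp
  | add x y _ _ hx hy =>
    intro g
    rw [mul_add, map_add]
    exact Ideal.add_mem _ (hx g) (hy g)
  | smul b x _ hx =>
    intro g
    rw [smul_eq_mul, ← mul_assoc]
    exact hx _

lemma mem_sup_span {g : MvPolynomial (Fin r) k} :
    f ∈ J ⊔ Ideal.span {g} ↔ ∃ j ∈ J, ∃ b, j + g * b = f := by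
  simp [Submodule.mem_sup, Ideal.mem_span_singleton', mul_comm]

lemma mem_sup_span_self {g : MvPolynomial (Fin r) k} : g ∈ J ⊔ Ideal.span {g} :=
  Ideal.mem_sup_right (Ideal.mem_span_singleton_self g)

lemma isHomogIdeal_sup (hJ : IsHomogIdeal J) (hF : F.IsHomogeneous a) :
    IsHomogIdeal (J ⊔ Ideal.span {F}) := by
  intro f hf n
  obtain ⟨j, hj, b, rfl⟩ := mem_sup_span.mp hf
  rw [map_add, homogeneousComponent_mul hF]
  refine Ideal.add_mem _ (Ideal.mem_sup_left (hJ j hj n)) ?_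
  split_ifs
  · exact Ideal.mul_mem_right _ _ mem_sup_span_self
  · exact Ideal.zero_mem _

/-- The forms of degree `n` in an ideal. -/
noncomputable def gp (J : Ideal (MvPolynomial (Fin r) k)) (n : ℕ) :
    Submodule k (MvPolynomial (Fin r) k) :=
  J.restrictScalars k ⊓ homogeneousSubmodule (Fin r) k n

lemma mem_gp : f ∈ gp J n ↔ f ∈ J ∧ f.IsHomogeneous n := Iff.rfl

lemma gp_le : gp J n ≤ homogeneousSubmodule (Fin r) k n := inf_le_right

lemma gp_mono {J' : Ideal (MvPolynomial (Fin r) k)} (h : J ≤ J') : gp J n ≤ gp J' n :=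
  inf_le_inf_right _ h

lemma gp_sup_span (hJ : IsHomogIdeal J) (hF : F.IsHomogeneous a) (h : a + e = n) :
    gp (J ⊔ Ideal.span {F}) n = add (gp J n) F e := by
  subst h
  apply le_antisymm
  · rintro f ⟨hf, hfn⟩
    obtain ⟨j, hj, b, rfl⟩ := mem_sup_span.mp hf
    refine mem_add.mpr ⟨homogeneousComponent (a + e) j,
      ⟨hJ j hj _, homogeneousComponent_isHomogeneous _ _⟩, homogeneousComponent e b,
      homogeneousComponent_isHomogeneous _ _, ?_⟩
    have h1 := homogeneousComponent_of_mem (n := a + e) (m := a + e) hfn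
    rw [if_pos rfl, map_add, homogeneousComponent_mul hF, if_pos (by omega),
      Nat.add_sub_cancel_left] at h1
    exact h1
  · intro f hf
    obtain ⟨v, hv, g, hg, rfl⟩ := mem_add.mp hf
    exact ⟨Ideal.add_mem _ (Ideal.mem_sup_left hv.1) (Ideal.mul_mem_right _ _ mem_sup_span_self),
      hv.2.add (hF.mul hg)⟩

lemma gp_sup_span_of_lt (hJ : IsHomogIdeal J) (hF : F.IsHomogeneous a) (h : n < a) :
    gp (J ⊔ Ideal.span {F}) n = gp J n := by
  apply le_antisymm
  · rintro f ⟨hf, hfn⟩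
    obtain ⟨j, hj, b, rfl⟩ := mem_sup_span.mp hf
    have h1 := homogeneousComponent_of_mem (n := n) (m := n) hfn
    rw [if_pos rfl, map_add, homogeneousComponent_mul hF, if_neg (by omega), add_zero] at h1
    refine ⟨?_, hfn⟩
    rw [← h1]
    exact hJ j hj n
  · exact gp_mono le_sup_left

lemma col_gp (hJ : J.IsPrime) (hFJ : F ∉ J) (hF : F.IsHomogeneous a) (h : a + e = n) :
    col (gp J n) F e = gp J e := by
  ext f
  rw [mem_col, mem_gp, mem_gp]
  constructor
  · rintro ⟨h1, h2, -⟩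
    exact ⟨(hJ.mem_or_mem h2).resolve_left hFJ, h1⟩
  · rintro ⟨h1, h2⟩
    exact ⟨h2, Ideal.mul_mem_left _ _ h1, h ▸ hF.mul h2⟩

/-! ### Ideals generated by linear forms -/

/-- The ideal generated by a space of linear forms. -/
noncomputable def linIdeal (U : Submodule k (Fin r → k)) : Ideal (MvPolynomial (Fin r) k) :=
  Ideal.span (linForm '' (U : Set (Fin r → k)))

lemma linForm_mem_of_mem (h : c ∈ U) : linForm c ∈ linIdeal U :=
  Ideal.subset_span ⟨c, h, rfl⟩

lemma linIdeal_le : linIdeal U ≤ J ↔ ∀ c ∈ U, linForm c ∈ J := by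
  rw [linIdeal, Ideal.span_le, Set.image_subset_iff]
  rfl

lemma linIdeal_mono (h : U ≤ U') : linIdeal U ≤ linIdeal U' :=
  linIdeal_le.mpr fun _ hc => linForm_mem_of_mem (h hc)

lemma isHomogIdeal_linIdeal : IsHomogIdeal (linIdeal U) :=
  isHomogIdeal_span (by rintro _ ⟨c, -, rfl⟩; exact ⟨1, isHomogeneous_linForm c⟩)

lemma linIdeal_sup : linIdeal U ⊔ Ideal.span {linForm c} = linIdeal (U ⊔ Submodule.span k {c}) := by
  apply le_antisymm
  · refine sup_le (linIdeal_mono le_sup_left) ?_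
    rw [Ideal.span_le, Set.singleton_subset_iff]
    exact linForm_mem_of_mem (Submodule.mem_sup_right (Submodule.mem_span_singleton_self c))
  · refine linIdeal_le.mpr fun x hx => ?_
    obtain ⟨u, hu, y, hy, rfl⟩ := Submodule.mem_sup.mp hx
    obtain ⟨t, rfl⟩ := Submodule.mem_span_singleton.mp hy
    rw [linForm_add, linForm_smul, smul_eq_C_mul]
    exact Ideal.add_mem _ (Ideal.mem_sup_left (linForm_mem_of_mem hu))
      (Ideal.mul_mem_left _ _ mem_sup_span_self)

/-- An ideal of linear forms is the kernel of an endomorphism of the polynomial ring. -/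
lemma exists_retraction (U : Submodule k (Fin r → k)) :
    ∃ (p : (Fin r → k) →ₗ[k] (Fin r → k)) (φ : MvPolynomial (Fin r) k →ₐ[k] MvPolynomial (Fin r) k),
      LinearMap.ker p = U ∧ (∀ c, φ (linForm c) = linForm (p c)) ∧
      (∀ f, f - φ f ∈ linIdeal U) ∧ ∀ f, φ f = 0 ↔ f ∈ linIdeal U := by
  obtain ⟨g, hg⟩ := LinearMap.exists_rightInverse_of_surjective U.mkQ (Submodule.range_mkQ U)
  have hg' : ∀ x, U.mkQ (g x) = x := fun x => LinearMap.congr_fun hg x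
  have hp : ∀ c, c - (g ∘ₗ U.mkQ) c ∈ U := by
    intro c
    have h : U.mkQ (c - (g ∘ₗ U.mkQ) c) = 0 := by
      rw [map_sub, LinearMap.comp_apply, hg', sub_self]
    rwa [← LinearMap.mem_ker, Submodule.ker_mkQ] at h
  have hker : LinearMap.ker (g ∘ₗ U.mkQ) = U := by
    ext c
    constructor
    · intro hc
      have := hp c
      rwa [LinearMap.mem_ker.mp hc, sub_zero] at this
    · intro hc
      have : U.mkQ c = 0 := by rwa [← LinearMap.mem_ker, Submodule.ker_mkQ]
      rw [LinearMap.mem_ker, LinearMap.comp_apply, this, map_zero]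
  generalize g ∘ₗ U.mkQ = p at hp hker
  let φ : MvPolynomial (Fin r) k →ₐ[k] MvPolynomial (Fin r) k :=
    aeval fun i => linForm (p (Pi.single i 1))
  have hφ : ∀ c, φ (linForm c) = linForm (p c) := by
    intro c
    have h1 : φ.toLinearMap ∘ₗ linFormₗ k r = linFormₗ k r ∘ₗ p := by
      refine LinearMap.pi_ext' fun i => LinearMap.ext_ring ?_
      change φ (linForm (Pi.single i 1)) = linForm (p (Pi.single i 1))
      rw [linForm_single]
      exact aeval_X _ _
    exact LinearMap.congr_fun h1 c
  have hsub : ∀ f, f - φ f ∈ linIdeal U := by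
    intro f
    have h1 : (Ideal.Quotient.mkₐ k (linIdeal U)).comp φ = Ideal.Quotient.mkₐ k (linIdeal U) := by
      refine algHom_ext fun i => ?_
      refine (Ideal.Quotient.eq.mpr ?_).symm
      change X i - φ (X i) ∈ _
      rw [← linForm_single i, hφ, ← linForm_sub]
      exact linForm_mem_of_mem (hp _)
    exact Ideal.Quotient.eq.mp (AlgHom.congr_fun h1 f).symm
  refine ⟨p, φ, hker, hφ, hsub, fun f => ⟨fun h => ?_, fun h => ?_⟩⟩
  · simpa [h] using hsub f
  · have h1 : linIdeal U ≤ RingHom.ker φ := by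
      refine linIdeal_le.mpr fun c hc => ?_
      rw [RingHom.mem_ker, hφ, LinearMap.mem_ker.mp (hker.symm ▸ hc), linForm_zero]
    exact h1 h

lemma linIdeal_isPrime (U : Submodule k (Fin r → k)) : (linIdeal U).IsPrime := by
  obtain ⟨p, φ, -, -, -, hφ⟩ := exists_retraction U
  have : linIdeal U = RingHom.ker φ := Ideal.ext fun f => (hφ f).symm
  rw [this]
  exact RingHom.ker_isPrime _

lemma linForm_mem_linIdeal_iff : linForm c ∈ linIdeal U ↔ c ∈ U := by
  refine ⟨fun h => ?_, linForm_mem_of_mem⟩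
  obtain ⟨p, φ, hker, hφ', -, hφ⟩ := exists_retraction U
  rw [← hφ, hφ', linForm_eq_zero_iff] at h
  rw [← hker]
  exact h

lemma linForm_pow_notMem (h : c ∉ U) (a : ℕ) : linForm c ^ a ∉ linIdeal U := fun h' =>
  h (linForm_mem_linIdeal_iff.mp ((linIdeal_isPrime U).mem_of_pow_mem a h'))

lemma gp_linIdeal_zero : gp (linIdeal U) 0 = ⊥ := by
  rw [eq_bot_iff]
  rintro f ⟨hf, hf0⟩
  replace hf0 : f.IsHomogeneous 0 := hf0
  rw [← totalDegree_zero_iff_isHomogeneous,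
    totalDegree_eq_zero_iff_eq_C] at hf0
  obtain ⟨p, φ, -, -, -, hφ⟩ := exists_retraction U
  have h1 := (hφ f).mpr hf
  rw [hf0, algHom_C] at h1
  rw [Submodule.mem_bot, hf0]
  exact h1

lemma gp_linIdeal_top : gp (linIdeal (⊤ : Submodule k (Fin r → k))) (n + 1) =
    homogeneousSubmodule (Fin r) k (n + 1) := by
  refine le_antisymm gp_le fun f hf => ⟨?_, hf⟩
  obtain ⟨p, φ, hker, hφ', -, hφ⟩ := exists_retraction (⊤ : Submodule k (Fin r → k))
  refine (hφ f).mp ?_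
  have h1 : φ = aeval (fun _ => 0) := algHom_ext fun i => by
    rw [aeval_X, ← linForm_single, hφ', LinearMap.ker_eq_top.mp hker, LinearMap.zero_apply,
      linForm_zero]
  rw [h1, aeval_zero', constantCoeff_eq, IsHomogeneous.coeff_eq_zero hf (by simp), map_zero]

lemma cod_linIdeal_zero : cod 0 (gp (linIdeal U) 0) = 1 := by
  rw [cod, gp_linIdeal_zero, finrank_bot, homogeneousSubmodule_zero, Submodule.one_eq_span,
    finrank_span_singleton one_ne_zero]

lemma cod_linIdeal_succ (hc : c ∉ U) : cod (n + 1) (gp (linIdeal U) (n + 1)) =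
    cod n (gp (linIdeal U) n) +
      cod (n + 1) (gp (linIdeal (U ⊔ Submodule.span k {c})) (n + 1)) := by
  have hc0 : linForm c ≠ 0 := fun h => hc (by simp [linForm_eq_zero_iff.mp h])
  rw [cod_eq_col_add gp_le (isHomogeneous_linForm c) hc0 (by omega : 1 + n = n + 1),
    col_gp (linIdeal_isPrime U) (linForm_mem_linIdeal_iff.not.mpr hc) (isHomogeneous_linForm c)
      (by omega), ← gp_sup_span isHomogIdeal_linIdeal (isHomogeneous_linForm c) (by omega),
    linIdeal_sup]

lemma finrank_sup_span (hc : c ∉ U) :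
    Module.finrank k ↥(U ⊔ Submodule.span k {c}) = Module.finrank k U + 1 := by
  have hc0 : c ≠ 0 := by rintro rfl; exact hc U.zero_mem
  have h1 := Submodule.finrank_sup_add_finrank_inf_eq U (Submodule.span k {c})
  have h2 : U ⊓ Submodule.span k {c} = ⊥ :=
    disjoint_iff.mp ((Submodule.disjoint_span_singleton' hc0).mpr hc)
  rw [h2, finrank_bot, finrank_span_singleton hc0] at h1
  exact h1

lemma ne_top_of_finrank {s : ℕ} (h : Module.finrank k U + (s + 1) = r) : U ≠ ⊤ := by
  rintro rfl
  rw [finrank_top, Module.finrank_fin_fun] at h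
  omega

lemma exists_notMem_of_finrank {s : ℕ} (h : Module.finrank k U + (s + 1) = r) : ∃ c, c ∉ U := by
  by_contra! h'
  exact ne_top_of_finrank h (eq_top_iff.mpr fun c _ => h' c)

lemma cod_linIdeal_of_finrank_zero (h : Module.finrank k U = r) :
    cod (n + 1) (gp (linIdeal U) (n + 1)) = 0 := by
  have : U = ⊤ := Submodule.eq_top_of_finrank_eq (by simpa using h)
  rw [this, gp_linIdeal_top, cod_self]

lemma cod_linIdeal_of_finrank_one (h : Module.finrank k U + 1 = r) :
    cod n (gp (linIdeal U) n) = 1 := by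
  obtain ⟨c, hc⟩ := exists_notMem_of_finrank (s := 0) h
  induction n with
  | zero => exact cod_linIdeal_zero
  | succ n ih =>
    rw [cod_linIdeal_succ hc, ih,
      cod_linIdeal_of_finrank_zero (by rw [finrank_sup_span hc, h])]

lemma cod_linIdeal_of_finrank_two (h : Module.finrank k U + 2 = r) :
    cod n (gp (linIdeal U) n) = n + 1 := by
  obtain ⟨c, hc⟩ := exists_notMem_of_finrank (s := 1) h
  induction n with
  | zero => exact cod_linIdeal_zero
  | succ n ih =>
    rw [cod_linIdeal_succ hc, ih,
      cod_linIdeal_of_finrank_one (by rw [finrank_sup_span hc]; omega)]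

lemma choose_two_succ (x : ℕ) : (x + 1).choose 2 = x.choose 2 + x := by
  rw [Nat.choose_succ_succ' x 1, Nat.choose_one_right, add_comm]

lemma cod_linIdeal_of_finrank_three (h : Module.finrank k U + 3 = r) :
    cod n (gp (linIdeal U) n) = (n + 2).choose 2 := by
  obtain ⟨c, hc⟩ := exists_notMem_of_finrank (s := 2) h
  induction n with
  | zero => exact cod_linIdeal_zero
  | succ n ih =>
    rw [cod_linIdeal_succ hc, ih,
      cod_linIdeal_of_finrank_two (by rw [finrank_sup_span hc]; omega), choose_two_succ (n + 2)]

lemma ne_zero_of_notMem (hF : F ∉ J) : F ≠ 0 := fun h => hF (h ▸ J.zero_mem)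

lemma cod_linIdeal_sup (hF : F.IsHomogeneous a) (hFU : F ∉ linIdeal U) (h : a + e = n) :
    cod n (gp (linIdeal U) n) =
      cod e (gp (linIdeal U) e) + cod n (gp (linIdeal U ⊔ Ideal.span {F}) n) := by
  rw [cod_eq_col_add gp_le hF (ne_zero_of_notMem hFU) h,
    col_gp (linIdeal_isPrime U) hFU hF h, ← gp_sup_span isHomogIdeal_linIdeal hF h]

lemma cod_curve (hU : Module.finrank k U + 3 = r) (hF : F.IsHomogeneous m) (hFU : F ∉ linIdeal U)
    (h : m ≤ n + 1) : cod n (gp (linIdeal U ⊔ Ideal.span {F}) n) + (n + 2 - m).choose 2 =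
      (n + 2).choose 2 := by
  rcases h.eq_or_lt with rfl | h
  · rw [gp_sup_span_of_lt isHomogIdeal_linIdeal hF (by omega), cod_linIdeal_of_finrank_three hU]
    simp
  · obtain ⟨e, rfl⟩ := Nat.exists_eq_add_of_le (Nat.lt_succ_iff.mp h)
    have h1 := cod_linIdeal_sup hF hFU rfl (e := e)
    rw [cod_linIdeal_of_finrank_three hU, cod_linIdeal_of_finrank_three hU] at h1
    rw [show m + e + 2 - m = e + 2 by omega]
    omega

lemma cod_points (hU : Module.finrank k U + 2 = r) (hF : F.IsHomogeneous m) (hFU : F ∉ linIdeal U)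
    (h : m ≤ n + 1) : cod n (gp (linIdeal U ⊔ Ideal.span {F}) n) = m := by
  rcases h.eq_or_lt with rfl | h
  · rw [gp_sup_span_of_lt isHomogIdeal_linIdeal hF (by omega), cod_linIdeal_of_finrank_two hU]
  · obtain ⟨e, rfl⟩ := Nat.exists_eq_add_of_le (Nat.lt_succ_iff.mp h)
    have h1 := cod_linIdeal_sup hF hFU rfl (e := e)
    rw [cod_linIdeal_of_finrank_two hU, cod_linIdeal_of_finrank_two hU] at h1
    omega

/-- A linear form outside `U` is a nonzerodivisor modulo `U` and `G`, if `G` does not vanish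
on the hyperplane section. -/
lemma mem_of_linForm_mul_mem {G : MvPolynomial (Fin r) k} (hc : c ∉ U)
    (hG : G ∉ linIdeal (U ⊔ Submodule.span k {c}))
    (hf : linForm c * f ∈ linIdeal U ⊔ Ideal.span {G}) : f ∈ linIdeal U ⊔ Ideal.span {G} := by
  obtain ⟨u, hu, b, hb⟩ := mem_sup_span.mp hf
  have h1 : G * b ∈ linIdeal (U ⊔ Submodule.span k {c}) := by
    rw [← linIdeal_sup, show G * b = linForm c * f - u by rw [← hb]; ring]
    exact Ideal.sub_mem _ (Ideal.mul_mem_right _ _ mem_sup_span_self) (Ideal.mem_sup_left hu)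
  have h2 := ((linIdeal_isPrime _).mem_or_mem h1).resolve_left hG
  rw [← linIdeal_sup] at h2
  obtain ⟨w, hw, b₁, rfl⟩ := mem_sup_span.mp h2
  have h3 : linForm c * (f - G * b₁) ∈ linIdeal U := by
    rw [show linForm c * (f - G * b₁) = u + G * w by linear_combination -hb]
    exact Ideal.add_mem _ hu (Ideal.mul_mem_left _ _ hw)
  have h4 := ((linIdeal_isPrime U).mem_or_mem h3).resolve_left
    (linForm_mem_linIdeal_iff.not.mpr hc)
  exact mem_sup_span.mpr ⟨_, h4, b₁, by ring⟩

/-- The forms of degree `1` in an ideal of linear forms. -/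
lemma gp_linIdeal_one : gp (linIdeal U) 1 = U.map (linFormₗ k r) := by
  ext f
  constructor
  · rintro ⟨h1, h2⟩
    obtain ⟨c, rfl⟩ := exists_linForm_eq h2
    exact ⟨c, linForm_mem_linIdeal_iff.mp h1, rfl⟩
  · rintro ⟨c, hc, rfl⟩
    exact ⟨linForm_mem_of_mem hc, isHomogeneous_linForm c⟩

lemma finrank_gp_linIdeal_one : Module.finrank k (gp (linIdeal U) 1) = Module.finrank k U := by
  rw [gp_linIdeal_one, ← (Submodule.equivMapOfInjective _ linFormₗ_injective U).finrank_eq]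

lemma finrank_homogeneousSubmodule_one :
    Module.finrank k (homogeneousSubmodule (Fin r) k 1) = r := by
  rw [← gp_linIdeal_top (n := 0), finrank_gp_linIdeal_one, finrank_top, Module.finrank_fin_fun]

lemma exists_eq_gp_linIdeal {V : Submodule k (MvPolynomial (Fin r) k)}
    (hV : V ≤ homogeneousSubmodule (Fin r) k 1) :
    ∃ T : Submodule k (Fin r → k), V = gp (linIdeal T) 1 ∧ cod 1 V + Module.finrank k T = r := by
  have h : V = gp (linIdeal (V.comap (linFormₗ k r))) 1 := by
    rw [gp_linIdeal_one]
    refine le_antisymm (fun f hf => ?_) (Submodule.map_comap_le _ _)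
    obtain ⟨c, rfl⟩ := exists_linForm_eq (hV hf)
    exact ⟨c, hf, rfl⟩
  refine ⟨_, h, ?_⟩
  have h1 := cod_add_finrank hV
  rw [finrank_homogeneousSubmodule_one] at h1
  rw [← finrank_gp_linIdeal_one, ← h, h1]

/-- Every space of codimension `s` contains one of codimension `s + 1`. -/
lemma exists_sup_span_eq {T : Submodule k (Fin r → k)} {s : ℕ}
    (h : Module.finrank k T = s + 1) :
    ∃ (W : Submodule k (Fin r → k)) (c : Fin r → k), c ∉ W ∧ W ⊔ Submodule.span k {c} = T ∧
      Module.finrank k W = s := by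
  obtain ⟨c, hcT, hc0⟩ : ∃ c ∈ T, c ≠ 0 := by
    by_contra! h'
    have : T = ⊥ := (Submodule.eq_bot_iff _).mpr h'
    rw [this, finrank_bot] at h
    omega
  obtain ⟨W, hW, hsup⟩ : ∃ W ≤ T, IsCompl (Submodule.comap T.subtype W)
      (Submodule.span k {(⟨c, hcT⟩ : T)}) := by
    obtain ⟨W', hW'⟩ := Submodule.exists_isCompl (Submodule.span k {(⟨c, hcT⟩ : T)})
    refine ⟨W'.map T.subtype, Submodule.map_subtype_le _ _, ?_⟩
    rw [Submodule.comap_map_eq_of_injective T.injective_subtype]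
    exact hW'.symm
  have hcW : c ∉ W := by
    intro hc
    have h1 := Submodule.disjoint_def.mp hsup.disjoint ⟨c, hcT⟩ hc
      (Submodule.mem_span_singleton_self _)
    exact hc0 (by simpa using h1)
  have heq : W ⊔ Submodule.span k {c} = T := by
    refine le_antisymm (sup_le hW (by simpa [Submodule.span_le] using hcT)) fun x hx => ?_
    obtain ⟨y, hy, z, hz, hyz⟩ := Submodule.mem_sup.mp
      (hsup.sup_eq_top ▸ Submodule.mem_top : (⟨x, hx⟩ : T) ∈ _)
    obtain ⟨t, rfl⟩ := Submodule.mem_span_singleton.mp hz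
    refine Submodule.mem_sup.mpr ⟨y, hy, t • c,
      Submodule.smul_mem _ _ (Submodule.mem_span_singleton_self c), ?_⟩
    simpa using congrArg Subtype.val hyz
  refine ⟨W, c, hcW, heq, ?_⟩
  have := finrank_sup_span hcW
  rw [heq] at this
  omega

end LinearIdeals

section Restriction

variable {k : Type*} [Field k] {r : ℕ}
variable {V W : Submodule k (MvPolynomial (Fin r) k)} {U : Submodule k (Fin r → k)}
  {F G f : MvPolynomial (Fin r) k} {n e a m : ℕ}

/-! ### Restriction to a general hyperplane -/

lemma eventually_cod_add_le (hV : V ≤ homogeneousSubmodule (Fin r) k (n + 1)) (c₀ : Fin r → k) :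
    ∀ᶠ c in genericFilter k (Fin r),
      cod (n + 1) (add V (linForm c) n) ≤ cod (n + 1) (add V (linForm c₀) n) := by
  simpa using eventually_cod_le hV (by omega : 1 + n = n + 1) c₀

lemma le_of_eventually_cod [Infinite k] (hV : V ≤ homogeneousSubmodule (Fin r) k (n + 1))
    (h : ∀ᶠ c in genericFilter k (Fin r), m ≤ cod (n + 1) (add V (linForm c) n))
    (c₀ : Fin r → k) : m ≤ cod (n + 1) (add V (linForm c₀) n) := by
  obtain ⟨c, h1, h2⟩ := (h.and (eventually_cod_add_le hV c₀)).exists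
  exact h1.trans h2

lemma eventually_cod_add_eq (hV : V ≤ homogeneousSubmodule (Fin r) k (n + 1))
    (hm : ∀ c, m ≤ cod (n + 1) (add V (linForm c) n))
    (hex : ∃ c, cod (n + 1) (add V (linForm c) n) = m) :
    ∀ᶠ c in genericFilter k (Fin r), cod (n + 1) (add V (linForm c) n) = m := by
  obtain ⟨c₀, h₀⟩ := hex
  filter_upwards [eventually_cod_add_le hV c₀] with c hc
  exact le_antisymm (h₀ ▸ hc) (hm c)

lemma mul_mem_of_eventually [Infinite k] {P : (Fin r → k) → Prop}
    (hP : ∀ᶠ c in genericFilter k (Fin r), P c) (h : ∀ c, P c → linForm c * f ∈ W)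
    (c : Fin r → k) : linForm c * f ∈ W := by
  have h1 := eventually_forall_notMem_of_eventually hP
    (U := W.comap (LinearMap.mulRight k f ∘ₗ linFormₗ k r)) h
  have h2 : c ∈ W.comap (LinearMap.mulRight k f ∘ₗ linFormₗ k r) := h1 ▸ Submodule.mem_top
  exact h2

lemma gp_linIdeal_le (h : ∀ c ∈ U, ∀ g : MvPolynomial (Fin r) k, g.IsHomogeneous e →
    linForm c * g ∈ W) : gp (linIdeal U) (e + 1) ≤ W := by
  rintro f ⟨hf, hfn⟩
  suffices h' : ∀ g : MvPolynomial (Fin r) k, homogeneousComponent (e + 1) (g * f) ∈ W by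
    have h1 := homogeneousComponent_of_mem (n := e + 1) (m := e + 1) hfn
    rw [if_pos rfl] at h1
    rw [← h1, ← one_mul f]
    exact h' 1
  replace hf : f ∈ linIdeal U := hf
  clear hfn
  induction hf using Submodule.span_induction with
  | mem x hx =>
    obtain ⟨c, hc, rfl⟩ := hx
    intro g
    rw [mul_comm, homogeneousComponent_mul (isHomogeneous_linForm c), if_pos (by omega)]
    exact h c hc _ (homogeneousComponent_isHomogeneous _ _)
  | zero => simp
  | add x y _ _ hx hy =>
    intro g
    rw [mul_add, map_add]
    exact Submodule.add_mem _ (hx g) (hy g)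
  | smul b x _ hx =>
    intro g
    rw [smul_eq_mul, ← mul_assoc]
    exact hx _

lemma homogeneousSubmodule_le (h : ∀ (c : Fin r → k) (g : MvPolynomial (Fin r) k),
    g.IsHomogeneous e → linForm c * g ∈ W) : homogeneousSubmodule (Fin r) k (e + 1) ≤ W := by
  rw [← gp_linIdeal_top]
  exact gp_linIdeal_le fun c _ g hg => h c g hg

/-- A space of forms of degree `n + 1` and codimension at most `n + 1` restricts onto all forms on
a general hyperplane. -/
lemma exists_cod_add_eq_zero [Infinite k] (hr : 0 < r)
    (hV : V ≤ homogeneousSubmodule (Fin r) k (n + 1)) (h : cod (n + 1) V ≤ n + 1) :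
    ∃ c, cod (n + 1) (add V (linForm c) n) = 0 := by
  induction n generalizing V with
  | zero =>
    by_contra! hne
    obtain ⟨V', hVV', hV', h1, h2⟩ := exists_enlarge hV (m := 1)
      fun c => Nat.one_le_iff_ne_zero.mpr (hne c)
    have hev := (eventually_cod_add_eq hV' h1 h2).and (eventually_ne_zero hr)
    have hcod := (cod_anti hV' hVV').trans h
    have hmem : ∀ c, linForm c * 1 ∈ V' := mul_mem_of_eventually hev fun c hc => by
      have h3 := cod_eq_col_add hV' (isHomogeneous_linForm c) (linForm_eq_zero_iff.not.mpr hc.2)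
        (by omega : 1 + 0 = 0 + 1)
      have h4 := eq_of_cod_eq_zero (col_le : col V' (linForm c) 0 ≤ _) (by omega)
      have h5 : (1 : MvPolynomial (Fin r) k) ∈ col V' (linForm c) 0 := h4 ▸ isHomogeneous_one _ _
      exact (mem_col.mp h5).2
    have htop : V' = homogeneousSubmodule (Fin r) k (0 + 1) := le_antisymm hV' fun f hf => by
      obtain ⟨c, rfl⟩ := exists_linForm_eq hf
      simpa using hmem c
    obtain ⟨c, hc⟩ := h2
    have h6 := cod_anti (add_le hV' (isHomogeneous_linForm c) (by omega : 1 + 0 = 0 + 1)) le_add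
    rw [hc, htop, cod_self] at h6
    omega
  | succ n ih =>
    by_contra! hne
    obtain ⟨V', hVV', hV', h1, h2⟩ := exists_enlarge hV (m := 1)
      fun c => Nat.one_le_iff_ne_zero.mpr (hne c)
    have hev := (eventually_cod_add_eq hV' h1 h2).and (eventually_ne_zero hr)
    have hcod := (cod_anti hV' hVV').trans h
    obtain ⟨c, hc1, hc0⟩ := hev.exists
    have hL := isHomogeneous_linForm c
    have h3 := cod_eq_col_add hV' hL (linForm_eq_zero_iff.not.mpr hc0)
      (by omega : 1 + (n + 1) = n + 1 + 1)
    obtain ⟨c₁, hc₁⟩ := ih (col_le : col V' (linForm c) (n + 1) ≤ _) (by omega)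
    have hev₁ := eventually_cod_add_le (col_le : col V' (linForm c) (n + 1) ≤ _) c₁
    have hle := add_le hV' hL (by omega : 1 + (n + 1) = n + 1 + 1)
    have hall : homogeneousSubmodule (Fin r) k (n + 1 + 1) ≤ add V' (linForm c) (n + 1) := by
      refine homogeneousSubmodule_le fun c' g hg =>
        mul_mem_of_eventually (hev.and hev₁) (fun c' hc' => ?_) c'
      obtain ⟨⟨h4, -⟩, h5⟩ := hc'
      have h6 := cod_add_le_cod_col hV' hL (linForm_eq_zero_iff.not.mpr hc0)
        (isHomogeneous_linForm c')
      have h7 := eq_of_le_of_cod_le (add_le hle (isHomogeneous_linForm c')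
        (by omega : 1 + (n + 1) = n + 1 + 1)) le_add (by omega)
      rw [h7]
      exact mul_mem_add hg
    rw [le_antisymm hle hall, cod_self] at hc1
    omega

/-- A general hyperplane misses a zero-dimensional scheme on a line. -/
lemma eventually_notMem_linIdeal [Infinite k] (hU : Module.finrank k U + 2 = r)
    (hG : G.IsHomogeneous (m + 1)) (hGU : G ∉ linIdeal U) :
    ∀ᶠ c in genericFilter k (Fin r), c ∉ U ∧ G ∉ linIdeal (U ⊔ Submodule.span k {c}) := by
  have hle : gp (linIdeal U ⊔ Ideal.span {G}) (m + 1) ≤ _ := gp_le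
  obtain ⟨c₀, hc₀⟩ := exists_cod_add_eq_zero (by omega) hle
    (cod_points hU hG hGU (by omega)).le
  filter_upwards [eventually_notMem (ne_top_of_finrank (s := 1) hU), eventually_cod_add_le hle c₀]
    with c hcU hc
  refine ⟨hcU, fun hGc => ?_⟩
  rw [← gp_sup_span (isHomogIdeal_sup isHomogIdeal_linIdeal hG) (isHomogeneous_linForm c)
    (by omega)] at hc
  have h1 : linIdeal U ⊔ Ideal.span {G} ⊔ Ideal.span {linForm c} ≤
      linIdeal (U ⊔ Submodule.span k {c}) := by
    rw [sup_right_comm, linIdeal_sup]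
    exact sup_le le_rfl ((Ideal.span_singleton_le_iff_mem _).mpr hGc)
  have h2 := cod_anti gp_le (gp_mono h1 (n := m + 1))
  rw [cod_linIdeal_of_finrank_one (by rw [finrank_sup_span hcU]; omega)] at h2
  omega

end Restriction

section Curves

variable {k : Type*} [Field k] {r : ℕ}
variable {V : Submodule k (MvPolynomial (Fin r) k)} {W U T : Submodule k (Fin r → k)}
  {J : Ideal (MvPolynomial (Fin r) k)}
  {F G f : MvPolynomial (Fin r) k} {c c' : Fin r → k} {n e a m : ℕ}

/-! ### Plane curves in a fixed degree -/

/-- `V` is the degree-`n` part of the ideal of a plane curve of degree `m`. -/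
def IsCurve (V : Submodule k (MvPolynomial (Fin r) k)) (m n : ℕ) : Prop :=
  ∃ (W : Submodule k (Fin r → k)) (F : MvPolynomial (Fin r) k), Module.finrank k W + 3 = r ∧
    F.IsHomogeneous m ∧ F ∉ linIdeal W ∧ V = gp (linIdeal W ⊔ Ideal.span {F}) n

lemma IsCurve.cod_eq (h : IsCurve V m n) (hmn : m ≤ n + 1) :
    cod n V + (n + 2 - m).choose 2 = (n + 2).choose 2 := by
  obtain ⟨W, F, hW, hF, hFW, rfl⟩ := h
  exact cod_curve hW hF hFW hmn

lemma IsCurve.cod_pos (h : IsCurve V m n) (hmn : m ≤ n + 1) (hm : 1 ≤ m) : 0 < cod n V := by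
  have h1 := h.cod_eq hmn
  have h2 := Nat.choose_le_choose 2 (by omega : n + 2 - m ≤ n + 1)
  have h3 : (n + 2).choose 2 = _ := choose_two_succ (n + 1)
  omega

lemma isCurve_of_le (hV : V ≤ homogeneousSubmodule (Fin r) k n)
    (hcod : cod n V + (n + 2 - m).choose 2 = (n + 2).choose 2) (hmn : m ≤ n + 1)
    (hW : Module.finrank k W + 3 = r) (hF : F.IsHomogeneous m) (hFW : F ∉ linIdeal W)
    (h : V ≤ gp (linIdeal W ⊔ Ideal.span {F}) n ∨ gp (linIdeal W ⊔ Ideal.span {F}) n ≤ V) :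
    IsCurve V m n := by
  have h1 := cod_curve hW hF hFW hmn
  refine ⟨W, F, hW, hF, hFW, ?_⟩
  rcases h with h | h
  · exact eq_of_le_of_cod_le gp_le h (by omega)
  · exact (eq_of_le_of_cod_le hV h (by omega)).symm

/-- The inductive statement: a space of forms of degree `n + 1` and small codimension, whose
restrictions to hyperplanes all have codimension at least `m`, comes from a plane curve. -/
def GreenAt (k : Type*) [Field k] (r m n : ℕ) : Prop :=
  ∀ V : Submodule k (MvPolynomial (Fin r) k), V ≤ homogeneousSubmodule (Fin r) k (n + 1) →
    cod (n + 1) V + (n + 3 - m).choose 2 ≤ (n + 3).choose 2 →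
    (∀ c, m ≤ cod (n + 1) (add V (linForm c) n)) → IsCurve V m (n + 1)

lemma greenAt_of_exact (hmn : m ≤ n + 2)
    (h : ∀ V : Submodule k (MvPolynomial (Fin r) k), V ≤ homogeneousSubmodule (Fin r) k (n + 1) →
      cod (n + 1) V + (n + 3 - m).choose 2 ≤ (n + 3).choose 2 →
      (∀ c, m ≤ cod (n + 1) (add V (linForm c) n)) →
      (∃ c, cod (n + 1) (add V (linForm c) n) = m) → IsCurve V m (n + 1)) :
    GreenAt k r m n := by
  intro V hV hcod hm
  obtain ⟨V', hVV', hV', hm', hex⟩ := exists_enlarge hV hm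
  have h1 := cod_anti hV' hVV'
  have h2 := h V' hV' (by omega) hm' hex
  have h3 := h2.cod_eq (by omega)
  rwa [eq_of_le_of_cod_le hV' hVV' (by simp only [show n + 1 + 2 = n + 3 by rfl] at h3; omega)]

lemma GreenAt.exists_cod_le (h : GreenAt k r m n) (hmn : m ≤ n + 2)
    (hV : V ≤ homogeneousSubmodule (Fin r) k (n + 1))
    (hcod : cod (n + 1) V + (n + 3 - m).choose 2 ≤ (n + 3).choose 2) :
    ∃ c, cod (n + 1) (add V (linForm c) n) ≤ m := by
  by_contra! hlt
  obtain ⟨V', hVV', hV', hm', c, hc⟩ := exists_enlarge hV fun c => (hlt c).le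
  have h1 := cod_anti hV' hVV'
  have h2 := h V' hV' (by omega) hm'
  have h3 := h2.cod_eq (by omega)
  have h4 := hlt c
  rw [eq_of_le_of_cod_le hV' hVV' (by simp only [show n + 1 + 2 = n + 3 by rfl] at h3; omega)] at h4
  omega

lemma greenAt_zero (hr : 3 ≤ r) (hm : 1 ≤ m) (hm2 : m ≤ 2) : GreenAt k r m 0 := by
  intro V hV hcod hres
  obtain ⟨T, rfl, hT⟩ := exists_eq_gp_linIdeal hV
  obtain ⟨c, hc⟩ : ∃ c, c ∉ T := by
    by_contra! h
    obtain rfl : T = ⊤ := eq_top_iff.mpr fun c _ => h c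
    have h1 := hres 0
    rw [← gp_sup_span isHomogIdeal_linIdeal (isHomogeneous_linForm _) (by omega)] at h1
    have h2 := cod_anti gp_le (gp_mono le_sup_left :
      gp _ (0 + 1) ≤ gp (linIdeal ⊤ ⊔ Ideal.span {linForm (0 : Fin r → k)}) _)
    rw [gp_linIdeal_top, cod_self] at h2
    simp only [zero_add] at h1 h2
    omega
  have h1 := hres c
  rw [← gp_sup_span isHomogIdeal_linIdeal (isHomogeneous_linForm _) (by omega), linIdeal_sup] at h1
  have h2 := cod_linIdeal_succ (n := 0) hc
  rw [cod_linIdeal_zero] at h2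
  simp only [zero_add] at h1 h2 hcod ⊢
  have h4 : (3 : ℕ).choose 2 = 3 := by decide
  interval_cases m
  · have h3 : (3 - 1).choose 2 = 1 := by decide
    obtain ⟨W, x, hx, hWx, hW⟩ := exists_sup_span_eq (T := T) (s := r - 3) (by omega)
    refine ⟨W, linForm x, by omega, isHomogeneous_linForm x, linForm_mem_linIdeal_iff.not.mpr hx,
      ?_⟩
    rw [linIdeal_sup, hWx]
  · have h3 : (3 - 2).choose 2 = 0 := by decide
    refine ⟨T, linForm c ^ 2, by omega, isHomogeneous_linForm_pow c 2, linForm_pow_notMem hc 2, ?_⟩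
    rw [gp_sup_span_of_lt isHomogIdeal_linIdeal (isHomogeneous_linForm_pow c 2) (by omega)]

lemma gp_linIdeal_succ_le (h : ∀ c, ∀ f ∈ gp (linIdeal T) (e + 1), linForm c * f ∈ V) :
    gp (linIdeal T) (e + 1 + 1) ≤ V := by
  refine gp_linIdeal_le fun c hc g hg => ?_
  have h1 : homogeneousSubmodule (Fin r) k (e + 1) ≤ V.comap (LinearMap.mulLeft k (linForm c)) := by
    refine homogeneousSubmodule_le fun c' g' hg' => ?_
    rw [Submodule.mem_comap, LinearMap.mulLeft_apply, mul_left_comm]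
    refine h c' _ (mem_gp.mpr ⟨Ideal.mul_mem_right _ _ (linForm_mem_of_mem hc), ?_⟩)
    have h2 := (isHomogeneous_linForm c).mul hg'
    rwa [add_comm] at h2
  have h2 := h1 ((mem_homogeneousSubmodule _ g).mpr hg)
  rwa [Submodule.mem_comap, LinearMap.mulLeft_apply] at h2

lemma exists_C_of_isHomogeneous_zero (hf : f.IsHomogeneous 0) : ∃ t, f = C t := by
  rw [← totalDegree_zero_iff_isHomogeneous, totalDegree_eq_zero_iff_eq_C] at hf
  exact ⟨_, hf⟩

lemma gp_sup_span_le_of_mem (hJ : IsHomogIdeal J) (hF : F.IsHomogeneous n) (h : gp J n ≤ V)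
    (hFV : F ∈ V) : gp (J ⊔ Ideal.span {F}) n ≤ V := by
  rw [gp_sup_span hJ hF (add_zero n)]
  intro f hf
  obtain ⟨v, hv, g, hg, rfl⟩ := mem_add.mp hf
  obtain ⟨t, rfl⟩ := exists_C_of_isHomogeneous_zero hg
  rw [mul_comm, ← smul_eq_C_mul]
  exact V.add_mem (h hv) (V.smul_mem t hFV)

/-- Two forms of the same degree that are congruent up to scalars modulo linear forms. -/
lemma mem_sup_span_swap (hF : F.IsHomogeneous m) (hG : G.IsHomogeneous m)
    (h : G ∈ linIdeal U ⊔ Ideal.span {F}) (hGU : G ∉ linIdeal U) :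
    F ∈ linIdeal U ⊔ Ideal.span {G} := by
  have h1 : G ∈ gp (linIdeal U ⊔ Ideal.span {F}) m := ⟨h, hG⟩
  rw [gp_sup_span isHomogIdeal_linIdeal hF (add_zero m)] at h1
  obtain ⟨u, hu, g, hg, hsum⟩ := mem_add.mp h1
  obtain ⟨t, rfl⟩ := exists_C_of_isHomogeneous_zero hg
  have ht : t ≠ 0 := by
    rintro rfl
    rw [map_zero, mul_zero, add_zero] at hsum
    exact hGU (hsum ▸ hu.1)
  refine mem_sup_span.mpr ⟨C (-t⁻¹) * u, Ideal.mul_mem_left _ _ hu.1, C t⁻¹, ?_⟩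
  have h2 : (C t⁻¹ * C t : MvPolynomial (Fin r) k) = 1 := by
    rw [← C_mul, inv_mul_cancel₀ ht, C_1]
  rw [← hsum, C_neg]
  linear_combination F * h2

lemma notMem_sup_span_swap (hc : c ∉ W) (hc' : c' ∉ W ⊔ Submodule.span k {c}) :
    c ∉ W ⊔ Submodule.span k {c'} := by
  intro h
  obtain ⟨w, hw, y, hy, hsum⟩ := Submodule.mem_sup.mp h
  obtain ⟨t, rfl⟩ := Submodule.mem_span_singleton.mp hy
  have ht : t ≠ 0 := by
    rintro rfl
    exact hc (by rw [← hsum]; simpa using hw)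
  refine hc' (Submodule.mem_sup.mpr ⟨-(t⁻¹ • w), W.neg_mem (W.smul_mem _ hw), t⁻¹ • c,
    Submodule.smul_mem _ _ (Submodule.mem_span_singleton_self c), ?_⟩)
  rw [← hsum, smul_add, smul_smul, inv_mul_cancel₀ ht, one_smul, neg_add_cancel_left]

lemma mem_of_linForm_pow_mul_mem (hc : c ∉ U) (hG : G ∉ linIdeal (U ⊔ Submodule.span k {c}))
    (hf : linForm c ^ a * f ∈ linIdeal U ⊔ Ideal.span {G}) :
    f ∈ linIdeal U ⊔ Ideal.span {G} := by
  induction a with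
  | zero => simpa using hf
  | succ a ih =>
    rw [pow_succ', mul_assoc] at hf
    exact ih (mem_of_linForm_mul_mem hc hG hf)

/-- Intersecting ideals `J + (L)` for many general linear forms `L`. -/
lemma exists_isHomogeneous_of_frequently [Infinite k]
    {P : Ideal (MvPolynomial (Fin r) k) → Prop} (htop : P ⊤)
    (hmono : ∀ I I', I ≤ I' → P I → P I') (hinf : ∀ I I', P I → P I' → P (I ⊓ I'))
    (hfreq : ∃ᶠ c in genericFilter k (Fin r), P (J ⊔ Ideal.span {linForm c}))
    (hreg : ∀ᶠ c in genericFilter k (Fin r), ∀ᶠ c' in genericFilter k (Fin r), ∀ f,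
      linForm c * f ∈ J ⊔ Ideal.span {linForm c'} → f ∈ J ⊔ Ideal.span {linForm c'}) (n : ℕ) :
    ∃ Q : MvPolynomial (Fin r) k, Q.IsHomogeneous n ∧ P (J ⊔ Ideal.span {Q}) := by
  suffices h : ∃ Q : MvPolynomial (Fin r) k, Q.IsHomogeneous n ∧ P (J ⊔ Ideal.span {Q}) ∧
      ∀ᶠ c' in genericFilter k (Fin r), ∀ f,
        Q * f ∈ J ⊔ Ideal.span {linForm c'} → f ∈ J ⊔ Ideal.span {linForm c'} by
    obtain ⟨Q, h1, h2, -⟩ := h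
    exact ⟨Q, h1, h2⟩
  induction n with
  | zero =>
    refine ⟨1, isHomogeneous_one _ _, ?_, by simp⟩
    rw [Ideal.span_singleton_one, sup_top_eq]
    exact htop
  | succ n ih =>
    obtain ⟨Q, hQ, hPQ, hQreg⟩ := ih
    obtain ⟨c, hPc, hc, hQc⟩ := (hfreq.and_eventually (hreg.and hQreg)).exists
    refine ⟨Q * linForm c, hQ.mul (isHomogeneous_linForm c),
      hmono _ _ (fun f hf => ?_) (hinf _ _ hPQ hPc), ?_⟩
    · obtain ⟨hf1, hf2⟩ := Submodule.mem_inf.mp hf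
      obtain ⟨j, hj, b, rfl⟩ := mem_sup_span.mp hf1
      have h1 := hQc b ((Ideal.add_mem_iff_right _ (Ideal.mem_sup_left hj)).mp hf2)
      obtain ⟨j', hj', b', rfl⟩ := mem_sup_span.mp h1
      exact mem_sup_span.mpr ⟨j + Q * j', Ideal.add_mem _ hj (Ideal.mul_mem_left _ _ hj'), b',
        by ring⟩
    · filter_upwards [hc, hQreg] with c' h1 h2 f hf
      rw [mul_assoc] at hf
      exact h1 f (h2 _ hf)

end Curves

section Step

variable {k : Type*} [Field k] {r : ℕ}
variable {V : Submodule k (MvPolynomial (Fin r) k)} {W U T : Submodule k (Fin r → k)}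
  {J : Ideal (MvPolynomial (Fin r) k)}
  {F G f : MvPolynomial (Fin r) k} {c c' : Fin r → k} {n e a m : ℕ}

/-! ### The inductive step: the curve attached to a general linear form -/

lemma isCurve_col [Infinite k] (hV : V ≤ homogeneousSubmodule (Fin r) k (n + 1 + 1))
    (hmn : m ≤ n + 3) (hcod : cod (n + 1 + 1) V + (n + 4 - m).choose 2 ≤ (n + 4).choose 2)
    (hm : ∀ c', m ≤ cod (n + 1 + 1) (add V (linForm c') (n + 1)))
    (ih : GreenAt k r (min m (n + 2)) n) (hc0 : c ≠ 0)
    (hc : cod (n + 1 + 1) (add V (linForm c) (n + 1)) = m)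
    (hkey : ∃ c₁, cod (n + 1 + 1) (add (add V (linForm c) (n + 1)) (linForm c₁) (n + 1)) +
      min m (n + 2) ≤ m) :
    IsCurve (col V (linForm c) (n + 1)) (min m (n + 2)) (n + 1) ∧
      cod (n + 1 + 1) V + (n + 4 - m).choose 2 = (n + 4).choose 2 := by
  obtain ⟨c₁, hc₁⟩ := hkey
  have hL := isHomogeneous_linForm c
  have hL0 : linForm c ≠ 0 := linForm_eq_zero_iff.not.mpr hc0
  have h1 := cod_eq_col_add hV hL hL0 (by omega : 1 + (n + 1) = n + 1 + 1)
  have h2 : (n + 4).choose 2 = _ := choose_two_succ (n + 3)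
  have h3 : (n + 4 - m).choose 2 = (n + 3 - min m (n + 2)).choose 2 + (n + 3 - m) := by
    rcases Nat.lt_or_ge (n + 2) m with h | h
    · obtain rfl : m = n + 3 := by omega
      rw [min_eq_right (by omega), show n + 4 - (n + 3) = 1 by omega,
        show n + 3 - (n + 2) = 1 by omega]
      simp
    · rw [min_eq_left h, show n + 4 - m = n + 3 - m + 1 by omega, choose_two_succ]
  have h4 : IsCurve (col V (linForm c) (n + 1)) (min m (n + 2)) (n + 1) := by
    refine ih _ col_le (by omega) (le_of_eventually_cod col_le ?_)
    filter_upwards [eventually_cod_add_le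
      (add_le hV hL (by omega : 1 + (n + 1) = n + 1 + 1)) c₁] with c' hc'
    have h5 := cod_add_le_cod_col hV hL hL0 (isHomogeneous_linForm c')
    have h6 := hm c'
    omega
  refine ⟨h4, ?_⟩
  have h5 := h4.cod_eq (by omega)
  simp only [show n + 1 + 2 = n + 3 by rfl] at h5
  omega

lemma notMem_of_gp_linIdeal_le_col [Infinite k] [CharZero k]
    (hV : V ≤ homogeneousSubmodule (Fin r) k (n + 1 + 1))
    (hmin : ∀ c', cod (n + 1 + 1) (add V (linForm c ^ 2) n) ≤
      cod (n + 1 + 1) (add V (linForm c' ^ 2) n))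
    (hle : gp (linIdeal W) (n + 1) ≤ col V (linForm c) (n + 1))
    (hpos : 0 < cod (n + 1) (col V (linForm c) (n + 1))) : c ∉ W := by
  intro hc
  have hsq : ∀ s : MvPolynomial (Fin r) k, s.IsHomogeneous n → linForm c ^ 2 * s ∈ V := by
    intro s hs
    have h1 : linForm c * s ∈ gp (linIdeal W) (n + 1) := by
      refine mem_gp.mpr ⟨Ideal.mul_mem_right _ _ (linForm_mem_of_mem hc), ?_⟩
      have h2 := (isHomogeneous_linForm c).mul hs
      rwa [add_comm] at h2
    have h3 := (mem_col.mp (hle h1)).2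
    rwa [← mul_assoc, ← pow_two] at h3
  have hadd : add V (linForm c ^ 2) n ≤ V := by
    intro f hf
    obtain ⟨v, hv, g, hg, rfl⟩ := mem_add.mp hf
    exact V.add_mem hv (hsq g hg)
  have htop : homogeneousSubmodule (Fin r) k (n + 1) ≤ col V (linForm c) (n + 1) := by
    refine homogeneousSubmodule_le fun c₁ g hg => mem_col.mpr ⟨?_, ?_⟩
    · have h2 := (isHomogeneous_linForm c₁).mul hg
      rwa [add_comm] at h2
    · have h3 := hadd (deriv_mul_mem_add hV (by omega) hmin hg (hsq g hg) c₁)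
      have h4 := V.smul_mem (2⁻¹ : k) h3
      have h5 : (2⁻¹ : k) • (((2 : ℕ) : MvPolynomial (Fin r) k) * linForm c ^ (2 - 1) *
          linForm c₁ * g) = linForm c * (linForm c₁ * g) := by
        have h6 : C (2⁻¹ : k) * ((2 : ℕ) : MvPolynomial (Fin r) k) = 1 := by
          rw [← map_natCast (C : k →+* MvPolynomial (Fin r) k), ← C_mul, Nat.cast_two,
            inv_mul_cancel₀ two_ne_zero, C_1]
        rw [smul_eq_C_mul, show 2 - 1 = 1 by rfl, pow_one]
        linear_combination (linForm c * linForm c₁ * g) * h6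
      rwa [h5] at h4
  rw [le_antisymm col_le htop, cod_self] at hpos
  exact lt_irrefl _ hpos

lemma natCast_notMem_linIdeal [CharZero k] (ha : a ≠ 0) :
    (a : MvPolynomial (Fin r) k) ∉ linIdeal U := by
  intro h
  refine (linIdeal_isPrime U).ne_top (Ideal.eq_top_of_isUnit_mem _ h ?_)
  rw [← map_natCast (C : k →+* MvPolynomial (Fin r) k)]
  exact (isUnit_iff_ne_zero.mpr (Nat.cast_ne_zero.mpr ha)).map C

lemma notMem_linIdeal_sup_of_col_eq [Infinite k] [CharZero k]
    (hV : V ≤ homogeneousSubmodule (Fin r) k (n + 1 + 1))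
    (hmin : ∀ a e, a + e = n + 1 + 1 → ∀ c', cod (n + 1 + 1) (add V (linForm c ^ a) e) ≤
      cod (n + 1 + 1) (add V (linForm c' ^ a) e))
    (hW : Module.finrank k W + 3 = r) (hcW : c ∉ W) (hF : F.IsHomogeneous m) (hFW : F ∉ linIdeal W)
    (hmn : m ≤ n + 1)
    (hcol : col V (linForm c) (n + 1) = gp (linIdeal W ⊔ Ideal.span {F}) (n + 1)) :
    F ∉ linIdeal (W ⊔ Submodule.span k {c}) := by
  intro hFc
  obtain ⟨c₁, hc₁⟩ := exists_notMem_of_finrank (U := W ⊔ Submodule.span k {c}) (s := 1)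
    (by rw [finrank_sup_span hcW]; omega)
  have hp := linIdeal_isPrime W
  have hpc := linIdeal_isPrime (W ⊔ Submodule.span k {c})
  have hL : linForm c ∉ linIdeal W := linForm_mem_linIdeal_iff.not.mpr hcW
  have key : ∀ a, a ≤ m → F ∈ linIdeal W ⊔ Ideal.span {linForm c ^ (a + 1)} := by
    intro a
    induction a with
    | zero => intro _; rwa [zero_add, pow_one, linIdeal_sup]
    | succ a ih =>
      intro ham
      have hFa := ih (by omega)
      have h1 : F ∈ gp (linIdeal W ⊔ Ideal.span {linForm c ^ (a + 1)}) m := ⟨hFa, hF⟩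
      rw [gp_sup_span isHomogIdeal_linIdeal (isHomogeneous_linForm_pow c (a + 1))
        (by omega : a + 1 + (m - (a + 1)) = m)] at h1
      obtain ⟨w, hw, g, hg, hsum⟩ := mem_add.mp h1
      have hs := isHomogeneous_linForm_pow c₁ (n + 1 - m)
      set s := linForm c₁ ^ (n + 1 - m) with hsdef
      have hgs : (g * s).IsHomogeneous (n - a) := by
        have h2 := hg.mul hs
        rwa [show m - (a + 1) + (n + 1 - m) = n - a by omega] at h2
      have h2 : linForm c ^ (a + 1) * (g * s) ∈ col V (linForm c) (n + 1) := by
        rw [hcol]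
        refine mem_gp.mpr ⟨?_, ?_⟩
        · rw [show linForm c ^ (a + 1) * (g * s) = F * s - w * s by rw [← hsum]; ring]
          exact Ideal.sub_mem _ (Ideal.mul_mem_right _ _ mem_sup_span_self)
            (Ideal.mul_mem_right _ _ (Ideal.mem_sup_left hw.1))
        · have h3 := (isHomogeneous_linForm_pow c (a + 1)).mul hgs
          rwa [show a + 1 + (n - a) = n + 1 by omega] at h3
      have h3 : linForm c ^ (a + 1 + 1) * (g * s) ∈ V := by
        rw [pow_succ' _ (a + 1), mul_assoc]
        exact (mem_col.mp h2).2
      have h4 := deriv_mul_mem_add hV (by omega) (hmin (a + 1 + 1) (n - a) (by omega)) hgs h3 c₁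
      rw [Nat.add_sub_cancel] at h4
      obtain ⟨v, hv, q, hq, hvq⟩ := mem_add.mp h4
      set N : MvPolynomial (Fin r) k := ((a + 1 + 1 : ℕ) : MvPolynomial (Fin r) k) with hN
      have hNhom : N.IsHomogeneous 0 := by
        rw [hN, ← map_natCast (C : k →+* MvPolynomial (Fin r) k)]
        exact isHomogeneous_C _ _
      have hX : (N * linForm c₁ * (g * s) - linForm c * q).IsHomogeneous (n - a + 1) := by
        refine (homogeneousSubmodule (Fin r) k (n - a + 1)).sub_mem ?_ ?_
        · have h5 := (hNhom.mul (isHomogeneous_linForm c₁)).mul hgs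
          rwa [show 0 + 1 + (n - a) = n - a + 1 by omega] at h5
        · have h5 := (isHomogeneous_linForm c).mul hq
          rwa [show 1 + (n - a) = n - a + 1 by omega] at h5
      have h5 : linForm c ^ a * (N * linForm c₁ * (g * s) - linForm c * q) ∈
          col V (linForm c) (n + 1) := by
        refine mem_col.mpr ⟨?_, ?_⟩
        · have h6 := (isHomogeneous_linForm_pow c a).mul hX
          rwa [show a + (n - a + 1) = n + 1 by omega] at h6
        · rw [show linForm c * (linForm c ^ a * (N * linForm c₁ * (g * s) - linForm c * q)) = v by
            linear_combination -hvq]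
          exact hv
      rw [hcol] at h5
      have h6 : linIdeal W ⊔ Ideal.span {F} ≤ linIdeal W ⊔ Ideal.span {linForm c ^ (a + 1)} :=
        sup_le le_sup_left ((Ideal.span_singleton_le_iff_mem _).mpr hFa)
      obtain ⟨j, hj, b, hjb⟩ := mem_sup_span.mp (h6 h5.1)
      have h7 : linForm c ^ a * (N * linForm c₁ * (g * s) - linForm c * q - linForm c * b) ∈
          linIdeal W := by
        rw [show linForm c ^ a * (N * linForm c₁ * (g * s) - linForm c * q - linForm c * b) = j by
          linear_combination -hjb]
        exact hj
      have h8 := (hp.mem_or_mem h7).resolve_left (linForm_pow_notMem hcW a)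
      have h9 : N * linForm c₁ * (g * s) ∈ linIdeal (W ⊔ Submodule.span k {c}) := by
        rw [← linIdeal_sup]
        exact mem_sup_span.mpr ⟨_, h8, q + b, by ring⟩
      have h10 : g ∈ linIdeal (W ⊔ Submodule.span k {c}) := by
        rcases hpc.mem_or_mem h9 with h | h
        · rcases hpc.mem_or_mem h with h | h
          · exact absurd h (natCast_notMem_linIdeal (by omega))
          · exact absurd (linForm_mem_linIdeal_iff.mp h) hc₁
        · exact (hpc.mem_or_mem h).resolve_right (linForm_pow_notMem hc₁ _)
      rw [← linIdeal_sup] at h10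
      obtain ⟨j', hj', b', rfl⟩ := mem_sup_span.mp h10
      exact mem_sup_span.mpr ⟨w + linForm c ^ (a + 1) * j',
        Ideal.add_mem _ hw.1 (Ideal.mul_mem_left _ _ hj'), b', by rw [← hsum]; ring⟩
  have h1 : F ∈ gp (linIdeal W ⊔ Ideal.span {linForm c ^ (m + 1)}) m := ⟨key m le_rfl, hF⟩
  rw [gp_sup_span_of_lt isHomogIdeal_linIdeal (isHomogeneous_linForm_pow c (m + 1))
    (by omega)] at h1
  exact hFW h1.1

end Step

section Step

variable {k : Type*} [Field k] {r : ℕ}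
variable {V : Submodule k (MvPolynomial (Fin r) k)} {W W' U T : Submodule k (Fin r → k)}
  {J : Ideal (MvPolynomial (Fin r) k)}
  {F G G' f : MvPolynomial (Fin r) k} {c c' : Fin r → k} {n e a m : ℕ}

/-- The residual `V : L` by `L = linForm c` contains the linear forms in `W`, and is a plane curve
with equation `G` if `m ≤ n + 1`; the trace of `V` on `L = 0` is a scheme of `m` points on
the line `W + L`, with equation `G`. -/
structure ResidualCurve (V : Submodule k (MvPolynomial (Fin r) k)) (m n : ℕ) (c : Fin r → k)
    (W : Submodule k (Fin r → k)) (G : MvPolynomial (Fin r) k) : Prop where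
  finrank_eq : Module.finrank k W + 3 = r
  notMem : c ∉ W
  gp_le_col : gp (linIdeal W) (n + 1) ≤ col V (linForm c) (n + 1)
  isHomogeneous : G.IsHomogeneous m
  notMem_linIdeal : G ∉ linIdeal (W ⊔ Submodule.span k {c})
  add_eq : add V (linForm c) (n + 1) =
    gp (linIdeal (W ⊔ Submodule.span k {c}) ⊔ Ideal.span {G}) (n + 1 + 1)
  col_eq : m ≤ n + 1 →
    col V (linForm c) (n + 1) = gp (linIdeal W ⊔ Ideal.span {G}) (n + 1)

lemma eventually_exists_residualCurve [Infinite k] [CharZero k] (hr : 3 ≤ r)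
    (hV : V ≤ homogeneousSubmodule (Fin r) k (n + 1 + 1)) (hm1 : 1 ≤ m)
    (hmn : m ≤ n + 3) (hcod : cod (n + 1 + 1) V + (n + 4 - m).choose 2 ≤ (n + 4).choose 2)
    (hm : ∀ c', m ≤ cod (n + 1 + 1) (add V (linForm c') (n + 1)))
    (hex : ∃ c', cod (n + 1 + 1) (add V (linForm c') (n + 1)) = m)
    (ih : GreenAt k r (min m (n + 2)) n)
    (hkey : ∀ c, cod (n + 1 + 1) (add V (linForm c) (n + 1)) = m →
      ∃ c₁, cod (n + 1 + 1) (add (add V (linForm c) (n + 1)) (linForm c₁) (n + 1)) +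
        min m (n + 2) ≤ m) :
    ∀ᶠ c in genericFilter k (Fin r), ∃ W G, ResidualCurve V m n c W G := by
  have hminall : ∀ᶠ c in genericFilter k (Fin r), ∀ a : Fin (n + 1 + 1 + 1), ∀ c',
      cod (n + 1 + 1) (add V (linForm c ^ (a : ℕ)) (n + 1 + 1 - a)) ≤
        cod (n + 1 + 1) (add V (linForm c' ^ (a : ℕ)) (n + 1 + 1 - a)) :=
    Filter.eventually_all.mpr fun a => eventually_forall_cod_le hV (by omega)
  filter_upwards [eventually_ne_zero (by omega), eventually_cod_add_eq hV hm hex, hminall]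
    with c hc0 hc hmin'
  have hmin : ∀ a e, a + e = n + 1 + 1 → ∀ c', cod (n + 1 + 1) (add V (linForm c ^ a) e) ≤
      cod (n + 1 + 1) (add V (linForm c' ^ a) e) := by
    intro a e hae
    have h1 := hmin' ⟨a, by omega⟩
    obtain rfl : e = n + 1 + 1 - a := by omega
    exact h1
  have hcurve := (isCurve_col hV hmn hcod hm ih hc0 hc (hkey c hc)).1
  have hpos := hcurve.cod_pos (by omega) (by omega)
  obtain ⟨W, F, hW, hF, hFW, hcol⟩ := hcurve
  have hle : gp (linIdeal W) (n + 1) ≤ col V (linForm c) (n + 1) := by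
    rw [hcol]; exact gp_mono le_sup_left
  have hcW : c ∉ W := notMem_of_gp_linIdeal_le_col hV (hmin 2 n (by omega)) hle hpos
  have hder : ∀ f ∈ col V (linForm c) (n + 1), ∀ c₁,
      linForm c₁ * f ∈ add V (linForm c) (n + 1) := by
    intro f hf c₁
    obtain ⟨hf1, hf2⟩ := mem_col.mp hf
    have h1 := deriv_mul_mem_add (a := 1) hV (by omega) (hmin 1 (n + 1) (by omega)) hf1
      (by rwa [pow_one]) c₁
    simpa using h1
  have hWadd : gp (linIdeal W) (n + 1 + 1) ≤ add V (linForm c) (n + 1) :=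
    gp_linIdeal_succ_le fun c₁ f hf => hder f (hle hf) c₁
  have hWc : gp (linIdeal (W ⊔ Submodule.span k {c})) (n + 1 + 1) ≤
      add V (linForm c) (n + 1) := by
    rw [← linIdeal_sup, gp_sup_span isHomogIdeal_linIdeal (isHomogeneous_linForm c)
      (by omega : 1 + (n + 1) = n + 1 + 1)]
    intro f hf
    obtain ⟨v, hv, g, hg, rfl⟩ := mem_add.mp hf
    exact Submodule.add_mem _ (hWadd hv) (mul_mem_add hg)
  have hadd : add V (linForm c) (n + 1) ≤ homogeneousSubmodule (Fin r) k (n + 1 + 1) :=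
    add_le hV (isHomogeneous_linForm c) (by omega)
  have hfin : Module.finrank k ↥(W ⊔ Submodule.span k {c}) + 2 = r := by
    rw [finrank_sup_span hcW]; omega
  have heq : ∀ G : MvPolynomial (Fin r) k, G.IsHomogeneous m →
      G ∉ linIdeal (W ⊔ Submodule.span k {c}) →
      gp (linIdeal (W ⊔ Submodule.span k {c}) ⊔ Ideal.span {G}) (n + 1 + 1) ≤
        add V (linForm c) (n + 1) →
      add V (linForm c) (n + 1) =
        gp (linIdeal (W ⊔ Submodule.span k {c}) ⊔ Ideal.span {G}) (n + 1 + 1) := by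
    intro G hG hGW h
    have h1 := cod_points (n := n + 1 + 1) hfin hG hGW (by omega)
    exact (eq_of_le_of_cod_le hadd h (by omega)).symm
  rcases (by omega : m ≤ n + 1 ∨ m = n + 2 ∨ m = n + 3) with h | h | h
  · rw [min_eq_left (by omega)] at hF
    have hFc := notMem_linIdeal_sup_of_col_eq hV hmin hW hcW hF hFW h hcol
    refine ⟨W, F, hW, hcW, hle, hF, hFc, heq F hF hFc ?_, fun _ => hcol⟩
    rw [gp_sup_span isHomogIdeal_linIdeal hF (by omega : m + (n + 1 - m + 1) = n + 1 + 1)]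
    have h1 : homogeneousSubmodule (Fin r) k (n + 1 - m + 1) ≤
        (add V (linForm c) (n + 1)).comap (LinearMap.mulLeft k F) := by
      refine homogeneousSubmodule_le fun c₁ g hg => ?_
      rw [Submodule.mem_comap, LinearMap.mulLeft_apply, mul_left_comm]
      refine hder _ ?_ c₁
      rw [hcol]
      refine mem_gp.mpr ⟨Ideal.mul_mem_right _ _ mem_sup_span_self, ?_⟩
      have h2 := hF.mul hg
      rwa [show m + (n + 1 - m) = n + 1 by omega] at h2
    intro f hf
    obtain ⟨v, hv, g, hg, rfl⟩ := mem_add.mp hf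
    have h2 := h1 ((mem_homogeneousSubmodule _ g).mpr hg)
    rw [Submodule.mem_comap, LinearMap.mulLeft_apply] at h2
    exact Submodule.add_mem _ (hWc hv) h2
  · obtain ⟨G, hG, hGW⟩ : ∃ G ∈ add V (linForm c) (n + 1),
        G ∉ gp (linIdeal (W ⊔ Submodule.span k {c})) (n + 1 + 1) := by
      by_contra! hcon
      have h1 := cod_anti gp_le hcon
      rw [cod_linIdeal_of_finrank_two hfin] at h1
      omega
    have hGhom : G.IsHomogeneous (n + 1 + 1) := hadd hG
    have hGW' : G ∉ linIdeal (W ⊔ Submodule.span k {c}) := fun h => hGW ⟨h, hGhom⟩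
    obtain rfl : m = n + 1 + 1 := by omega
    exact ⟨W, G, hW, hcW, hle, hGhom, hGW', heq G hGhom hGW'
      (gp_sup_span_le_of_mem isHomogIdeal_linIdeal hGhom hWc hG), fun h => by omega⟩
  · obtain ⟨c₁, hc₁⟩ := exists_notMem_of_finrank (s := 1) hfin
    have hG := isHomogeneous_linForm_pow c₁ m
    have hGW := linForm_pow_notMem hc₁ m
    refine ⟨W, linForm c₁ ^ m, hW, hcW, hle, hG, hGW, heq _ hG hGW ?_, fun h => by omega⟩
    rwa [gp_sup_span_of_lt isHomogIdeal_linIdeal hG (by omega)]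

namespace ResidualCurve

variable (h : ResidualCurve V m n c W G) (h' : ResidualCurve V m n c' W' G')

include h

lemma le : V ≤ gp (linIdeal (W ⊔ Submodule.span k {c}) ⊔ Ideal.span {G}) (n + 1 + 1) :=
  h.add_eq ▸ le_add

lemma finrank_sup : Module.finrank k ↥(W ⊔ Submodule.span k {c}) + 2 = r := by
  have h1 := h.finrank_eq
  rw [finrank_sup_span h.notMem]; omega

include h'

lemma linForm_mem (hc' : c' ∉ W ⊔ Submodule.span k {c})
    (hG : G ∉ linIdeal (W ⊔ Submodule.span k {c} ⊔ Submodule.span k {c'})) {w : Fin r → k}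
    (hw : w ∈ W') : linForm w ∈ linIdeal (W ⊔ Submodule.span k {c}) ⊔ Ideal.span {G} := by
  have h1 : linForm c' ^ n * linForm w ∈ gp (linIdeal W') (n + 1) :=
    mem_gp.mpr ⟨Ideal.mul_mem_left _ _ (linForm_mem_of_mem hw),
      (isHomogeneous_linForm_pow c' n).mul (isHomogeneous_linForm w)⟩
  have h2 := (mem_col.mp (h'.gp_le_col h1)).2
  rw [← mul_assoc, ← pow_succ'] at h2
  exact mem_of_linForm_pow_mul_mem hc' hG (h.le h2).1

lemma mem (hc' : c' ∉ W ⊔ Submodule.span k {c})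
    (hG : G ∉ linIdeal (W ⊔ Submodule.span k {c} ⊔ Submodule.span k {c'})) (hmn : m ≤ n + 1) :
    G' ∈ linIdeal (W ⊔ Submodule.span k {c}) ⊔ Ideal.span {G} := by
  have h1 : linForm c' ^ (n + 1 - m) * G' ∈ col V (linForm c') (n + 1) := by
    rw [h'.col_eq hmn]
    refine mem_gp.mpr ⟨Ideal.mul_mem_left _ _ mem_sup_span_self, ?_⟩
    have h2 := (isHomogeneous_linForm_pow c' (n + 1 - m)).mul h'.isHomogeneous
    rwa [show n + 1 - m + m = n + 1 by omega] at h2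
  have h2 := (mem_col.mp h1).2
  rw [← mul_assoc, ← pow_succ'] at h2
  exact mem_of_linForm_pow_mul_mem hc' hG (h.le h2).1

lemma le_sup (hm : 2 ≤ m) (hc' : c' ∉ W ⊔ Submodule.span k {c})
    (hG : G ∉ linIdeal (W ⊔ Submodule.span k {c} ⊔ Submodule.span k {c'})) :
    W' ≤ W ⊔ Submodule.span k {c} := by
  intro w hw
  have h1 : linForm w ∈ gp (linIdeal (W ⊔ Submodule.span k {c}) ⊔ Ideal.span {G}) 1 :=
    mem_gp.mpr ⟨h.linForm_mem h' hc' hG hw, isHomogeneous_linForm w⟩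
  rw [gp_sup_span_of_lt isHomogIdeal_linIdeal h.isHomogeneous (by omega)] at h1
  exact linForm_mem_linIdeal_iff.mp h1.1

end ResidualCurve

end Step

section Patching

variable {k : Type*} [Field k] [Infinite k] {r : ℕ}
variable {V : Submodule k (MvPolynomial (Fin r) k)} {W W' U T : Submodule k (Fin r → k)}
  {J : Ideal (MvPolynomial (Fin r) k)}
  {F G G' f : MvPolynomial (Fin r) k} {c c' : Fin r → k} {n e a m : ℕ}

/-! ### The inductive step: patching the residual curves -/

lemma gp_linIdeal_le_of_eventually
    (h : ∀ᶠ c in genericFilter k (Fin r), gp (linIdeal T) (n + 1) ≤ col V (linForm c) (n + 1)) :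
    gp (linIdeal T) (n + 1 + 1) ≤ V :=
  gp_linIdeal_succ_le fun c _ hf =>
    mul_mem_of_eventually h (fun _ hc' => (mem_col.mp (hc' hf)).2) c

lemma exists_forall_eventually_residualCurve (hm : 2 ≤ m)
    (h : ∀ᶠ c in genericFilter k (Fin r), ∃ W G, ResidualCurve V m n c W G) :
    ∃ W : Submodule k (Fin r → k), Module.finrank k W + 3 = r ∧
      ∀ᶠ c in genericFilter k (Fin r), ∃ G, ResidualCurve V m n c W G := by
  have hgen : ∀ {c W G}, ResidualCurve V m n c W G → ∀ᶠ c' in genericFilter k (Fin r),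
      c' ∉ W ⊔ Submodule.span k {c} ∧
        G ∉ linIdeal (W ⊔ Submodule.span k {c} ⊔ Submodule.span k {c'}) := by
    intro c W G h
    obtain ⟨p, rfl⟩ : ∃ p, m = p + 1 := ⟨m - 1, by omega⟩
    exact eventually_notMem_linIdeal h.finrank_sup h.isHomogeneous h.notMem_linIdeal
  obtain ⟨c₁, W₁, G₁, h₁⟩ := h.exists
  obtain ⟨c₂, ⟨W₂, G₂, h₂⟩, h₂₁, -⟩ := (h.and (hgen h₁)).exists
  have hlt : (W₁ ⊔ Submodule.span k {c₁}) ⊓ (W₂ ⊔ Submodule.span k {c₂}) <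
      W₂ ⊔ Submodule.span k {c₂} := by
    refine lt_of_le_of_ne inf_le_right fun heq => h₂₁ ?_
    have h3 : c₂ ∈ W₂ ⊔ Submodule.span k {c₂} :=
      Submodule.mem_sup_right (Submodule.mem_span_singleton_self c₂)
    rw [← heq] at h3
    exact h3.1
  have hfin := Submodule.finrank_lt_finrank_of_lt hlt
  have hfin₂ := h₂.finrank_sup
  have key : ∀ᶠ c in genericFilter k (Fin r), ∃ W G, ResidualCurve V m n c W G ∧
      W = (W₁ ⊔ Submodule.span k {c₁}) ⊓ (W₂ ⊔ Submodule.span k {c₂}) := by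
    filter_upwards [h, hgen h₁, hgen h₂] with c ⟨W, G, hW⟩ hc₁ hc₂
    refine ⟨W, G, hW, Submodule.eq_of_le_of_finrank_le (le_inf ?_ ?_) ?_⟩
    · exact h₁.le_sup hW hm hc₁.1 hc₁.2
    · exact h₂.le_sup hW hm hc₂.1 hc₂.2
    · have h3 := hW.finrank_eq
      omega
  obtain ⟨c, W, G, hW, rfl⟩ := key.exists
  refine ⟨_, hW.finrank_eq, key.mono ?_⟩
  rintro c' ⟨_, G', hW', rfl⟩
  exact ⟨G', hW'⟩

lemma exists_frequently_notMem (hW : Module.finrank k W + 3 = r)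
    {G : (Fin r → k) → MvPolynomial (Fin r) k}
    (hG : ∀ᶠ c in genericFilter k (Fin r), ResidualCurve V m n c W (G c)) :
    ∃ c₁, ResidualCurve V m n c₁ W (G c₁) ∧
      ∃ᶠ c in genericFilter k (Fin r), G c ∉ linIdeal (W ⊔ Submodule.span k {c₁}) := by
  by_contra! hcon
  have h1 : ∀ᶠ c₁ in genericFilter k (Fin r), ∀ᶠ c in genericFilter k (Fin r),
      G c ∈ linIdeal W ⊔ Ideal.span {linForm c₁} := by
    filter_upwards [hG] with c₁ hc₁
    have h2 := hcon c₁ hc₁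
    rw [linIdeal_sup]
    simpa [Filter.not_frequently] using h2
  obtain ⟨Q, hQ, hQG⟩ := exists_isHomogeneous_of_frequently
    (P := fun I => ∀ᶠ c in genericFilter k (Fin r), G c ∈ I) (J := linIdeal W)
    (Filter.Eventually.of_forall fun _ => Submodule.mem_top)
    (fun I I' hI h => h.mono fun _ hc => hI hc)
    (fun I I' h h' => (h.and h').mono fun _ hc => hc) h1.frequently
    (by
      filter_upwards [eventually_notMem (ne_top_of_finrank hW)] with c hc
      have h2 : W ⊔ Submodule.span k {c} ≠ ⊤ :=
        ne_top_of_finrank (s := 1) (by rw [finrank_sup_span hc]; omega)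
      filter_upwards [eventually_notMem h2] with c' hc' f hf
      rw [linIdeal_sup] at hf ⊢
      exact ((linIdeal_isPrime _).mem_or_mem hf).resolve_left
        (linForm_mem_linIdeal_iff.not.mpr (notMem_sup_span_swap hc hc'))) (m + 1)
  obtain ⟨c, hc, hcQ⟩ := (hG.and hQG).exists
  have h2 : G c ∈ gp (linIdeal W ⊔ Ideal.span {Q}) m := ⟨hcQ, hc.isHomogeneous⟩
  rw [gp_sup_span_of_lt isHomogIdeal_linIdeal hQ (by omega)] at h2
  exact hc.notMem_linIdeal (linIdeal_mono le_sup_left h2.1)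

lemma exists_le_gp_of_eventually (hV : V ≤ homogeneousSubmodule (Fin r) k (n + 1 + 1))
    (hm : 2 ≤ m) (hmn : m ≤ n + 1)
    (hW : Module.finrank k W + 3 = r)
    (h : ∀ᶠ c in genericFilter k (Fin r), ∃ G, ResidualCurve V m n c W G) :
    ∃ F : MvPolynomial (Fin r) k, F.IsHomogeneous m ∧ F ∉ linIdeal W ∧
      V ≤ gp (linIdeal W ⊔ Ideal.span {F}) (n + 1 + 1) := by
  obtain ⟨p, rfl⟩ : ∃ p, m = p + 1 := ⟨m - 1, by omega⟩
  obtain ⟨G, hG⟩ := Filter.skolem.mp h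
  obtain ⟨c₁, h₁, hfreq⟩ := exists_frequently_notMem hW hG
  have hgen := eventually_notMem_linIdeal h₁.finrank_sup h₁.isHomogeneous h₁.notMem_linIdeal
  have hA := h₁.isHomogeneous
  set A := G c₁ with hAdef
  have hJ := isHomogIdeal_sup (isHomogIdeal_linIdeal (U := W)) hA
  obtain ⟨Q, hQ, hQV⟩ := exists_isHomogeneous_of_frequently
    (P := fun I => ∀ f ∈ V, f ∈ I) (J := linIdeal W ⊔ Ideal.span {A})
    (fun _ _ => Submodule.mem_top) (fun I I' hI h f hf => hI (h f hf))
    (fun I I' h h' f hf => ⟨h f hf, h' f hf⟩)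
    (by
      refine (hfreq.and_eventually (hG.and hgen)).mono ?_
      rintro c ⟨hGc, hc, hcc₁, hAc⟩ f hf
      have h1 := mem_sup_span_swap hA hc.isHomogeneous (h₁.mem hc hcc₁ hAc hmn) hGc
      have h2 : G c ∉ linIdeal (W ⊔ Submodule.span k {c} ⊔ Submodule.span k {c₁}) := by
        rw [sup_right_comm]
        intro h3
        exact hAc ((sup_le (linIdeal_mono le_sup_left)
          ((Ideal.span_singleton_le_iff_mem _).mpr h3)) h1)
      have h3 := hc.mem h₁ (notMem_sup_span_swap h₁.notMem hcc₁) h2 hmn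
      have h4 : A ∉ linIdeal (W ⊔ Submodule.span k {c}) := fun h5 =>
        hAc (linIdeal_mono (sup_le_sup_right le_sup_left _) h5)
      have h5 := mem_sup_span_swap hc.isHomogeneous hA h3 h4
      rw [sup_right_comm, linIdeal_sup]
      exact (sup_le le_sup_left ((Ideal.span_singleton_le_iff_mem _).mpr h5)) (hc.le hf).1)
    (by
      filter_upwards [eventually_notMem (ne_top_of_finrank hW), hgen] with c hc hAc
      have h4 : A ∉ linIdeal (W ⊔ Submodule.span k {c}) := fun h5 =>
        hAc.2 (linIdeal_mono (sup_le_sup_right le_sup_left _) h5)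
      filter_upwards [eventually_notMem_linIdeal (by rw [finrank_sup_span hc]; omega) hA h4]
        with c' hc' f hf
      rw [sup_right_comm, linIdeal_sup] at hf ⊢
      refine mem_of_linForm_mul_mem (notMem_sup_span_swap hc hc'.1) ?_ hf
      rw [sup_right_comm]
      exact hc'.2) (n + 1 + 1 + 1)
  refine ⟨A, hA, fun h5 => h₁.notMem_linIdeal (linIdeal_mono le_sup_left h5), fun f hf => ?_⟩
  rw [← gp_sup_span_of_lt hJ hQ (Nat.lt_succ_self _)]
  exact ⟨hQV f hf, hV hf⟩

lemma isCurve_of_eventually_residualCurve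
    (hV : V ≤ homogeneousSubmodule (Fin r) k (n + 1 + 1))
    (hcod : cod (n + 1 + 1) V + (n + 1 + 1 + 2 - m).choose 2 = (n + 1 + 1 + 2).choose 2)
    (hm : 2 ≤ m) (hmn : m ≤ n + 3)
    (h : ∀ᶠ c in genericFilter k (Fin r), ∃ W G, ResidualCurve V m n c W G) :
    IsCurve V m (n + 1 + 1) := by
  obtain ⟨W, hW, hWG⟩ := exists_forall_eventually_residualCurve hm h
  rcases Nat.lt_or_ge (n + 1) m with hlt | hle
  · have hle : gp (linIdeal W) (n + 1 + 1) ≤ V :=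
      gp_linIdeal_le_of_eventually (hWG.mono fun c ⟨_, hc⟩ => hc.gp_le_col)
    rcases (by omega : m = n + 1 + 1 ∨ m = n + 3) with rfl | rfl
    · obtain ⟨F, hF, hFW⟩ : ∃ F ∈ V, F ∉ gp (linIdeal W) (n + 1 + 1) := by
        by_contra! hcon
        have h1 := cod_anti gp_le hcon
        rw [cod_linIdeal_of_finrank_three hW] at h1
        have h2 : (n + 1 + 1 + 2 - (n + 1 + 1)).choose 2 = 1 := by
          rw [Nat.add_sub_cancel_left]; decide
        omega
      have hFhom : F.IsHomogeneous (n + 1 + 1) := hV hF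
      exact isCurve_of_le hV hcod (by omega) hW hFhom (fun h3 => hFW ⟨h3, hFhom⟩)
        (Or.inr (gp_sup_span_le_of_mem isHomogIdeal_linIdeal hFhom hle hF))
    · obtain ⟨c₁, hc₁⟩ := exists_notMem_of_finrank hW
      have hF := isHomogeneous_linForm_pow c₁ (n + 3)
      refine isCurve_of_le hV hcod (by omega) hW hF (linForm_pow_notMem hc₁ _) (Or.inr ?_)
      rwa [gp_sup_span_of_lt isHomogIdeal_linIdeal hF (by omega)]
  · obtain ⟨F, hF, hFW, hVF⟩ := exists_le_gp_of_eventually hV hm hle hW hWG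
    exact isCurve_of_le hV hcod (by omega) hW hF hFW (Or.inl hVF)

omit [Infinite k] in
lemma ResidualCurve.sup_span_le {g g' : Fin r → k} (h : ResidualCurve V 1 n c W (linForm g))
    (h' : ResidualCurve V 1 n c' W' (linForm g'))
    (hc' : c' ∉ W ⊔ Submodule.span k {c} ⊔ Submodule.span k {g}) :
    W' ⊔ Submodule.span k {g'} ≤ W ⊔ Submodule.span k {c} ⊔ Submodule.span k {g} := by
  have h1 : c' ∉ W ⊔ Submodule.span k {c} := fun h2 => hc' (Submodule.mem_sup_left h2)
  have h2 : g ∉ W ⊔ Submodule.span k {c} := fun h3 => h.notMem_linIdeal (linForm_mem_of_mem h3)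
  have h3 := linForm_mem_linIdeal_iff.not.mpr (notMem_sup_span_swap h2 hc')
  refine sup_le (fun w hw => ?_) ((Submodule.span_singleton_le_iff_mem _ _).mpr ?_)
  · have h4 := h.linForm_mem h' h1 h3 hw
    rwa [linIdeal_sup, linForm_mem_linIdeal_iff] at h4
  · have h4 := h.mem h' h1 h3 (by omega)
    rwa [linIdeal_sup, linForm_mem_linIdeal_iff] at h4

lemma isCurve_one_of_eventually_residualCurve
    (hV : V ≤ homogeneousSubmodule (Fin r) k (n + 1 + 1))
    (hcod : cod (n + 1 + 1) V + (n + 1 + 1 + 2 - 1).choose 2 = (n + 1 + 1 + 2).choose 2)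
    (h : ∀ᶠ c in genericFilter k (Fin r), ∃ W G, ResidualCurve V 1 n c W G) :
    IsCurve V 1 (n + 1 + 1) := by
  replace h : ∀ᶠ c in genericFilter k (Fin r), ∃ W g, ResidualCurve V 1 n c W (linForm g) := by
    filter_upwards [h] with c ⟨W, G, hW⟩
    obtain ⟨g, rfl⟩ := exists_linForm_eq hW.isHomogeneous
    exact ⟨W, g, hW⟩
  have hfinH : ∀ {c W g}, ResidualCurve V 1 n c W (linForm g) →
      Module.finrank k ↥(W ⊔ Submodule.span k {c} ⊔ Submodule.span k {g}) + 1 = r := by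
    intro c W g hW
    rw [finrank_sup_span fun h3 => hW.notMem_linIdeal (linForm_mem_of_mem h3)]
    have h1 := hW.finrank_sup
    omega
  obtain ⟨c₁, W₁, g₁, h₁⟩ := h.exists
  have hgen₁ := eventually_notMem (ne_top_of_finrank (s := 0) (hfinH h₁))
  obtain ⟨c₂, ⟨W₂, g₂, h₂⟩, h₂₁⟩ := (h.and hgen₁).exists
  have hgen₂ := eventually_notMem (ne_top_of_finrank (s := 0) (hfinH h₂))
  set H₁ := W₁ ⊔ Submodule.span k {c₁} ⊔ Submodule.span k {g₁} with hH₁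
  set H₂ := W₂ ⊔ Submodule.span k {c₂} ⊔ Submodule.span k {g₂} with hH₂
  have hlt : H₁ ⊓ H₂ < H₂ := by
    refine lt_of_le_of_ne inf_le_right fun heq => h₂₁ ?_
    have h3 : c₂ ∈ H₂ :=
      Submodule.mem_sup_left (Submodule.mem_sup_right (Submodule.mem_span_singleton_self c₂))
    rw [← heq] at h3
    exact h3.1
  have hfin := Submodule.finrank_lt_finrank_of_lt hlt
  have hfin₂ : Module.finrank k H₂ + 1 = r := hfinH h₂
  have key : ∀ᶠ c in genericFilter k (Fin r), Module.finrank k ↥(H₁ ⊓ H₂) + 2 = r ∧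
      gp (linIdeal (H₁ ⊓ H₂)) (n + 1) ≤ col V (linForm c) (n + 1) := by
    filter_upwards [h, hgen₁, hgen₂] with c ⟨W, g, hW⟩ hc₁ hc₂
    have hg : g ∉ W := fun h3 =>
      hW.notMem_linIdeal (linForm_mem_of_mem (Submodule.mem_sup_left h3))
    have h1 := finrank_sup_span hg
    have h2 := hW.finrank_eq
    have h3 : W ⊔ Submodule.span k {g} = H₁ ⊓ H₂ := by
      refine Submodule.eq_of_le_of_finrank_le
        (le_inf (h₁.sup_span_le hW hc₁) (h₂.sup_span_le hW hc₂)) ?_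
      omega
    rw [← h3]
    refine ⟨by omega, ?_⟩
    rw [← linIdeal_sup, hW.col_eq (by omega)]
  have hle := gp_linIdeal_le_of_eventually (key.mono fun c hc => hc.2)
  obtain ⟨_, hfinT, _⟩ := key.exists
  have hr := h₁.finrank_eq
  obtain ⟨W, x, hx, hWx, hW⟩ := exists_sup_span_eq (T := H₁ ⊓ H₂) (s := r - 3) (by omega)
  refine isCurve_of_le (F := linForm x) (W := W) hV hcod (by omega) (by omega)
    (isHomogeneous_linForm x)
    (linForm_mem_linIdeal_iff.not.mpr hx) (Or.inr ?_)
  rwa [linIdeal_sup, hWx]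

end Patching

section Induction

variable {k : Type*} [Field k] [Infinite k] [CharZero k] {r m n : ℕ}

lemma GreenAt.succ (hr : 3 ≤ r) (hm1 : 1 ≤ m) (hmn : m ≤ n + 3)
    (ih : GreenAt k r (min m (n + 2)) n)
    (hkey : ∀ V : Submodule k (MvPolynomial (Fin r) k),
      V ≤ homogeneousSubmodule (Fin r) k (n + 1 + 1) → cod (n + 1 + 1) V = m →
      ∃ c, cod (n + 1 + 1) (add V (linForm c) (n + 1)) + min m (n + 2) ≤ m) :
    GreenAt k r m (n + 1) := by
  refine greenAt_of_exact hmn fun V hV hcod hm hex => ?_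
  have hkey' : ∀ c, cod (n + 1 + 1) (add V (linForm c) (n + 1)) = m →
      ∃ c₁, cod (n + 1 + 1) (add (add V (linForm c) (n + 1)) (linForm c₁) (n + 1)) +
        min m (n + 2) ≤ m := fun c hc =>
    hkey _ (add_le hV (isHomogeneous_linForm c) (by omega)) hc
  obtain ⟨c, hc0, hc⟩ :=
    ((eventually_ne_zero (by omega)).and (eventually_cod_add_eq hV hm hex)).exists
  have hcod' := (isCurve_col hV hmn hcod hm ih hc0 hc (hkey' c hc)).2
  rw [show n + 4 = n + 1 + 1 + 2 from rfl] at hcod'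
  have hres := eventually_exists_residualCurve hr hV hm1 hmn hcod hm hex ih hkey'
  rcases (by omega : m = 1 ∨ 2 ≤ m) with rfl | h2
  · exact isCurve_one_of_eventually_residualCurve hV hcod' hres
  · exact isCurve_of_eventually_residualCurve hV hcod' h2 hmn hres

theorem greenAt (hr : 3 ≤ r) (hm1 : 1 ≤ m) (hmn : m ≤ n + 2) : GreenAt k r m n := by
  induction n generalizing m with
  | zero => exact greenAt_zero hr hm1 hmn
  | succ n ih =>
    have hlow : ∀ m, 1 ≤ m → m ≤ n + 2 → GreenAt k r m (n + 1) := by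
      intro m hm1 hmn
      refine GreenAt.succ hr hm1 (by omega) (ih (by omega) (by omega)) fun V hV hcod => ?_
      obtain ⟨c, hc⟩ := exists_cod_add_eq_zero (by omega) hV (by omega)
      exact ⟨c, by omega⟩
    rcases (by omega : m ≤ n + 2 ∨ m = n + 3) with h | rfl
    · exact hlow m hm1 h
    · refine GreenAt.succ hr hm1 le_rfl (ih (by omega) (by omega)) fun V hV hcod => ?_
      have h1 : (n + 4).choose 2 = _ := choose_two_succ (n + 3)
      obtain ⟨c, hc⟩ := (hlow 1 le_rfl (by omega)).exists_cod_le (by omega) hV (by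
        simp only [show n + 1 + 3 = n + 4 by rfl, show n + 4 - 1 = n + 3 by rfl]
        omega)
      exact ⟨c, by omega⟩

end Induction

section Hilbert

variable {k : Type*} [Field k] {r : ℕ} {I : Ideal (MvPolynomial (Fin r) k)}
  {W : Submodule k (Fin r → k)} {F : MvPolynomial (Fin r) k} {c : Fin r → k} {d e a m : ℕ}

lemma hilb_eq_cod : hilb k r I d = cod d (gp I d) := by
  have h1 := LinearMap.finrank_range_add_finrank_ker
    ((Ideal.Quotient.mkₐ k I).toLinearMap.domRestrict (homogeneousSubmodule (Fin r) k d))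
  have h2 : LinearMap.range ((Ideal.Quotient.mkₐ k I).toLinearMap.domRestrict
      (homogeneousSubmodule (Fin r) k d)) = gradedPiece k r I d :=
    LinearMap.range_domRestrict _ _
  have h3 : (LinearMap.ker ((Ideal.Quotient.mkₐ k I).toLinearMap.domRestrict
      (homogeneousSubmodule (Fin r) k d))).map (homogeneousSubmodule (Fin r) k d).subtype =
        gp I d := by
    ext f
    simp only [Submodule.mem_map, LinearMap.mem_ker, LinearMap.domRestrict_apply,
      AlgHom.toLinearMap_apply, Ideal.Quotient.mkₐ_eq_mk, Ideal.Quotient.eq_zero_iff_mem,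
      Submodule.subtype_apply, mem_gp]
    constructor
    · rintro ⟨g, hg, rfl⟩
      exact ⟨hg, g.2⟩
    · rintro ⟨h, h'⟩
      exact ⟨⟨f, h'⟩, h, rfl⟩
  have h4 := LinearEquiv.finrank_eq (Submodule.equivMapOfInjective
    (homogeneousSubmodule (Fin r) k d).subtype (Submodule.subtype_injective _)
    (LinearMap.ker ((Ideal.Quotient.mkₐ k I).toLinearMap.domRestrict
      (homogeneousSubmodule (Fin r) k d))))
  have h5 := cod_add_finrank (gp_le : gp I d ≤ _)
  rw [h3] at h4
  rw [h2] at h1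
  rw [hilb]
  omega

lemma hilb_sup_span (hI : IsHomogIdeal I) (c : Fin r → k) :
    hilb k r (I ⊔ Ideal.span {linForm c}) (d + 1) =
      cod (d + 1) (add (gp I (d + 1)) (linForm c) d) := by
  rw [hilb_eq_cod, gp_sup_span hI (isHomogeneous_linForm c) (add_comm 1 d)]

lemma mul_choose_two_eq (hm : 1 ≤ m) (hmd : m ≤ d) :
    m * d + 1 - (m - 1).choose 2 + (d + 2 - m).choose 2 = (d + 2).choose 2 := by
  obtain ⟨p, rfl⟩ : ∃ p, m = p + 1 := ⟨m - 1, by omega⟩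
  obtain ⟨q, rfl⟩ : ∃ q, d = p + 1 + q := ⟨d - (p + 1), by omega⟩
  rw [Nat.add_sub_cancel, show p + 1 + q + 2 - (p + 1) = q + 2 by omega]
  have h1 : (p + 1) * (p + 1 + q) + 1 + (q + 2).choose 2 =
      (p + 1 + q + 2).choose 2 + p.choose 2 := by
    induction p with
    | zero =>
      have h2 : (q + 3).choose 2 = _ := choose_two_succ (q + 2)
      rw [show 0 + 1 + q + 2 = q + 3 by omega, h2]
      simp only [Nat.choose_zero_succ]
      omega
    | succ p ih =>
      have h2 : (p + 1 + 1 + q + 2).choose 2 = (p + 1 + q + 2).choose 2 + (p + 1 + q + 2) := by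
        rw [← choose_two_succ]; congr 1; omega
      rw [h2, choose_two_succ p]
      have h3 := ih (by omega) (by omega)
      nlinarith
  have h2 := Nat.choose_le_choose 2 (by omega : q + 2 ≤ p + 1 + q + 2)
  omega

/-- The linear forms in a subspace, in terms of a basis. -/
lemma gp_linIdeal_eq_iSup {ι : Type*} (b : Module.Basis ι k W) :
    gp (linIdeal W) (d + 1) = ⨆ i, (homogeneousSubmodule (Fin r) k d).map
      (LinearMap.mulLeft k (linForm (b i : Fin r → k))) := by
  apply le_antisymm
  · refine gp_linIdeal_le fun c hc g hg => ?_
    have h1 : (⟨c, hc⟩ : W) ∈ Submodule.span k (Set.range b) := by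
      rw [b.span_eq]; exact Submodule.mem_top
    have h2 : Submodule.span k (Set.range b) ≤ (⨆ i, (homogeneousSubmodule (Fin r) k d).map
        (LinearMap.mulLeft k (linForm (b i : Fin r → k)))).comap
          (LinearMap.mulRight k g ∘ₗ linFormₗ k r ∘ₗ W.subtype) := by
      rw [Submodule.span_le]
      rintro _ ⟨i, rfl⟩
      exact Submodule.mem_iSup_of_mem i
        (Submodule.mem_map.mpr ⟨g, (mem_homogeneousSubmodule _ g).mpr hg, rfl⟩)
    have h3 := h2 h1
    rw [Submodule.mem_comap] at h3
    exact h3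
  · refine iSup_le fun i => ?_
    rintro _ ⟨g, hg, rfl⟩
    rw [LinearMap.mulLeft_apply]
    refine mem_gp.mpr ⟨Ideal.mul_mem_right _ _ (linForm_mem_of_mem (b i).2), ?_⟩
    have h1 := (isHomogeneous_linForm (b i : Fin r → k)).mul
      ((mem_homogeneousSubmodule _ g).mp hg)
    rwa [add_comm] at h1

lemma IsCurve.exists_linearIndependent {V : Submodule k (MvPolynomial (Fin r) k)}
    (h : IsCurve V m (d + 1)) (hmd : m ≤ d + 1) :
    ∃ (L : Fin (r - 3) → MvPolynomial (Fin r) k) (F : MvPolynomial (Fin r) k),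
      (∀ i, (L i).IsHomogeneous 1) ∧ LinearIndependent k L ∧ F.IsHomogeneous m ∧ F ≠ 0 ∧
      V = (⨆ i, (homogeneousSubmodule (Fin r) k d).map (LinearMap.mulLeft k (L i))) ⊔
        (homogeneousSubmodule (Fin r) k (d + 1 - m)).map (LinearMap.mulLeft k F) := by
  obtain ⟨W, F, hW, hF, hFW, rfl⟩ := h
  let b := Module.finBasisOfFinrankEq k W (by omega : Module.finrank k W = r - 3)
  refine ⟨fun i => linForm (b i : Fin r → k), F, fun i => isHomogeneous_linForm _, ?_, hF,
    ne_zero_of_notMem hFW, ?_⟩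
  · have h1 := b.linearIndependent.map' W.subtype W.ker_subtype
    exact h1.map' (linFormₗ k r) (LinearMap.ker_eq_bot.mpr linFormₗ_injective)
  · rw [gp_sup_span isHomogIdeal_linIdeal hF (by omega : m + (d + 1 - m) = d + 1),
      gp_linIdeal_eq_iSup b]
    rfl

end Hilbert

end GreenPlaneCurve

open GreenPlaneCurve in
/-- **Green's Theorem 4.** Assume `char k = 0`. If
`dim_k (R/I)_d = md + 1 - C(m-1, 2)` and for a general linear form `L` one has
`dim_k (R/(I+(L)))_d = m`, then in degree `d` the ideal `I` is the ideal of a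
plane curve of degree `m`:
`I_d = ⟨L_1, …, L_{r-3}⟩ · R_{d-1} + F · R_{d-m}` for linearly independent
linear forms `L_1, …, L_{r-3}` and a form `F` of degree `m`. -/
theorem green_theorem_4
    (k : Type*) [Field k] [Infinite k] [CharZero k]
    (r d m : ℕ) (hr : 3 ≤ r) (hm : 1 ≤ m) (hmd : m ≤ d)
    (I : Ideal (MvPolynomial (Fin r) k)) (hI : IsHomogIdeal I)
    (hhd : hilb k r I d = m * d + 1 - Nat.choose (m - 1) 2)
    (hgen : Generically k r (fun L => hilb k r (I ⊔ Ideal.span {L}) d = m)) :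
    ∃ (L : Fin (r - 3) → MvPolynomial (Fin r) k) (F : MvPolynomial (Fin r) k),
      (∀ i, (L i).IsHomogeneous 1) ∧ LinearIndependent k L ∧
      F.IsHomogeneous m ∧ F ≠ 0 ∧
      Submodule.restrictScalars k I ⊓ homogeneousSubmodule (Fin r) k d =
        (⨆ i : Fin (r - 3), Submodule.map (LinearMap.mulLeft k (L i))
          (homogeneousSubmodule (Fin r) k (d - 1))) ⊔
        Submodule.map (LinearMap.mulLeft k F)
          (homogeneousSubmodule (Fin r) k (d - m)) := by
  obtain ⟨n, rfl⟩ : ∃ n, d = n + 1 := ⟨d - 1, by omega⟩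
  have hcod := mul_choose_two_eq hm hmd
  rw [← hhd, hilb_eq_cod, show n + 1 + 2 = n + 3 from rfl] at hcod
  have hres : ∀ᶠ c in genericFilter k (Fin r),
      m ≤ cod (n + 1) (add (gp I (n + 1)) (linForm c) n) := by
    obtain ⟨Q, hQ, hQm⟩ := hgen
    refine (eventually_generic_iff.mpr ⟨Q, hQ, fun c hc => ?_⟩)
    rw [← hilb_sup_span hI]
    exact (hQm c hc).ge
  exact (greenAt hr hm (by omega) (gp I (n + 1)) gp_le hcod.le
    (le_of_eventually_cod gp_le hres)).exists_linearIndependent hmd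
end

section
/- Assume char k = 0. Let A = R/I be a standard graded algebra with Hilbert function h, r ≥ 3, and let d, m be integers with 1 ≤ m ≤ d. Suppose that the socle of A is zero in all degrees ≤ d−1, that h_d = C(d+2, 2) − C(d−m+2, 2), and that dim_k (A/(L))_d = m for a general linear form L. Then h_i = C(i+2, 2) − C(i−m+2, 2) for all 0 ≤ i ≤ d, i.e., h equals the Hilbert function of a plane curve of degree m up to degree d. -/
open MvPolynomial

section Semicontinuity

variable {k : Type*} [Field k]

lemma LinearIndependent.exists_biorthogonal {n W : Type*} [DecidableEq n] [AddCommGroup W]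
    [Module k W] {v : n → W} (hv : LinearIndependent k v) :
    ∃ φ : n → W →ₗ[k] k, ∀ i j, φ i (v j) = if j = i then 1 else 0 := by
  obtain ⟨g, hg⟩ := (Finsupp.linearCombination k v).exists_leftInverse_of_injective
    (LinearMap.ker_eq_bot.2 hv)
  refine ⟨fun i => Finsupp.lapply i ∘ₗ g, fun i j => ?_⟩
  have h := LinearMap.congr_fun hg (Finsupp.single j 1)
  simp only [LinearMap.comp_apply, Finsupp.linearCombination_single, one_smul,
    LinearMap.id_apply] at h
  simp [h, Finsupp.single_apply]

/-- Linear independence of vectors depending on parameters through a fixed algebra of functions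
is detected, near a point where it holds, by a function of that algebra. -/
lemma exists_linearIndependent_locus {X n W : Type*} [Fintype n] [AddCommGroup W] [Module k W]
    (P : Subalgebra k (X → k)) (f : n → X → W)
    (hf : ∀ i (φ : W →ₗ[k] k), (fun x => φ (f i x)) ∈ P) (x₀ : X)
    (h : LinearIndependent k fun i => f i x₀) :
    ∃ D ∈ P, D x₀ ≠ 0 ∧ ∀ x, D x ≠ 0 → LinearIndependent k fun i => f i x := by
  classical
  obtain ⟨φ, hφ⟩ := h.exists_biorthogonal
  let M : Matrix n n (X → k) := Matrix.of fun i j x => φ j (f i x)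
  have hM (x : X) : M.det x = (Matrix.of fun i j => φ j (f i x)).det := by
    have := RingHom.map_det (Pi.evalRingHom (fun _ : X => k) x) M
    rw [Pi.evalRingHom_apply] at this
    exact this
  refine ⟨M.det, ?_, ?_, fun x hx => ?_⟩
  · rw [Matrix.det_apply]
    refine P.sum_mem fun σ _ => ?_
    rw [Units.smul_def]
    exact zsmul_mem (P.prod_mem fun i _ => hf _ _) _
  · rw [hM]
    have : (Matrix.of fun i j => φ j (f i x₀)) = (1 : Matrix n n k) := by
      ext i j
      simp [hφ, Matrix.one_apply]
    simp [this]
  · rw [hM] at hx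
    have := Matrix.linearIndependent_rows_of_det_ne_zero hx
    exact LinearIndependent.of_comp (LinearMap.pi φ) this

lemma exists_basis_range {U W : Type*} [AddCommGroup U] [Module k U] [FiniteDimensional k U]
    [AddCommGroup W] [Module k W] (A : U →ₗ[k] W) :
    ∃ w : Fin (Module.finrank k (LinearMap.range A)) → U,
      LinearIndependent k (fun i => A (w i)) ∧
        Submodule.span k (Set.range fun i => A (w i)) = LinearMap.range A := by
  let b := Module.finBasis k (LinearMap.range A)
  choose w hw using fun i => (b i).2
  have hw' : (fun i => A (w i)) = (LinearMap.range A).subtype ∘ b := funext hw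
  refine ⟨w, ?_, ?_⟩
  · rw [hw']
    exact b.linearIndependent.map' _ (Submodule.ker_subtype _)
  · rw [hw', Set.range_comp, ← Submodule.map_span, b.span_eq, Submodule.map_subtype_top]

lemma card_le_finrank_range {U W n : Type*} [Fintype n] [AddCommGroup U] [Module k U]
    [FiniteDimensional k U] [AddCommGroup W] [Module k W] (A : U →ₗ[k] W) (w : n → U)
    (h : LinearIndependent k fun i => A (w i)) :
    Fintype.card n ≤ Module.finrank k (LinearMap.range A) := by
  have : LinearIndependent k fun i => (⟨A (w i), LinearMap.mem_range_self A _⟩ :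
      LinearMap.range A) := LinearIndependent.of_comp (LinearMap.range A).subtype h
  exact this.fintype_card_le_finrank

/-- The derivative of a family of linear maps of constant rank sends the kernel to the range. -/
lemma derivative_mem_range [Infinite k] {U W : Type*} [AddCommGroup U] [Module k U]
    [FiniteDimensional k U] [AddCommGroup W] [Module k W] (A : k → U →ₗ[k] W)
    (hrank : ∀ t, Module.finrank k (LinearMap.range (A t)) ≤
      Module.finrank k (LinearMap.range (A 0)))
    (B : U → W) (G : k → U → W) (hA : ∀ t x, A t x = A 0 x + t • B x + t ^ 2 • G t x)
    (hG : ∀ x (φ : W →ₗ[k] k), ∃ p : Polynomial k, ∀ t, φ (G t x) = p.eval t)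
    (x : U) (hx : A 0 x = 0) : B x ∈ LinearMap.range (A 0) := by
  by_contra hB
  obtain ⟨w, hw, hspan⟩ := exists_basis_range (A 0)
  rw [← hspan] at hB
  let P : Subalgebra k (k → k) := (Polynomial.aeval (id : k → k)).range
  have mem_P (f : k → k) (h : ∃ p : Polynomial k, ∀ t, f t = p.eval t) : f ∈ P := by
    obtain ⟨p, hp⟩ := h
    refine ⟨p, funext fun t => ?_⟩
    have h := Polynomial.aeval_algHom_apply (Pi.evalAlgHom k (fun _ : k => k) t) id p
    simp only [Pi.evalAlgHom_apply, id] at h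
    rw [hp]
    exact h.symm.trans (by simp)
  let f : Option (Fin (Module.finrank k (LinearMap.range (A 0)))) → k → W :=
    fun o t => o.elim (B x + t • G t x) (fun i => A t (w i))
  have hf : ∀ i (φ : W →ₗ[k] k), (fun t => φ (f i t)) ∈ P := by
    intro i φ
    apply mem_P
    cases i with
    | none =>
      obtain ⟨p, hp⟩ := hG x φ
      exact ⟨Polynomial.C (φ (B x)) + Polynomial.X * p, fun t => by simp [f, hp]⟩
    | some i =>
      obtain ⟨p, hp⟩ := hG (w i) φ
      exact ⟨Polynomial.C (φ (A 0 (w i))) + Polynomial.X * Polynomial.C (φ (B (w i))) +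
        Polynomial.X ^ 2 * p, fun t => by simp [f, hA t, hp, mul_comm t]⟩
  have h0 : LinearIndependent k fun i => f i 0 := by
    rw [linearIndependent_option]
    exact ⟨by simpa [f, Function.comp_def] using hw, by simpa [f, Function.comp_def] using hB⟩
  obtain ⟨D, ⟨p, hp⟩, hD0, hD⟩ := exists_linearIndependent_locus P f hf 0 h0
  have hDp (t : k) : D t = p.eval t := by
    have h := Polynomial.aeval_algHom_apply (Pi.evalAlgHom k (fun _ : k => k) t) id p
    simp only [Pi.evalAlgHom_apply, id] at h
    rw [← hp]
    exact h.symm.trans (by simp)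
  have hp0 : Polynomial.X * p ≠ 0 := by
    refine mul_ne_zero Polynomial.X_ne_zero ?_
    rintro rfl
    simp [hDp] at hD0
  obtain ⟨t, ht⟩ : ∃ t, (Polynomial.X * p).eval t ≠ 0 := by
    by_contra! h
    exact hp0 (Polynomial.funext fun t => by simpa using h t)
  simp only [Polynomial.eval_mul, Polynomial.eval_X, mul_ne_zero_iff, ← hDp] at ht
  obtain ⟨ht0, htD⟩ := ht
  have hind : LinearIndependent k fun o : Option (Fin (Module.finrank k (LinearMap.range (A 0)))) =>
      A t (o.elim (t⁻¹ • x) w) := by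
    convert! hD t htD using 2 with o
    cases o with
    | none =>
      simp only [f, Option.elim, map_smul, hA t x, hx, zero_add, smul_add, smul_smul]
      congr 2
      · simp [ht0]
      · field_simp
    | some i => rfl
  have := (card_le_finrank_range (A t) _ hind).trans (hrank t)
  simp at this

end Semicontinuity

section Generic

variable {k : Type*} [Field k] {ι : Type*}

/-- The filter of sets of points containing a nonempty basic Zariski-open set. -/
def zariskiGeneric (k : Type*) [Field k] (ι : Type*) : Filter (ι → k) where
  sets := {S | ∃ Q : MvPolynomial ι k, Q ≠ 0 ∧ ∀ c, eval c Q ≠ 0 → c ∈ S}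
  univ_sets := ⟨1, one_ne_zero, fun _ _ => trivial⟩
  sets_of_superset := by
    rintro S T ⟨Q, hQ, h⟩ hST
    exact ⟨Q, hQ, fun c hc => hST (h c hc)⟩
  inter_sets := by
    rintro S T ⟨Q, hQ, h⟩ ⟨Q', hQ', h'⟩
    refine ⟨Q * Q', mul_ne_zero hQ hQ', fun c hc => ?_⟩
    rw [map_mul, mul_ne_zero_iff] at hc
    exact ⟨h c hc.1, h' c hc.2⟩

lemma eventually_zariskiGeneric {p : (ι → k) → Prop} :
    (∀ᶠ c in zariskiGeneric k ι, p c) ↔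
      ∃ Q : MvPolynomial ι k, Q ≠ 0 ∧ ∀ c, eval c Q ≠ 0 → p c := Iff.rfl

instance [Infinite k] : (zariskiGeneric k ι).NeBot := by
  rw [Filter.neBot_iff]
  intro h
  have : ∀ᶠ _ in zariskiGeneric k ι, False := by simp [h]
  obtain ⟨Q, hQ, hc⟩ := eventually_zariskiGeneric.1 this
  exact hQ (MvPolynomial.funext fun c => by
    rw [map_zero]
    by_contra h'
    exact hc c h')

/-- A linear condition that holds generically holds everywhere. -/
lemma forall_mem_of_eventually_mem [Infinite k] [Finite ι] {S : Submodule k (ι → k)}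
    (h : ∀ᶠ c in zariskiGeneric k ι, c ∈ S) (c : ι → k) : c ∈ S := by
  classical
  have := Fintype.ofFinite ι
  by_contra hc
  obtain ⟨φ, hφ, hφS⟩ := Submodule.exists_le_ker_of_lt_top S
    (lt_top_iff_ne_top.2 fun h => hc (h ▸ Submodule.mem_top))
  have hne : ∀ᶠ c in zariskiGeneric k ι, φ c ≠ 0 := by
    refine ⟨∑ i, C (φ (Pi.single i 1)) * X i, fun h0 => hφ ?_, fun c hc => ?_⟩
    · refine LinearMap.pi_ext' fun i => LinearMap.ext_ring ?_
      have := congrArg (eval (Pi.single i 1)) h0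
      simpa [Pi.single_apply] using this
    · have : φ c = ∑ i, φ (Pi.single i 1) * c i := by
        conv_lhs => rw [pi_eq_sum_univ' c]
        simp [map_sum, mul_comm]
      simpa [this] using hc
  obtain ⟨c, h₁, h₂⟩ := (h.and hne).exists
  exact h₂ (hφS h₁)

/-- A family of vectors is polynomial if all its scalar coordinates are polynomial functions. -/
def PolynomialFamily {W : Type*} [AddCommGroup W] [Module k W] (f : (ι → k) → W) : Prop :=
  ∀ φ : W →ₗ[k] k, ∃ P : MvPolynomial ι k, ∀ c, φ (f c) = eval c P

namespace PolynomialFamily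

variable {W W' : Type*} [AddCommGroup W] [Module k W] [AddCommGroup W'] [Module k W']

lemma add {f g : (ι → k) → W} (hf : PolynomialFamily f) (hg : PolynomialFamily g) :
    PolynomialFamily fun c => f c + g c := fun φ => by
  obtain ⟨P, hP⟩ := hf φ
  obtain ⟨Q, hQ⟩ := hg φ
  exact ⟨P + Q, fun c => by simp [hP, hQ]⟩

lemma map {f : (ι → k) → W} (hf : PolynomialFamily f) (A : W →ₗ[k] W') :
    PolynomialFamily fun c => A (f c) := fun φ => hf (φ ∘ₗ A)

lemma of_eval {S : Type*} [CommRing S] [Algebra k S] (F : MvPolynomial ι S) :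
    PolynomialFamily fun c : ι → k => eval (fun i => algebraMap k S (c i)) F := by
  intro φ
  induction F using MvPolynomial.induction_on' with
  | monomial s a =>
    refine ⟨monomial s (φ a), fun c => ?_⟩
    simp only [eval_monomial, ← map_pow, Finsupp.prod, ← map_prod]
    rw [mul_comm, ← Algebra.smul_def, map_smul, smul_eq_mul, mul_comm]
  | add p q hp hq =>
    obtain ⟨P, hP⟩ := hp
    obtain ⟨Q, hQ⟩ := hq
    exact ⟨P + Q, fun c => by simp [hP, hQ]⟩

end PolynomialFamily

/-- A polynomial family of linear maps has maximal rank generically. -/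
lemma eventually_finrank_range_max {U W : Type*} [AddCommGroup U] [Module k U]
    [FiniteDimensional k U] [AddCommGroup W] [Module k W] (A : (ι → k) → U →ₗ[k] W)
    (hA : ∀ x, PolynomialFamily fun c => A c x) :
    ∀ᶠ c in zariskiGeneric k ι, ∀ c', Module.finrank k (LinearMap.range (A c')) ≤
      Module.finrank k (LinearMap.range (A c)) := by
  have hbdd : BddAbove (Set.range fun c => Module.finrank k (LinearMap.range (A c))) :=
    ⟨Module.finrank k U, by rintro _ ⟨c, rfl⟩; exact LinearMap.finrank_range_le _⟩
  obtain ⟨c₀, hc₀⟩ := Nat.sSup_mem (Set.range_nonempty _) hbdd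
  obtain ⟨w, hw, -⟩ := exists_basis_range (A c₀)
  let P : Subalgebra k ((ι → k) → k) := (MvPolynomial.aeval fun i (c : ι → k) => c i).range
  have eval_P (p : MvPolynomial ι k) (c : ι → k) :
      (MvPolynomial.aeval fun i (c : ι → k) => c i) p c = eval c p := by
    have h := MvPolynomial.comp_aeval_apply (fun i (c : ι → k) => c i)
      (Pi.evalAlgHom k (fun _ : ι → k => k) c) p
    simpa [MvPolynomial.aeval_eq_eval] using h
  obtain ⟨D, ⟨p, hp⟩, hD0, hD⟩ := exists_linearIndependent_locus P (fun i c => A c (w i))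
    (fun i φ => by
      obtain ⟨p, hp⟩ := hA (w i) φ
      exact ⟨p, funext fun c => (eval_P p c).trans (hp c).symm⟩) c₀ hw
  have hDp (c : ι → k) : D c = eval c p := by rw [← hp]; exact eval_P p c
  refine ⟨p, ?_, fun c hc c' => ?_⟩
  · rintro rfl
    simp [hDp] at hD0
  · refine (le_csSup hbdd ⟨c', rfl⟩).trans (hc₀ ▸ ?_)
    simpa using card_le_finrank_range (A c) w (hD c (by rwa [hDp]))

end Generic

section Derivative

variable {k : Type*} [Field k] {r : ℕ}

instance (e : ℕ) : Module.Finite k (homogeneousSubmodule (Fin r) k e) :=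
  Module.Finite.iff_fg.2 (homogeneousSubmodule_fg (Fin r) k e)

lemma linForm_isHomogeneous (c : Fin r → k) : (linForm c).IsHomogeneous 1 :=
  IsHomogeneous.sum _ _ _ fun i _ => isHomogeneous_C_mul_X (c i) i

lemma linForm_add_smul_single (c : Fin r → k) (t : k) (i : Fin r) :
    linForm (c + t • Pi.single i 1) = linForm c + C t * X i := by
  simp [linForm, add_mul, Finset.sum_add_distrib, Pi.single_apply, apply_ite C, ite_mul]

lemma coeff_linForm (c : Fin r → k) (i : Fin r) :
    coeff (Finsupp.single i 1) (linForm c) = c i := by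
  classical
  simp [linForm, coeff_sum, coeff_C_mul, coeff_X, Finsupp.single_left_inj]

lemma polynomialFamily_linForm_pow_mul (p : ℕ) (F : MvPolynomial (Fin r) k) :
    PolynomialFamily fun c : Fin r → k => linForm c ^ p * F := by
  convert! PolynomialFamily.of_eval (k := k) (ι := Fin r)
    ((∑ i, X i * C (X i)) ^ p * C F : MvPolynomial (Fin r) (MvPolynomial (Fin r) k)) using 2 with c
  simp [linForm, algebraMap_eq]

lemma exists_pow_add_C_mul_eq (n : ℕ) (L u : MvPolynomial (Fin r) k) :
    ∃ K : Polynomial (MvPolynomial (Fin r) k), ∀ t : k,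
      (L + C t * u) ^ n =
        L ^ n + C t * ((n : MvPolynomial (Fin r) k) * L ^ (n - 1) * u) +
          C t ^ 2 * K.eval (C t) := by
  obtain ⟨κ, hκ⟩ := Polynomial.powAddExpansion (Polynomial.C L) (Polynomial.X * Polynomial.C u) n
  refine ⟨κ * Polynomial.C u ^ 2, fun t => ?_⟩
  have := congrArg (Polynomial.eval (C t)) hκ
  simp only [Polynomial.eval_pow, Polynomial.eval_add, Polynomial.eval_mul, Polynomial.eval_C,
    Polynomial.eval_X, Polynomial.eval_natCast] at this ⊢
  rw [this]
  ring

lemma exists_polynomial_eval_C (ψ : MvPolynomial (Fin r) k →ₗ[k] k)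
    (K : Polynomial (MvPolynomial (Fin r) k)) :
    ∃ p : Polynomial k, ∀ t, ψ (K.eval (C t)) = p.eval t := by
  induction K using Polynomial.induction_on' with
  | add p q hp hq =>
    obtain ⟨P, hP⟩ := hp
    obtain ⟨Q, hQ⟩ := hq
    exact ⟨P + Q, fun t => by simp [hP, hQ]⟩
  | monomial n a =>
    refine ⟨Polynomial.monomial n (ψ a), fun t => ?_⟩
    simp only [Polynomial.eval_monomial]
    rw [← C_pow, mul_comm, ← smul_eq_C_mul, map_smul, smul_eq_mul, mul_comm]

/-- First-order deformation, for a general linear form `L`, of the solutions `(F, T)` of the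
system `L ^ p * F ∈ V`, `Y * F + L ^ n * T ∈ V`. -/
lemma eventually_exists_deformation [Infinite k] (V : Submodule k (MvPolynomial (Fin r) k))
    (p n a e : ℕ) (Y : MvPolynomial (Fin r) k) (i : Fin r) :
    ∀ᶠ c in zariskiGeneric k (Fin r), ∀ F ∈ homogeneousSubmodule (Fin r) k a,
      ∀ T ∈ homogeneousSubmodule (Fin r) k e,
      linForm c ^ p * F ∈ V → Y * F + linForm c ^ n * T ∈ V →
      ∃ F' ∈ homogeneousSubmodule (Fin r) k a, ∃ T' ∈ homogeneousSubmodule (Fin r) k e,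
        linForm c ^ p * F' + (p : MvPolynomial (Fin r) k) * linForm c ^ (p - 1) * X i * F ∈ V ∧
        Y * F' + (n : MvPolynomial (Fin r) k) * linForm c ^ (n - 1) * X i * T +
          linForm c ^ n * T' ∈ V := by
  let Ha := homogeneousSubmodule (Fin r) k a
  let He := homogeneousSubmodule (Fin r) k e
  let A (c : Fin r → k) : Ha × He →ₗ[k]
      (MvPolynomial (Fin r) k ⧸ V) × (MvPolynomial (Fin r) k ⧸ V) :=
    LinearMap.prod
      (V.mkQ ∘ₗ LinearMap.mulLeft k (linForm c ^ p) ∘ₗ Ha.subtype ∘ₗ LinearMap.fst k Ha He)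
      (V.mkQ ∘ₗ (LinearMap.mulLeft k Y ∘ₗ Ha.subtype ∘ₗ LinearMap.fst k Ha He +
        LinearMap.mulLeft k (linForm c ^ n) ∘ₗ He.subtype ∘ₗ LinearMap.snd k Ha He))
  have hA (c) (F : Ha) (T : He) : A c (F, T) = (V.mkQ (linForm c ^ p * F),
    V.mkQ (Y * F + linForm c ^ n * T)) := rfl
  have hpoly : ∀ x, PolynomialFamily fun c => A c x := by
    rintro ⟨F, T⟩
    have h := ((polynomialFamily_linForm_pow_mul p F.1).map
      (LinearMap.inl k _ (MvPolynomial (Fin r) k ⧸ V) ∘ₗ V.mkQ)).add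
      (((polynomialFamily_linForm_pow_mul 0 (Y * F.1)).add
        (polynomialFamily_linForm_pow_mul n T.1)).map
          (LinearMap.inr k (MvPolynomial (Fin r) k ⧸ V) _ ∘ₗ V.mkQ))
    convert! h using 2 with c
    simp [hA]
  filter_upwards [eventually_finrank_range_max A hpoly] with c hc F hF T hT h₁ h₂
  obtain ⟨K₁, hK₁⟩ := exists_pow_add_C_mul_eq p (linForm c) (X i)
  obtain ⟨K₂, hK₂⟩ := exists_pow_add_C_mul_eq n (linForm c) (X i)
  have key := derivative_mem_range (fun t => A (c + t • Pi.single i 1))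
    (fun t => (hc _).trans_eq (by rw [zero_smul, add_zero]))
    (fun x => (V.mkQ ((p : MvPolynomial (Fin r) k) * linForm c ^ (p - 1) * X i * x.1.1),
      V.mkQ ((n : MvPolynomial (Fin r) k) * linForm c ^ (n - 1) * X i * x.2.1)))
    (fun t x => (V.mkQ ((K₁ * Polynomial.C x.1.1).eval (C t)),
      V.mkQ ((K₂ * Polynomial.C x.2.1).eval (C t))))
    (fun t x => by
      obtain ⟨F, T⟩ := x
      simp only [hA, linForm_add_smul_single, hK₁, hK₂, zero_smul, add_zero, Prod.smul_mk,
        Prod.mk_add_mk, ← map_smul, ← map_add, smul_eq_C_mul, Polynomial.eval_mul,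
        Polynomial.eval_C, C_pow]
      congr 2 <;> ring)
    (fun x φ => by
      obtain ⟨p₁, hp₁⟩ := exists_polynomial_eval_C
        (φ ∘ₗ LinearMap.inl k _ (MvPolynomial (Fin r) k ⧸ V) ∘ₗ V.mkQ) (K₁ * Polynomial.C x.1.1)
      obtain ⟨p₂, hp₂⟩ := exists_polynomial_eval_C
        (φ ∘ₗ LinearMap.inr k (MvPolynomial (Fin r) k ⧸ V) _ ∘ₗ V.mkQ) (K₂ * Polynomial.C x.2.1)
      refine ⟨p₁ + p₂, fun t => ?_⟩
      rw [Polynomial.eval_add, ← hp₁, ← hp₂]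
      simp [← map_add])
    (⟨F, hF⟩, ⟨T, hT⟩) (by
      simp only [zero_smul, add_zero, hA, Prod.mk_eq_zero]
      exact ⟨(Submodule.Quotient.mk_eq_zero V).2 h₁, (Submodule.Quotient.mk_eq_zero V).2 h₂⟩)
  obtain ⟨⟨F', T'⟩, h'⟩ := key
  simp only [zero_smul, add_zero, hA, Prod.mk.injEq, ← sub_eq_zero (b := V.mkQ _), ← map_sub]
    at h'
  obtain ⟨h₁', h₂'⟩ := h'
  replace h₁' := (Submodule.Quotient.mk_eq_zero V).1 h₁'
  replace h₂' := (Submodule.Quotient.mk_eq_zero V).1 h₂'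
  refine ⟨-F', neg_mem F'.2, -T', neg_mem T'.2, ?_, ?_⟩
  · convert! neg_mem h₁' using 1
    ring
  · convert! neg_mem h₂' using 1
    ring

end Derivative

section Codimension

variable {k : Type*} [Field k] {r : ℕ}

local notation "𝓗" => homogeneousSubmodule (Fin r) k

/-- The codimension in degree `e` of a subspace of the polynomial ring. -/
noncomputable def codimIn (e : ℕ) (V : Submodule k (MvPolynomial (Fin r) k)) : ℕ :=
  Module.finrank k (homogeneousSubmodule (Fin r) k e) -
    Module.finrank k (V ⊓ homogeneousSubmodule (Fin r) k e : Submodule k _)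

/-- The multiples of `L` by forms of degree `e - 1`. -/
noncomputable def multiples (L : MvPolynomial (Fin r) k) :
    ℕ → Submodule k (MvPolynomial (Fin r) k)
  | 0 => ⊥
  | e + 1 => (homogeneousSubmodule (Fin r) k e).map (LinearMap.mulLeft k L)

/-- The preimage in degree `e` of the ideal quotient `(V : L ^ j)` restricted to `L = 0`. -/
noncomputable def colonRestr (V : Submodule k (MvPolynomial (Fin r) k))
    (L : MvPolynomial (Fin r) k) (j e : ℕ) : Submodule k (MvPolynomial (Fin r) k) :=
  V.comap (LinearMap.mulLeft k (L ^ j)) ⊔ multiples L e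

instance (e : ℕ) (V : Submodule k (MvPolynomial (Fin r) k)) :
    Module.Finite k (V ⊓ 𝓗 e : Submodule k _) :=
  Submodule.finiteDimensional_inf_right V (𝓗 e)

lemma finrank_inf_add_codimIn (e : ℕ) (V : Submodule k (MvPolynomial (Fin r) k)) :
    Module.finrank k (V ⊓ 𝓗 e : Submodule k _) + codimIn e V = Module.finrank k (𝓗 e) :=
  Nat.add_sub_cancel' (Submodule.finrank_mono inf_le_right)

lemma codimIn_anti {e : ℕ} {V V' : Submodule k (MvPolynomial (Fin r) k)} (h : V ⊓ 𝓗 e ≤ V') :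
    codimIn e V' ≤ codimIn e V :=
  Nat.sub_le_sub_left (Submodule.finrank_mono (le_inf h inf_le_right)) _

lemma codimIn_congr {e : ℕ} {V V' : Submodule k (MvPolynomial (Fin r) k)}
    (h : V ⊓ 𝓗 e = V' ⊓ 𝓗 e) : codimIn e V = codimIn e V' := by
  rw [codimIn, h, codimIn]

lemma inf_le_of_codimIn_le {e : ℕ} {V V' : Submodule k (MvPolynomial (Fin r) k)}
    (h : V ⊓ 𝓗 e ≤ V') (hc : codimIn e V ≤ codimIn e V') : V' ⊓ 𝓗 e ≤ V := by
  have h₁ := finrank_inf_add_codimIn e V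
  have h₂ := finrank_inf_add_codimIn e V'
  rw [← Submodule.eq_of_le_of_finrank_le (le_inf h inf_le_right) (by omega)]
  exact inf_le_left

lemma codimIn_eq_zero {e : ℕ} {V : Submodule k (MvPolynomial (Fin r) k)} :
    codimIn e V = 0 ↔ 𝓗 e ≤ V := by
  refine ⟨fun h => ?_, fun h => ?_⟩
  · have := inf_le_of_codimIn_le (V := V) (V' := ⊤) (e := e) le_top (by omega)
    simpa using this
  · rw [codimIn, inf_eq_right.2 h, Nat.sub_self]

lemma mul_mem_homogeneous {L F : MvPolynomial (Fin r) k} {e : ℕ} (hL : L.IsHomogeneous 1)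
    (hF : F ∈ 𝓗 e) : L * F ∈ 𝓗 (e + 1) := by
  rw [add_comm]
  exact hL.mul hF

lemma multiples_le {L : MvPolynomial (Fin r) k} (hL : L.IsHomogeneous 1) (e : ℕ) :
    multiples L e ≤ 𝓗 e := by
  cases e with
  | zero => exact bot_le
  | succ e =>
    rintro _ ⟨F, hF, rfl⟩
    exact mul_mem_homogeneous hL hF

lemma X_mul_mem_multiples {L F : MvPolynomial (Fin r) k} {e : ℕ} (hF : F ∈ multiples L e)
    (i : Fin r) : X i * F ∈ multiples L (e + 1) := by
  cases e with
  | zero => simp [(Submodule.mem_bot k).1 hF]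
  | succ e =>
    obtain ⟨G, hG, rfl⟩ := hF
    exact ⟨X i * G, mul_mem_homogeneous (isHomogeneous_X k i) hG, by simp; ring⟩

lemma codimIn_zero_sup (V : Submodule k (MvPolynomial (Fin r) k)) (L : MvPolynomial (Fin r) k) :
    codimIn 0 (V ⊔ multiples L 0) = codimIn 0 V := by
  simp [multiples]

lemma codimIn_succ {L : MvPolynomial (Fin r) k} (hL : L.IsHomogeneous 1) (hL0 : L ≠ 0) (e : ℕ)
    (V : Submodule k (MvPolynomial (Fin r) k)) :
    codimIn (e + 1) V = codimIn (e + 1) (V ⊔ multiples L (e + 1)) +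
      codimIn e (V.comap (LinearMap.mulLeft k L)) := by
  have hinj : Function.Injective (LinearMap.mulLeft k L) := mul_right_injective₀ hL0
  have hM := multiples_le hL (e + 1)
  have h₁ := finrank_inf_add_codimIn (e + 1) V
  have h₂ := finrank_inf_add_codimIn (e + 1) (V ⊔ multiples L (e + 1))
  have h₃ := finrank_inf_add_codimIn e (V.comap (LinearMap.mulLeft k L))
  have : Module.Finite k (multiples L (e + 1)) := Submodule.finiteDimensional_of_le hM
  have h₄ := Submodule.finrank_sup_add_finrank_inf_eq (V ⊓ 𝓗 (e + 1)) (multiples L (e + 1))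
  have h₅ : (V ⊔ multiples L (e + 1)) ⊓ 𝓗 (e + 1) = V ⊓ 𝓗 (e + 1) ⊔ multiples L (e + 1) := by
    rw [sup_comm, sup_inf_assoc_of_le _ hM, sup_comm]
  have h₆ : Module.finrank k (multiples L (e + 1)) = Module.finrank k (𝓗 e) :=
    (Submodule.equivMapOfInjective _ hinj _).finrank_eq.symm
  have h₇ : V ⊓ 𝓗 (e + 1) ⊓ multiples L (e + 1) =
      (V.comap (LinearMap.mulLeft k L) ⊓ 𝓗 e).map (LinearMap.mulLeft k L) := by
    rw [inf_assoc, inf_eq_right.2 hM, Submodule.map_inf _ hinj, Submodule.map_comap_eq, multiples,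
      inf_comm (LinearMap.range _), inf_assoc, inf_eq_right.2 (LinearMap.map_le_range)]
  have h₈ : Module.finrank k ((V.comap (LinearMap.mulLeft k L) ⊓ 𝓗 e).map
      (LinearMap.mulLeft k L)) =
      Module.finrank k (V.comap (LinearMap.mulLeft k L) ⊓ 𝓗 e : Submodule k _) :=
    (Submodule.equivMapOfInjective _ hinj _).finrank_eq.symm
  rw [h₅] at h₂
  rw [h₇, h₈, h₆] at h₄
  omega

lemma comap_pow_succ (V : Submodule k (MvPolynomial (Fin r) k)) (L : MvPolynomial (Fin r) k)
    (j : ℕ) : (V.comap (LinearMap.mulLeft k (L ^ j))).comap (LinearMap.mulLeft k L) =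
      V.comap (LinearMap.mulLeft k (L ^ (j + 1))) := by
  ext F
  simp [pow_succ]

lemma codimIn_comap_pow_eq_sum {L : MvPolynomial (Fin r) k} (hL : L.IsHomogeneous 1) (hL0 : L ≠ 0)
    (V : Submodule k (MvPolynomial (Fin r) k)) (e j : ℕ) :
    codimIn e (V.comap (LinearMap.mulLeft k (L ^ j))) =
      ∑ i ∈ Finset.range (e + 1), codimIn i (colonRestr V L (j + e - i) i) := by
  induction e generalizing j with
  | zero => simp [colonRestr, codimIn_zero_sup]
  | succ e ih =>
    rw [codimIn_succ hL hL0, comap_pow_succ, ih, Finset.sum_range_succ _ (e + 1), add_comm]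
    congr 1
    · refine Finset.sum_congr rfl fun i _ => ?_
      rw [add_right_comm, add_assoc]
    · simp [colonRestr]

lemma comap_pow_zero (V : Submodule k (MvPolynomial (Fin r) k)) (L : MvPolynomial (Fin r) k) :
    V.comap (LinearMap.mulLeft k (L ^ 0)) = V := by
  ext
  simp

lemma codimIn_eq_sum {L : MvPolynomial (Fin r) k} (hL : L.IsHomogeneous 1) (hL0 : L ≠ 0)
    (V : Submodule k (MvPolynomial (Fin r) k)) (d : ℕ) :
    codimIn d V = ∑ i ∈ Finset.range (d + 1), codimIn i (colonRestr V L (d - i) i) := by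
  simpa [comap_pow_zero] using codimIn_comap_pow_eq_sum hL hL0 V d 0

/-- Forms of degree `e + 1` are generated by the products of variables and forms of degree `e`. -/
lemma homogeneous_succ_le {e : ℕ} {S : Submodule k (MvPolynomial (Fin r) k)}
    (h : ∀ F ∈ 𝓗 e, ∀ i, X i * F ∈ S) : 𝓗 (e + 1) ≤ S := by
  classical
  intro F hF
  rw [F.as_sum]
  refine S.sum_mem fun s hs => ?_
  have hdeg : s.degree = e + 1 := by
    by_contra hne
    exact mem_support_iff.1 hs (IsHomogeneous.coeff_eq_zero hF hne)
  obtain ⟨i, hi⟩ : ∃ i, s i ≠ 0 := by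
    by_contra! h0
    have : s = 0 := Finsupp.ext h0
    simp [this] at hdeg
  have hs' : s - Finsupp.single i 1 + Finsupp.single i 1 = s :=
    tsub_add_cancel_of_le (Finsupp.single_le_iff.2 (Nat.one_le_iff_ne_zero.2 hi))
  have hdeg' : (s - Finsupp.single i 1).degree = e := by
    have := congrArg Finsupp.degree hs'
    rw [map_add, hdeg, Finsupp.degree_single] at this
    omega
  have := h (monomial (s - Finsupp.single i 1) (coeff s F)) (isHomogeneous_monomial _ hdeg') i
  rwa [X, monomial_mul, one_mul, add_comm, hs'] at this

end Codimension

section Transversality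

variable {k : Type*} [Field k] {r : ℕ}

local notation "𝓗" => homogeneousSubmodule (Fin r) k

lemma eventually_linForm_ne_zero [NeZero r] :
    ∀ᶠ c in zariskiGeneric k (Fin r), linForm c ≠ 0 := by
  refine eventually_zariskiGeneric.2 ⟨X 0, X_ne_zero 0, fun c hc h => hc ?_⟩
  rw [eval_X, ← coeff_linForm c, h, coeff_zero]

lemma linForm_mul_mem {S : Submodule k (MvPolynomial (Fin r) k)} {F : MvPolynomial (Fin r) k}
    (h : ∀ i, X i * F ∈ S) (c : Fin r → k) : linForm c * F ∈ S := by
  rw [linForm, Finset.sum_mul]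
  refine S.sum_mem fun i _ => ?_
  rw [mul_assoc, ← smul_eq_C_mul]
  exact S.smul_mem _ (h i)

/-- Multiplication by a variable sends the degree `e` part of the ideal quotient `(V : L ^ (j + 1))`
to that of `(V : L ^ j)` restricted to `L = 0`. -/
def IsTransversal (V : Submodule k (MvPolynomial (Fin r) k)) (L : MvPolynomial (Fin r) k)
    (d : ℕ) : Prop :=
  ∀ e < d, ∀ F ∈ 𝓗 e, L ^ (d - e) * F ∈ V → ∀ i,
    X i * F ∈ colonRestr V L (d - (e + 1)) (e + 1)

lemma eventually_isTransversal [CharZero k] (V : Submodule k (MvPolynomial (Fin r) k)) (d : ℕ) :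
    ∀ᶠ c in zariskiGeneric k (Fin r), IsTransversal V (linForm c) d := by
  have h := (Filter.eventually_all_finset (Finset.range d)).2 fun e _ =>
    Filter.eventually_all.2 fun i => eventually_exists_deformation V (d - e) 0 e 0 0 i
  filter_upwards [h] with c hc e he F hF hFV i
  obtain ⟨F', hF', -, -, h', -⟩ :=
    hc e (Finset.mem_range.2 he) i F hF 0 (Submodule.zero_mem _) hFV (by simp)
  obtain ⟨j, hj⟩ : ∃ j, d - e = j + 1 := ⟨d - e - 1, by omega⟩
  have hj' : d - (e + 1) = j := by omega
  rw [hj, Nat.add_sub_cancel] at h'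
  rw [hj']
  have hne : ((j + 1 : ℕ) : k) ≠ 0 := Nat.cast_ne_zero.2 j.succ_ne_zero
  rw [← Submodule.smul_mem_iff _ hne]
  have hsum : ((j + 1 : ℕ) : k) • (X i * F) =
      (linForm c * F' + C ((j + 1 : ℕ) : k) * (X i * F)) + linForm c * -F' := by
    rw [smul_eq_C_mul]
    ring
  rw [hsum]
  refine Submodule.add_mem_sup ?_ ⟨-F', Submodule.neg_mem _ hF', rfl⟩
  rw [Submodule.mem_comap, LinearMap.mulLeft_apply]
  convert h' using 1
  rw [map_natCast]
  ring

lemma IsTransversal.X_mul_mem {V : Submodule k (MvPolynomial (Fin r) k)}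
    {L : MvPolynomial (Fin r) k} {d : ℕ} (h : IsTransversal V L d) (hL : L.IsHomogeneous 1)
    {e : ℕ} (he : e < d) {F : MvPolynomial (Fin r) k} (hF : F ∈ 𝓗 e)
    (hFZ : F ∈ colonRestr V L (d - e) e) (i : Fin r) :
    X i * F ∈ colonRestr V L (d - (e + 1)) (e + 1) := by
  obtain ⟨G, hG, M, hM, rfl⟩ := Submodule.mem_sup.1 hFZ
  have hG' : G ∈ 𝓗 e := (Submodule.add_mem_iff_left _ (multiples_le hL e hM)).1 hF
  rw [mul_add]
  exact Submodule.add_mem _ (h e he G hG' hG i)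
    (Submodule.mem_sup_right (X_mul_mem_multiples hM i))

/-- In degree `d`, a general linear form either generates everything modulo `V`, or leaves a
codimension that is smaller by at least `d`. -/
lemma eventually_codimIn_sup_multiples [CharZero k] [NeZero r]
    (V : Submodule k (MvPolynomial (Fin r) k)) (d : ℕ) :
    ∀ᶠ c in zariskiGeneric k (Fin r), codimIn d (V ⊔ multiples (linForm c) d) = 0 ∨
      codimIn d (V ⊔ multiples (linForm c) d) + d ≤ codimIn d V := by
  filter_upwards [eventually_isTransversal V d, eventually_linForm_ne_zero] with c hc hc0
  rw [or_iff_not_imp_left]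
  intro hpos
  have hL := linForm_isHomogeneous c
  have hsum := codimIn_eq_sum hL hc0 V d
  rw [Finset.sum_range_succ, add_comm, Nat.sub_self, colonRestr, comap_pow_zero] at hsum
  rw [hsum]
  refine Nat.add_le_add_left ?_ _
  have hpos' : ∀ e ≤ d, codimIn e (colonRestr V (linForm c) (d - e) e) ≠ 0 := by
    intro e he h0
    have hzero : ∀ n, e ≤ n → n ≤ d → codimIn n (colonRestr V (linForm c) (d - n) n) = 0 := by
      intro n hn
      induction n, hn using Nat.le_induction with
      | base => exact fun _ => h0
      | succ n _ ih =>
        intro hnd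
        exact codimIn_eq_zero.2 (homogeneous_succ_le fun F hF i =>
          hc.X_mul_mem hL hnd hF (codimIn_eq_zero.1 (ih (by omega)) hF) i)
    have := hzero d he le_rfl
    rw [Nat.sub_self, colonRestr, comap_pow_zero] at this
    exact hpos this
  calc d = ∑ e ∈ Finset.range d, 1 := by simp
    _ ≤ _ := Finset.sum_le_sum fun e he =>
      Nat.one_le_iff_ne_zero.2 (hpos' e (Finset.mem_range.1 he).le)

/-- The codimensions of the restricted ideal quotients do not grow once they are small. -/
lemma IsTransversal.codimIn_succ_le [CharZero k] [NeZero r]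
    {V : Submodule k (MvPolynomial (Fin r) k)} {L : MvPolynomial (Fin r) k} {d : ℕ}
    (h : IsTransversal V L d) (hL : L.IsHomogeneous 1) {e : ℕ} (he : e < d)
    (hle : codimIn e (colonRestr V L (d - e) e) ≤ e) :
    codimIn (e + 1) (colonRestr V L (d - (e + 1)) (e + 1)) ≤
      codimIn e (colonRestr V L (d - e) e) := by
  obtain ⟨c, hc, hc0⟩ := ((eventually_codimIn_sup_multiples (colonRestr V L (d - e) e) e).and
    eventually_linForm_ne_zero).exists
  have hu := linForm_isHomogeneous c
  have hzero : codimIn e (colonRestr V L (d - e) e ⊔ multiples (linForm c) e) = 0 := by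
    omega
  rw [codimIn_eq_zero] at hzero
  rw [codimIn_succ hu hc0, codimIn_eq_zero.2 (homogeneous_succ_le fun F hF i => ?_), zero_add]
  · exact codimIn_anti fun F hF => linForm_mul_mem (h.X_mul_mem hL he hF.2 hF.1) c
  · obtain ⟨G, hG, M, hM, rfl⟩ := Submodule.mem_sup.1 (hzero hF)
    have hG' : G ∈ 𝓗 e := (Submodule.add_mem_iff_left _ (multiples_le hu e hM)).1 hF
    rw [mul_add]
    exact Submodule.add_mem_sup (h.X_mul_mem hL he hG' hG i) (X_mul_mem_multiples hM i)

end Transversality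

lemma choose_sub_choose_eq_sum (m d : ℕ) : Nat.choose (d + 2) 2 - Nat.choose (d + 2 - m) 2 =
    ∑ e ∈ Finset.range (d + 1), min m (e + 1) := by
  induction d with
  | zero =>
    rcases m with _ | _ | m
    · simp
    · simp
    · simp
  | succ d ih =>
    have hstep (n : ℕ) : Nat.choose (n + 1) 2 = n + Nat.choose n 2 := by
      rw [Nat.choose_succ_succ' n 1, Nat.choose_one_right]
    rw [Finset.sum_range_succ, ← ih, show d + 1 + 2 = d + 2 + 1 by ring, hstep (d + 2)]
    have hle := Nat.choose_le_choose 2 (Nat.sub_le (d + 2) m)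
    rcases le_or_gt m (d + 2) with hm | hm
    · rw [Nat.succ_sub hm, Nat.succ_eq_add_one, hstep (d + 2 - m)]
      omega
    · rw [show d + 2 + 1 - m = 0 by omega, show d + 2 - m = 0 by omega]
      simp only [Nat.choose_zero_succ]
      omega

section ExtremalCodimension

variable {k : Type*} [Field k] [CharZero k] {r : ℕ} [NeZero r]
  {V : Submodule k (MvPolynomial (Fin r) k)} {L : MvPolynomial (Fin r) k} {d m : ℕ}

local notation "𝓗" => homogeneousSubmodule (Fin r) k

lemma IsTransversal.min_le_codimIn (h : IsTransversal V L d) (hL : L.IsHomogeneous 1)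
    (hm : min m (d + 1) ≤ codimIn d (V ⊔ multiples L d)) {e : ℕ} (he : e ≤ d) :
    min m (e + 1) ≤ codimIn e (colonRestr V L (d - e) e) := by
  by_contra! hlt
  have hlt' : ∀ n, e ≤ n → n ≤ d →
      codimIn n (colonRestr V L (d - n) n) < min m (n + 1) := by
    intro n hn
    induction n, hn using Nat.le_induction with
    | base => exact fun _ => hlt
    | succ n _ ih =>
      intro hnd
      have h₁ := ih (by omega)
      have h₂ := h.codimIn_succ_le hL hnd (by omega)
      omega
  have := hlt' d he le_rfl
  rw [Nat.sub_self, colonRestr, comap_pow_zero] at this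
  omega

lemma IsTransversal.codimIn_eq_min (h : IsTransversal V L d) (hL : L.IsHomogeneous 1) (hL0 : L ≠ 0)
    (hm : min m (d + 1) ≤ codimIn d (V ⊔ multiples L d))
    (hV : codimIn d V = ∑ e ∈ Finset.range (d + 1), min m (e + 1)) {e : ℕ} (he : e ≤ d) :
    codimIn e (colonRestr V L (d - e) e) = min m (e + 1) := by
  have hle : ∀ i ∈ Finset.range (d + 1),
      min m (i + 1) ≤ codimIn i (colonRestr V L (d - i) i) := fun i hi =>
    h.min_le_codimIn hL hm (Finset.mem_range_succ_iff.1 hi)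
  exact ((Finset.sum_eq_sum_iff_of_le hle).1 (hV.symm.trans (codimIn_eq_sum hL hL0 V d)) e
    (Finset.mem_range_succ_iff.2 he)).symm

/-- If the restricted ideal quotients have the codimensions of a plane curve of degree `m`, then
multiplication by a general linear form is injective on the quotients by them. -/
lemma eventually_mem_of_linForm_mul_mem (h : IsTransversal V L d) (hL : L.IsHomogeneous 1)
    (hβ : ∀ e ≤ d, codimIn e (colonRestr V L (d - e) e) = min m (e + 1)) {e : ℕ} (he : e < d) :
    ∀ᶠ c in zariskiGeneric k (Fin r), ∀ F ∈ 𝓗 e,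
      linForm c * F ∈ colonRestr V L (d - (e + 1)) (e + 1) → F ∈ colonRestr V L (d - e) e := by
  filter_upwards [eventually_codimIn_sup_multiples (colonRestr V L (d - (e + 1)) (e + 1)) (e + 1),
    eventually_linForm_ne_zero] with c hc hc0 F hF hFZ
  have hu := linForm_isHomogeneous c
  have h₁ := codimIn_succ hu hc0 e (colonRestr V L (d - (e + 1)) (e + 1))
  have h₂ := hβ e he.le
  have h₃ := hβ (e + 1) he
  refine inf_le_of_codimIn_le (V := colonRestr V L (d - e) e)
    (V' := (colonRestr V L (d - (e + 1)) (e + 1)).comap (LinearMap.mulLeft k (linForm c)))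
    (fun G hG => linForm_mul_mem (h.X_mul_mem hL he hG.2 hG.1) c) ?_ ⟨hFZ, hF⟩
  omega

end ExtremalCodimension

section Socle

variable {k : Type*} [Field k] [CharZero k] {r : ℕ}
  {V : Submodule k (MvPolynomial (Fin r) k)} {L : MvPolynomial (Fin r) k} {D n e : ℕ}

local notation "𝓗" => homogeneousSubmodule (Fin r) k

/-- The forms `T i` through which `X i * F` is divisible by `L ^ (n + 1)` modulo `V` lie in the
ideal quotient `(V : L ^ (n + 1))` restricted to `L = 0`. -/
lemma mem_colonRestr_of_deformation (hL : L.IsHomogeneous 1) (hne : n + e = D)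
    (hinj : ∀ᶠ c in zariskiGeneric k (Fin r), ∀ F ∈ 𝓗 e,
      linForm c * F ∈ colonRestr V L n (e + 1) → F ∈ colonRestr V L (n + 1) e)
    (hdiv : ∀ F ∈ 𝓗 D, L * F ∈ V → ∀ i, ∃ T ∈ 𝓗 e, X i * F + L ^ (n + 1) * T ∈ V)
    (hdef : ∀ i j, ∀ F ∈ 𝓗 D, ∀ T ∈ 𝓗 e, L * F ∈ V → X i * F + L ^ (n + 1) * T ∈ V →
      ∃ F' ∈ 𝓗 D, ∃ T' ∈ 𝓗 e, L * F' + X j * F ∈ V ∧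
        X i * F' + C (n + 1 : k) * L ^ n * X j * T + L ^ (n + 1) * T' ∈ V)
    {F : MvPolynomial (Fin r) k} (hF : F ∈ 𝓗 D) (hLF : L * F ∈ V)
    {T : Fin r → MvPolynomial (Fin r) k} (hT : ∀ i, T i ∈ 𝓗 e)
    (hFT : ∀ i, X i * F + L ^ (n + 1) * T i ∈ V) (i : Fin r) :
    T i ∈ colonRestr V L (n + 1) e := by
  have key (i j : Fin r) :
      X i * T j + C (n + 1 : k) * (X j * T i) ∈ colonRestr V L n (e + 1) := by
    obtain ⟨F', hF', T', hT', h₁, h₂⟩ := hdef i j F hF (T i) (hT i) hLF (hFT i)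
    have hF₁ : F' - L ^ n * T j ∈ 𝓗 D := by
      refine Submodule.sub_mem _ hF' ?_
      rw [← hne]
      simpa using (hL.pow n).mul (hT j)
    obtain ⟨T'', hT'', h₃⟩ := hdiv _ hF₁ (by
      convert V.sub_mem h₁ (hFT j) using 1
      ring) i
    have hsum : X i * T j + C (n + 1 : k) * (X j * T i) =
        X i * T j + C (n + 1 : k) * (X j * T i) + L * (T' - T'') + L * (T'' - T') := by
      ring
    rw [hsum]
    refine Submodule.add_mem_sup ?_ ⟨T'' - T', Submodule.sub_mem _ hT'' hT', rfl⟩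
    rw [Submodule.mem_comap, LinearMap.mulLeft_apply]
    convert V.sub_mem h₂ h₃ using 1
    ring
  let Φ : (Fin r → k) →ₗ[k] MvPolynomial (Fin r) k := Fintype.linearCombination k T
  have hΦ (c) : Φ c = ∑ i, C (c i) * T i := by
    simp [Φ, Fintype.linearCombination_apply, smul_eq_C_mul]
  have hgen : ∀ᶠ c in zariskiGeneric k (Fin r), c ∈ (colonRestr V L (n + 1) e).comap Φ := by
    filter_upwards [hinj] with c hc
    have hn : (n + 2 : k) ≠ 0 := by exact_mod_cast (n + 1).succ_ne_zero
    refine hc _ ?_ ?_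
    · rw [hΦ]
      exact Submodule.sum_mem _ fun i _ => by
        rw [← smul_eq_C_mul]
        exact Submodule.smul_mem _ _ (hT i)
    · rw [← Submodule.smul_mem_iff _ hn]
      have hsum : (n + 2 : k) • (linForm c * Φ c) =
          ∑ i, ∑ j, (c i * c j) • (X i * T j + C (n + 1 : k) * (X j * T i)) := by
        have h₁ : linForm c * Φ c = ∑ i, ∑ j, (c i * c j) • (X i * T j) := by
          rw [hΦ, linForm, Finset.sum_mul_sum]
          refine Finset.sum_congr rfl fun i _ => Finset.sum_congr rfl fun j _ => ?_
          rw [smul_eq_C_mul, C_mul]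
          ring
        have h₂ : linForm c * Φ c = ∑ i, ∑ j, (c i * c j) • (X j * T i) := by
          rw [h₁, Finset.sum_comm]
          refine Finset.sum_congr rfl fun i _ => Finset.sum_congr rfl fun j _ => ?_
          rw [mul_comm (c j)]
        have h₃ : (n + 2 : k) • (linForm c * Φ c) =
            linForm c * Φ c + (n + 1 : k) • (linForm c * Φ c) := by
          rw [show (n + 2 : k) = 1 + (n + 1) by ring, add_smul, one_smul]
        rw [h₃]
        nth_rw 1 [h₁]
        rw [h₂, Finset.smul_sum, ← Finset.sum_add_distrib]
        refine Finset.sum_congr rfl fun i _ => ?_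
        rw [Finset.smul_sum, ← Finset.sum_add_distrib]
        refine Finset.sum_congr rfl fun j _ => ?_
        rw [smul_add, ← smul_eq_C_mul, smul_comm]
      rw [hsum]
      exact Submodule.sum_mem _ fun i _ => Submodule.sum_mem _ fun j _ =>
        Submodule.smul_mem _ _ (key i j)
  have := forall_mem_of_eventually_mem hgen (Pi.single i 1)
  simpa [Φ] using this

/-- If `V` has the codimension of a plane curve of degree `m` in degree `D + 1`, and so has a
general hyperplane restriction, then a form of degree `D` multiplied into `V` by a general linear
form is multiplied into `V` by every linear form. -/
lemma eventually_X_mul_mem [NeZero r] {m : ℕ}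
    (hV : codimIn (D + 1) V = ∑ e ∈ Finset.range (D + 2), min m (e + 1))
    (hm : ∀ᶠ c in zariskiGeneric k (Fin r),
      min m (D + 2) ≤ codimIn (D + 1) (V ⊔ multiples (linForm c) (D + 1))) :
    ∀ᶠ c in zariskiGeneric k (Fin r), ∀ F ∈ 𝓗 D, linForm c * F ∈ V → ∀ i, X i * F ∈ V := by
  have hdef := (Filter.eventually_all_finset (Finset.range (D + 1))).2 fun n _ =>
    Filter.eventually_all.2 fun i => Filter.eventually_all.2 fun j =>
      eventually_exists_deformation V 1 (n + 1) D (D - n) (X i) j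
  filter_upwards [eventually_isTransversal V (D + 1), eventually_linForm_ne_zero, hm, hdef]
    with c hc hc0 hmc hdef
  set L := linForm c
  have hL : L.IsHomogeneous 1 := linForm_isHomogeneous c
  have hβ : ∀ e ≤ D + 1, codimIn e (colonRestr V L (D + 1 - e) e) = min m (e + 1) :=
    fun e he => hc.codimIn_eq_min hL hc0 hmc hV he
  have hmem {n e : ℕ} (hne : n + e = D)
      (hdiv : ∀ F ∈ 𝓗 D, L * F ∈ V → ∀ i, ∃ T ∈ 𝓗 e, X i * F + L ^ (n + 1) * T ∈ V) :
      ∀ F ∈ 𝓗 D, L * F ∈ V → ∀ i, ∃ T ∈ colonRestr V L (n + 1) e,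
        T ∈ 𝓗 e ∧ X i * F + L ^ (n + 1) * T ∈ V := by
    intro F hF hLF
    choose T hT hFT using hdiv F hF hLF
    have hinj := eventually_mem_of_linForm_mul_mem hc hL hβ (e := e) (by omega)
    rw [show D + 1 - (e + 1) = n by omega, show D + 1 - e = n + 1 by omega] at hinj
    refine fun i => ⟨T i, mem_colonRestr_of_deformation hL hne hinj hdiv
      (fun i j F hF T hT h₁ h₂ => ?_) hF hLF hT hFT i, hT i, hFT i⟩
    have := hdef n (Finset.mem_range.2 (by omega)) i j F hF T
    rw [show D - n = e by omega] at this
    simpa using this hT (by simpa using h₁) h₂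
  have hdiv : ∀ n e, n + e = D →
      ∀ F ∈ 𝓗 D, L * F ∈ V → ∀ i, ∃ T ∈ 𝓗 e, X i * F + L ^ (n + 1) * T ∈ V := by
    intro n
    induction n with
    | zero =>
      intro e he F hF hLF i
      have := hc D D.lt_succ_self F hF (by simpa using hLF) i
      rw [Nat.sub_self, colonRestr, comap_pow_zero] at this
      obtain ⟨G, hG, _, ⟨T, hT, rfl⟩, hGT⟩ := Submodule.mem_sup.1 this
      rw [zero_add] at he
      refine ⟨-T, Submodule.neg_mem _ (he ▸ hT), ?_⟩
      convert hG using 1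
      rw [← hGT, LinearMap.mulLeft_apply]
      ring
    | succ n ih =>
      intro e he F hF hLF i
      obtain ⟨T, hT, -, hFT⟩ := hmem (show n + (e + 1) = D by omega) (ih _ (by omega)) F hF hLF i
      obtain ⟨T₀, hT₀, _, ⟨T₁, hT₁, rfl⟩, rfl⟩ := Submodule.mem_sup.1 hT
      refine ⟨T₁, hT₁, ?_⟩
      convert V.sub_mem hFT hT₀ using 1
      simp only [LinearMap.mulLeft_apply]
      ring
  intro F hF hLF i
  obtain ⟨T, hT, -, hFT⟩ := hmem (add_zero D) (hdiv D 0 (add_zero D)) F hF hLF i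
  rw [colonRestr, multiples, sup_bot_eq] at hT
  exact (V.add_mem_iff_left hT).1 hFT

end Socle

section HilbertFunction

variable {k : Type*} [Field k] {r : ℕ}

local notation "𝓗" => homogeneousSubmodule (Fin r) k

lemma hilb_eq_codimIn (I : Ideal (MvPolynomial (Fin r) k)) (d : ℕ) :
    hilb k r I d = codimIn d (I.restrictScalars k) := by
  let f := (Ideal.Quotient.mkₐ k I).toLinearMap
  have hker : LinearMap.ker f = I.restrictScalars k := by
    ext F
    simp [f, Ideal.Quotient.eq_zero_iff_mem]
  have h₁ := LinearMap.finrank_range_add_finrank_ker (f.domRestrict (𝓗 d))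
  rw [LinearMap.range_domRestrict, LinearMap.ker_domRestrict, hker,
    ← Submodule.finrank_map_subtype_eq, Submodule.map_comap_subtype, inf_comm] at h₁
  have h₂ := finrank_inf_add_codimIn d (I.restrictScalars k)
  have h₃ : hilb k r I d = Module.finrank k ((𝓗 d).map f) := rfl
  omega

lemma mem_of_socDim_eq_zero {I : Ideal (MvPolynomial (Fin r) k)} {i : ℕ}
    (h : socDim k r I i = 0) {F : MvPolynomial (Fin r) k} (hF : F ∈ 𝓗 i)
    (hFI : ∀ j, X j * F ∈ I) : F ∈ I := by
  have : Module.Finite k (𝓗 i ⊓ ⨅ j : Fin r, Submodule.comap (LinearMap.mulLeft k (X j))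
      (Submodule.restrictScalars k I) : Submodule k _) :=
    Submodule.finiteDimensional_inf_left _ _
  have hbot := Submodule.finrank_eq_zero.1 h
  have hmem : Ideal.Quotient.mk I F ∈ (⊥ : Submodule k (MvPolynomial (Fin r) k ⧸ I)) := by
    rw [← hbot]
    exact ⟨F, ⟨hF, by simpa [Submodule.mem_iInf] using hFI⟩, rfl⟩
  exact Ideal.Quotient.eq_zero_iff_mem.1 ((Submodule.mem_bot k).1 hmem)

lemma codimIn_sup_span_le (I : Ideal (MvPolynomial (Fin r) k)) (L : MvPolynomial (Fin r) k)
    (d : ℕ) : codimIn d ((I ⊔ Ideal.span {L}).restrictScalars k) ≤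
      codimIn d (I.restrictScalars k ⊔ multiples L d) := by
  refine codimIn_anti (inf_le_left.trans (sup_le (fun F hF => Ideal.mem_sup_left hF) ?_))
  cases d with
  | zero => exact bot_le
  | succ d =>
    rintro _ ⟨F, -, rfl⟩
    exact Ideal.mem_sup_right (Ideal.mem_span_singleton.2 (dvd_mul_right L F))

/-- If the socle of `R/I` vanishes below degree `d`, and `R/I` and a general hyperplane section
have in degree `d` the dimension of a plane curve of degree `m`, then so does `R/I` up to
degree `d`. -/
lemma codimIn_eq_sum_of_socle_eq_zero [CharZero k] [NeZero r]
    {I : Ideal (MvPolynomial (Fin r) k)} {d m : ℕ}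
    (hsoc : ∀ i < d, ∀ F ∈ 𝓗 i, (∀ j, X j * F ∈ I) → F ∈ I)
    (hd : codimIn d (I.restrictScalars k) = ∑ e ∈ Finset.range (d + 1), min m (e + 1))
    (hm : ∀ᶠ c in zariskiGeneric k (Fin r),
      min m (d + 1) ≤ codimIn d (I.restrictScalars k ⊔ multiples (linForm c) d))
    {i : ℕ} (hi : i ≤ d) :
    codimIn i (I.restrictScalars k) = ∑ e ∈ Finset.range (i + 1), min m (e + 1) := by
  induction d with
  | zero =>
    obtain rfl : i = 0 := by omega
    exact hd
  | succ d ih =>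
    rcases Nat.le_succ_iff.1 hi with hi | rfl
    swap
    · exact hd
    have hβ : ∀ᶠ c in zariskiGeneric k (Fin r), ∀ e ≤ d + 1,
        codimIn e (colonRestr (I.restrictScalars k) (linForm c) (d + 1 - e) e) = min m (e + 1) := by
      filter_upwards [eventually_isTransversal (I.restrictScalars k) (d + 1),
        eventually_linForm_ne_zero, hm] with c hc hc0 hmc e he
      exact hc.codimIn_eq_min (linForm_isHomogeneous c) hc0 hmc hd he
    refine ih (fun i hi => hsoc i (by omega)) ?_ ?_ hi
    · obtain ⟨c, ⟨hβ, hc0⟩, hX⟩ :=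
        ((hβ.and eventually_linForm_ne_zero).and (eventually_X_mul_mem hd hm)).exists
      have hcolon : I.restrictScalars k ⊓ 𝓗 d =
          (I.restrictScalars k).comap (LinearMap.mulLeft k (linForm c ^ 1)) ⊓ 𝓗 d := by
        ext F
        refine and_congr_left fun hF => ⟨fun h => I.mul_mem_left _ h, fun h => ?_⟩
        exact hsoc d d.lt_succ_self F hF (hX F hF (by simpa using h))
      rw [codimIn_congr hcolon, codimIn_comap_pow_eq_sum (linForm_isHomogeneous c) hc0]
      refine Finset.sum_congr rfl fun e he => ?_
      rw [add_comm 1 d]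
      exact hβ e (Finset.mem_range.1 he).le
    · filter_upwards [hβ] with c hc
      rw [← hc d d.le_succ]
      refine codimIn_anti (inf_le_left.trans (sup_le_sup_right ?_ _))
      exact fun F hF => I.mul_mem_left _ hF

end HilbertFunction

/-- Proposition 2.7: under the hypotheses of Green's Theorem 4, if the socle of
`A = R/I` vanishes in all degrees `≤ d-1`, then
`h_i = C(i+2, 2) - C(i-m+2, 2)` for all `0 ≤ i ≤ d`, i.e. `h` equals the
Hilbert function of a plane curve of degree `m` up to degree `d`. -/
theorem hilbert_plane_curve_up_to_d
    (k : Type*) [Field k] [Infinite k] [CharZero k]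
    (r d m : ℕ) (hr : 3 ≤ r) (hm : 1 ≤ m) (hmd : m ≤ d)
    (I : Ideal (MvPolynomial (Fin r) k)) (hI : IsHomogIdeal I)
    (hlin : NoLinearForms I)
    (hsoc : ∀ i : ℕ, i ≤ d - 1 → socDim k r I i = 0)
    (hhd : hilb k r I d = Nat.choose (d + 2) 2 - Nat.choose (d + 2 - m) 2)
    (hgen : Generically k r (fun L => hilb k r (I ⊔ Ideal.span {L}) d = m)) :
    ∀ i : ℕ, i ≤ d →
      hilb k r I i = Nat.choose (i + 2) 2 - Nat.choose (i + 2 - m) 2 := by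
  have : NeZero r := ⟨by omega⟩
  intro i hi
  rw [choose_sub_choose_eq_sum, hilb_eq_codimIn]
  rw [choose_sub_choose_eq_sum, hilb_eq_codimIn] at hhd
  refine codimIn_eq_sum_of_socle_eq_zero
    (fun i hi F hF => mem_of_socDim_eq_zero (hsoc i (by omega)) hF) hhd ?_ hi
  refine (eventually_zariskiGeneric.2 hgen).mono fun c (hc : hilb k r _ d = m) => ?_
  refine (min_le_left _ _).trans (le_trans ?_ (codimIn_sup_span_le I (linForm c) d))
  rw [← hilb_eq_codimIn, hc]
end
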